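/- For every a > 0 there exist a sequence of finite connected vertex-transitive graphs Γ_n = (V_n, E_n) of diverging sizes and uniformly bounded degree with diameters satisfying D² ∼ |V_n|/(a·log|V_n|), a real number s(a) and a constant c(a) > 0, such that for all s ≥ s(a), limsup_{n→∞} P(τ_cov > t_s) ≤ P(χ > s) − c(a)·e^{−2s}, where χ is a standard Gumbel random variable and t_s = E_π(T_o)(log|V_n| + s). Moreover the sequence satisfies strong uniform transience: lim_{s→∞} limsup_{n→∞} max_{o∈V_n} E_o(L_o(t_mix(1/4)) − L_o(s)) = 0. -/

import Mathlib

open MeasureTheory Filter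

noncomputable section

/-- Heat kernel (transition semigroup) of the continuous-time rate-1 Markov chain with
one-step transition matrix `K`, given by the uniformization formula
`p_t = e^{-t} ∑_k (t^k/k!) K^k`. -/
def heatKer {V : Type} [Fintype V] [DecidableEq V] (K : Matrix V V ℝ) (t : ℝ) (x y : V) : ℝ :=
  ∑' k : ℕ, Real.exp (-t) * t ^ k / (Nat.factorial k : ℝ) * (K ^ k) x y

/-- A continuous-time Markov chain with jump matrix `K`: a family of path measures `P x`
(for the chain started at `x`), with right-continuous paths, whose finite-dimensional
distributions are given by the heat kernel of `K`. -/
structure CTMC (V : Type) [Fintype V] [DecidableEq V] (K : Matrix V V ℝ) where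
  Ω : Type
  mΩ : MeasurableSpace Ω
  P : V → @Measure Ω mΩ
  prob : ∀ x, IsProbabilityMeasure (P x)
  X : ℝ → Ω → V
  measX : ∀ (t : ℝ) (y : V), MeasurableSet[mΩ] {ω | X t ω = y}
  rightCts : ∀ (ω : Ω) (t : ℝ), ∃ ε > 0, ∀ s, t ≤ s → s < t + ε → X s ω = X t ω
  fdd : ∀ (x : V) (n : ℕ) (t : Fin (n + 1) → ℝ), Monotone t → t 0 = 0 →
    ∀ y : Fin (n + 1) → V,
      P x {ω | ∀ i, X (t i) ω = y i} =
        ENNReal.ofReal ((if y 0 = x then (1 : ℝ) else 0) *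
          ∏ i : Fin n, heatKer K (t i.succ - t i.castSucc) (y i.castSucc) (y i.succ))

namespace CTMC

variable {V : Type} [Fintype V] [DecidableEq V] {K : Matrix V V ℝ}

/-- Hitting time of a set of states. -/
def hit (W : CTMC V K) (A : Set V) (ω : W.Ω) : ℝ :=
  sInf {t : ℝ | 0 ≤ t ∧ W.X t ω ∈ A}

/-- Cover time: the first time every state has been visited. -/
def cov (W : CTMC V K) (ω : W.Ω) : ℝ :=
  sInf {t : ℝ | 0 ≤ t ∧ ∀ y : V, ∃ s, 0 ≤ s ∧ s ≤ t ∧ W.X s ω = y}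

/-- The uncovered set at time `t`. -/
def uncov (W : CTMC V K) (t : ℝ) (ω : W.Ω) : Set V :=
  {y | ∀ s, 0 ≤ s → s ≤ t → W.X s ω ≠ y}

/-- Local time at `y` up to time `t`. -/
def loc (W : CTMC V K) (y : V) (t : ℝ) (ω : W.Ω) : ℝ :=
  ∫ s in (0:ℝ)..t, (if W.X s ω = y then (1 : ℝ) else 0)

/-- Probability of an event for the walk started at `x`. -/
def prx (W : CTMC V K) (x : V) (S : Set W.Ω) : ℝ := (W.P x S).toReal

/-- Expectation of a path functional for the walk started at `x`. -/
def ex (W : CTMC V K) (x : V) (f : W.Ω → ℝ) : ℝ := ∫ ω, f ω ∂(W.P x)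

/-- Probability of an event for the walk started from the uniform (stationary) distribution. -/
def prpi (W : CTMC V K) (S : Set W.Ω) : ℝ :=
  (Fintype.card V : ℝ)⁻¹ * ∑ x : V, W.prx x S

/-- Expectation for the walk started from the uniform (stationary) distribution. -/
def epi (W : CTMC V K) (f : W.Ω → ℝ) : ℝ :=
  (Fintype.card V : ℝ)⁻¹ * ∑ x : V, W.ex x f

/-- Probability for the walk started from the initial distribution `a`. -/
def prw (W : CTMC V K) (a : V → ℝ) (S : Set W.Ω) : ℝ := ∑ x : V, a x * W.prx x S

/-- Expectation for the walk started from the initial distribution `a`. -/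
def exw (W : CTMC V K) (a : V → ℝ) (f : W.Ω → ℝ) : ℝ := ∑ x : V, a x * W.ex x f

end CTMC

/-- Total variation mixing time at level `1/4`. -/
def tmixTV {V : Type} [Fintype V] [DecidableEq V] (K : Matrix V V ℝ) : ℝ :=
  sInf {t : ℝ | 0 ≤ t ∧ ∀ x : V, ∑ y : V, |heatKer K t x y - (Fintype.card V : ℝ)⁻¹| ≤ 1 / 2}

/-- Transition matrix of the simple random walk on a graph. -/
def transMat {V : Type} [Fintype V] [DecidableEq V] (G : SimpleGraph V) [DecidableRel G.Adj] :
    Matrix V V ℝ :=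
  Matrix.of fun x y => if G.Adj x y then ((G.degree x : ℝ))⁻¹ else 0

/-- Diameter of a finite graph. -/
def gDiam {V : Type} [Fintype V] (G : SimpleGraph V) : ℕ :=
  Finset.univ.sup fun p : V × V => G.dist p.1 p.2

/-- Vertex-transitivity of a graph. -/
def IsVertexTransitive {V : Type} (G : SimpleGraph V) : Prop :=
  ∀ x y : V, ∃ φ : SimpleGraph.Iso G G, φ x = y

/-- A finite graph bundled together with a continuous-time rate-1 simple random walk on it. -/
structure GW where
  (V : Type) [fin : Fintype V] [deq : DecidableEq V]
  (G : SimpleGraph V) [adj : DecidableRel G.Adj]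
  (W : CTMC V (transMat G))

instance (B : GW) : Fintype B.V := B.fin
instance (B : GW) : DecidableEq B.V := B.deq
instance (B : GW) : DecidableRel B.G.Adj := B.adj
instance (B : GW) : MeasurableSpace B.W.Ω := B.W.mΩ

/-- Number of vertices. -/
def GW.nV (B : GW) : ℕ := Fintype.card B.V

/-- Diameter. -/
def GW.D (B : GW) : ℕ := gDiam B.G

/-- `f(n)`, defined by `n = D² f(n)`. -/
def GW.fgrowth (B : GW) : ℝ := (B.nV : ℝ) / (B.D : ℝ) ^ 2

/-- Standing assumptions: a sequence of finite connected vertex-transitive graphs with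
degrees uniformly bounded by `d`, of diverging sizes, satisfying the diameter condition
`D² = o(n / log n)`. -/
def GoodSeq (B : ℕ → GW) (d : ℕ) : Prop :=
  (∀ n, (B n).G.Connected) ∧
  (∀ n, IsVertexTransitive (B n).G) ∧
  (∀ n (x : (B n).V), (B n).G.degree x ≤ d) ∧
  Tendsto (fun n => (B n).nV) atTop atTop ∧
  Tendsto (fun n => ((B n).D : ℝ) ^ 2 * Real.log ((B n).nV) / ((B n).nV)) atTop (nhds 0)

/-- The transition matrix of the chain killed upon hitting `A`. -/
def killedMat {V : Type} [Fintype V] [DecidableEq V] (K : Matrix V V ℝ) (A : Finset V) :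
    Matrix V V ℝ :=
  Matrix.of fun x y => if x ∈ A ∨ y ∈ A then 0 else K x y

/-- `a` is the quasi-stationary distribution of `A` with rate `lam`: a probability
distribution supported off `A` which is a left eigenvector of the killed matrix for the
eigenvalue `1 - lam`, where `lam` is the smallest eigenvalue of `I_B - P_B`. -/
structure IsQSD {V : Type} [Fintype V] [DecidableEq V] (K : Matrix V V ℝ) (A : Finset V)
    (a : V → ℝ) (lam : ℝ) : Prop where
  nonneg : ∀ x, 0 ≤ a x
  sum_one : ∑ x : V, a x = 1
  supported : ∀ v ∈ A, a v = 0
  eigen : ∀ y : V, ∑ x : V, a x * killedMat K A x y = (1 - lam) * a y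
  minimal : ∀ (mu : ℝ) (g : V → ℝ), g ≠ 0 → (∀ v ∈ A, g v = 0) →
    (∀ y : V, ∑ x : V, g x * killedMat K A x y = (1 - mu) * g y) → lam ≤ mu

/-- Spectral gap `1 - λ₂` of a reversible transition matrix `K` with stationary
distribution `pd`. -/
def specGap {V : Type} [Fintype V] (K : Matrix V V ℝ) (pd : V → ℝ) : ℝ :=
  sInf {r : ℝ | ∃ g : V → ℝ, g ≠ 0 ∧ (∑ x : V, pd x * g x = 0) ∧
    ∀ y : V, ∑ x : V, K y x * g x = (1 - r) * g y}

/-- Relaxation time of a reversible chain. -/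
def trel {V : Type} [Fintype V] (K : Matrix V V ℝ) (pd : V → ℝ) : ℝ := (specGap K pd)⁻¹

/-- Total variation distance between two Borel measures on `ℝ`. -/
def dTVReal (μ ν : Measure ℝ) : ℝ :=
  ⨆ A : {A : Set ℝ // MeasurableSet A}, |(μ A.1).toReal - (ν A.1).toReal|

/-- The standard Gumbel distribution on `ℝ` (distribution function `s ↦ exp (-e^{-s})`). -/
def gumbelMeasure : Measure ℝ :=
  volume.withDensity fun s => ENNReal.ofReal (Real.exp (-s - Real.exp (-s)))

/-- `ψ(u) = (2/π²) ∑_{k ≥ 1} cos(2πku)/k²`. -/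
def psiSeries (u : ℝ) : ℝ :=
  (2 / Real.pi ^ 2) * ∑' k : ℕ, Real.cos (2 * Real.pi * ((k : ℝ) + 1) * u) / ((k : ℝ) + 1) ^ 2

/-- The cycle graph on `ℤ/mℤ`. -/
def cycleG (m : ℕ) : SimpleGraph (ZMod m) := SimpleGraph.fromRel fun x y => x - y = 1

instance (m : ℕ) : DecidableRel (cycleG m).Adj := fun _ _ => Classical.dec _

section Spectral

variable {V : Type} [Fintype V] [DecidableEq V]

lemma hasSum_exp_pow (t κ : ℝ) :
    HasSum (fun k : ℕ => Real.exp (-t) * t ^ k / (Nat.factorial k : ℝ) * κ ^ k)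
      (Real.exp (-(1 - κ) * t)) := by
  have h := (NormedSpace.expSeries_div_hasSum_exp (𝔸 := ℝ) (t * κ)).mul_left (Real.exp (-t))
  rw [← Real.exp_eq_exp_ℝ, ← Real.exp_add] at h
  have h2 : -(1 - κ) * t = -t + t * κ := by ring
  rw [h2]
  have h3 : (fun k : ℕ => Real.exp (-t) * t ^ k / (Nat.factorial k : ℝ) * κ ^ k)
      = fun k : ℕ => Real.exp (-t) * ((t * κ) ^ k / (Nat.factorial k : ℝ)) := by
    funext k; rw [mul_pow]; ring
  rw [h3]
  exact h

/-- If the powers of `M` are exponential sums, so is the heat kernel. -/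
lemma heatKer_eq_sum_exp {ι : Type*} (s : Finset ι) (M : Matrix V V ℝ) (x y : V) (c κ : ι → ℝ)
    (h : ∀ k : ℕ, (M ^ k) x y = ∑ i ∈ s, c i * κ i ^ k) (t : ℝ) :
    heatKer M t x y = ∑ i ∈ s, c i * Real.exp (-(1 - κ i) * t) := by
  unfold heatKer
  have h1 : HasSum (fun k : ℕ => ∑ i ∈ s,
      c i * (Real.exp (-t) * t ^ k / (Nat.factorial k : ℝ) * κ i ^ k))
      (∑ i ∈ s, c i * Real.exp (-(1 - κ i) * t)) :=
    hasSum_sum fun i _ => (hasSum_exp_pow t (κ i)).mul_left (c i)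
  rw [← h1.tsum_eq]
  congr 1
  funext k
  rw [h, Finset.mul_sum]
  exact Finset.sum_congr rfl fun i _ => by ring

lemma isHermitian_pow_mulVec_eigenvector {M : Matrix V V ℝ} (hM : M.IsHermitian) (i : V) (k : ℕ) :
    (M ^ k).mulVec (hM.eigenvectorBasis i).ofLp
      = hM.eigenvalues i ^ k • (hM.eigenvectorBasis i).ofLp := by
  induction k with
  | zero => simp
  | succ k ih =>
    rw [pow_succ, ← Matrix.mulVec_mulVec, hM.mulVec_eigenvectorBasis, Matrix.mulVec_smul, ih,
      smul_smul, pow_succ, mul_comm]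

lemma sum_sq_eigenvector {M : Matrix V V ℝ} (hM : M.IsHermitian) (f g : V → ℝ) :
    ∑ i, (∑ x, f x * hM.eigenvectorBasis i x) * (∑ x, g x * hM.eigenvectorBasis i x)
      = ∑ x, f x * g x := by
  have h := hM.eigenvectorBasis.sum_inner_mul_inner (WithLp.toLp 2 f) (WithLp.toLp 2 g)
  simp only [PiLp.inner_apply, RCLike.inner_apply, conj_trivial] at h
  rw [show ∑ x, f x * g x = ∑ x, g x * f x from Finset.sum_congr rfl fun _ _ => mul_comm _ _, ← h]
  refine Finset.sum_congr rfl fun i _ => ?_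
  congr 1
  exact Finset.sum_congr rfl fun x _ => mul_comm _ _

lemma dot_pow_eigenvector {M : Matrix V V ℝ} (hM : M.IsHermitian) (f : V → ℝ) (i : V) (k : ℕ) :
    ∑ x, (∑ y, (M ^ k) x y * f y) * hM.eigenvectorBasis i x
      = hM.eigenvalues i ^ k * ∑ x, f x * hM.eigenvectorBasis i x := by
  have hs : (M ^ k).transpose = M ^ k := by
    have h1 : M.transpose = M := by
      simpa [Matrix.conjTranspose_eq_transpose_of_trivial] using hM.eq
    rw [Matrix.transpose_pow, h1]
  have h := isHermitian_pow_mulVec_eigenvector hM i k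
  simp_rw [Finset.sum_mul]
  rw [Finset.sum_comm, Finset.mul_sum]
  refine Finset.sum_congr rfl fun y _ => ?_
  have h2 := congrFun h y
  simp only [Matrix.mulVec, dotProduct, Pi.smul_apply, smul_eq_mul] at h2
  calc _ = f y * ∑ x, (M ^ k) y x * (hM.eigenvectorBasis i).ofLp x := by
        rw [Finset.mul_sum]
        refine Finset.sum_congr rfl fun x _ => ?_
        have h3 : (M ^ k) x y = (M ^ k) y x := congrFun (congrFun hs y) x
        rw [h3]; ring
    _ = _ := by rw [h2]; ring

lemma pow_apply_spectral {M : Matrix V V ℝ} (hM : M.IsHermitian) (f g : V → ℝ) (k : ℕ) :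
    ∑ x, f x * ∑ y, (M ^ k) x y * g y
      = ∑ i, ((∑ x, f x * hM.eigenvectorBasis i x) * (∑ x, g x * hM.eigenvectorBasis i x))
          * hM.eigenvalues i ^ k := by
  rw [← sum_sq_eigenvector hM]
  refine Finset.sum_congr rfl fun i _ => ?_
  rw [dot_pow_eigenvector]; ring

/-- Probability that the chain with jump matrix `K` started from the uniform distribution
avoids `A` up to time `t`, computed with the killed semigroup. -/
def survival (K : Matrix V V ℝ) (A : Finset V) (t : ℝ) : ℝ :=
  (Fintype.card V : ℝ)⁻¹ * ∑ x ∈ Aᶜ, ∑ y ∈ Aᶜ, heatKer (killedMat K A) t x y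

lemma killedMat_isHermitian {K : Matrix V V ℝ} (hK : ∀ x y, K x y = K y x) (A : Finset V) :
    (killedMat K A).IsHermitian := by
  ext x y
  simp only [killedMat, Matrix.conjTranspose_apply, Matrix.of_apply, star_trivial, hK x y,
    or_comm (a := x ∈ A)]

/-- Spectral representation of the survival probability. -/
lemma survival_spectral {K : Matrix V V ℝ} (hK : ∀ x y, K x y = K y x) (A : Finset V) :
    ∃ w lam : V → ℝ, (∀ i, 0 ≤ w i) ∧ ∑ i, w i ≤ 1 ∧
      (∀ t, survival K A t = ∑ i, w i * Real.exp (-(lam i) * t)) ∧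
      (∀ ρ : ℝ, ρ ≤ 1 → (∀ f : V → ℝ, (∀ x ∈ A, f x = 0) →
          ρ * ∑ x, f x ^ 2 ≤ ∑ x, f x * (f x - ∑ y, K x y * f y)) → ∀ i, ρ ≤ lam i) ∧
      (∀ u : V → ℝ, (∀ x ∈ A, u x = 0) → (∀ x ∉ A, u x - ∑ y, K x y * u y = 1) →
          (∀ i, lam i ≠ 0) → ∑ i, w i / lam i = (Fintype.card V : ℝ)⁻¹ * ∑ x, u x) := by
  classical
  set M := killedMat K A with hMdef
  have hM : M.IsHermitian := killedMat_isHermitian hK A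
  set φ : V → ℝ := fun x => if x ∈ A then 0 else 1 with hφ
  set p : V → ℝ := fun i => ∑ x, φ x * hM.eigenvectorBasis i x with hp
  have hcard : (0 : ℝ) ≤ (Fintype.card V : ℝ)⁻¹ := by positivity
  have hMv : ∀ f : V → ℝ, (∀ x ∈ A, f x = 0) → ∀ x, ∑ y, M x y * f y =
      if x ∈ A then 0 else ∑ y, K x y * f y := by
    intro f hf x
    split_ifs with hx
    · refine Finset.sum_eq_zero fun y _ => ?_
      simp [hMdef, killedMat, hx]
    · refine Finset.sum_congr rfl fun y _ => ?_
      by_cases hy : y ∈ A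
      · simp [hf y hy]
      · simp [hMdef, killedMat, hx, hy]
  refine ⟨fun i => (Fintype.card V : ℝ)⁻¹ * (p i * p i), fun i => 1 - hM.eigenvalues i,
    fun i => mul_nonneg hcard (mul_self_nonneg _), ?_, ?_, ?_, ?_⟩
  · rw [← Finset.mul_sum, sum_sq_eigenvector]
    have h1 : ∑ x, φ x * φ x ≤ ∑ _x : V, (1 : ℝ) :=
      Finset.sum_le_sum fun x _ => by simp only [hφ]; split_ifs <;> norm_num
    rw [Finset.sum_const, Finset.card_univ, nsmul_eq_mul, mul_one] at h1
    calc _ ≤ (Fintype.card V : ℝ)⁻¹ * (Fintype.card V : ℝ) := mul_le_mul_of_nonneg_left h1 hcard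
      _ ≤ 1 := inv_mul_le_one
  · intro t
    unfold survival
    simp_rw [mul_assoc, ← Finset.mul_sum]
    congr 1
    have h1 : ∀ x y, heatKer (killedMat K A) t x y =
        ∑ i, (hM.eigenvectorBasis i x * hM.eigenvectorBasis i y) *
          Real.exp (-(1 - hM.eigenvalues i) * t) := by
      intro x y
      refine heatKer_eq_sum_exp Finset.univ M x y _ _ (fun k => ?_) t
      have h := pow_apply_spectral hM (Pi.single x 1) (Pi.single y 1) k
      simpa [Pi.single_apply] using h
    have h2 : ∀ F : V → ℝ, ∑ x ∈ Aᶜ, F x = ∑ x, φ x * F x := by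
      intro F
      rw [← Finset.sum_subset (Finset.subset_univ Aᶜ)]
      · refine Finset.sum_congr rfl fun x hx => ?_
        simp [hφ, Finset.mem_compl.1 hx]
      · intro x _ hx
        simp only [Finset.mem_compl, not_not] at hx
        simp [hφ, hx]
    rw [h2]
    simp_rw [h2, h1, hp]
    simp_rw [← mul_assoc, Finset.sum_mul_sum, Finset.mul_sum, Finset.sum_mul]
    conv_rhs => rw [Finset.sum_comm]
    refine Finset.sum_congr rfl fun x _ => ?_
    rw [Finset.sum_comm]
    refine Finset.sum_congr rfl fun i _ => Finset.sum_congr rfl fun y _ => ?_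
    ring
  · intro ρ hρ1 hρ i
    set v : V → ℝ := fun x => hM.eigenvectorBasis i x with hv
    have hev : ∀ x, ∑ y, M x y * v y = hM.eigenvalues i * v x := by
      intro x
      have := congrFun (hM.mulVec_eigenvectorBasis i) x
      simpa [Matrix.mulVec, dotProduct] using this
    by_cases h0 : hM.eigenvalues i = 0
    · simpa [h0] using hρ1
    have hvA : ∀ x ∈ A, v x = 0 := by
      intro x hx
      have := hev x
      rw [Finset.sum_eq_zero (fun y _ => by simp [hMdef, killedMat, hx])] at this
      exact (mul_eq_zero.1 this.symm).resolve_left h0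
    have hn : ∑ x, v x ^ 2 = 1 := by
      have := hM.eigenvectorBasis.orthonormal.1 i
      rw [EuclideanSpace.norm_eq, Real.sqrt_eq_one] at this
      simpa [hv] using this
    have := hρ v hvA
    rw [hn, mul_one] at this
    refine this.trans (le_of_eq ?_)
    calc _ = ∑ x, (1 - hM.eigenvalues i) * v x ^ 2 := by
          refine Finset.sum_congr rfl fun x _ => ?_
          by_cases hx : x ∈ A
          · simp [hvA x hx]
          · have h1 := hMv v hvA x
            rw [if_neg hx, hev] at h1
            rw [← h1]; ring
      _ = _ := by rw [← Finset.mul_sum, hn, mul_one]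
  · intro u hu hu1 hl
    simp_rw [mul_div_assoc, ← Finset.mul_sum]
    congr 1
    have hφu : ∑ x, u x = ∑ x, φ x * u x := by
      refine Finset.sum_congr rfl fun x _ => ?_
      by_cases hx : x ∈ A
      · simp [hu x hx]
      · simp [hφ, hx]
    rw [hφu, ← sum_sq_eigenvector hM φ u]
    refine Finset.sum_congr rfl fun i _ => ?_
    have h1 : p i = (1 - hM.eigenvalues i) * ∑ x, u x * hM.eigenvectorBasis i x := by
      have h2 := dot_pow_eigenvector hM u i 1
      simp only [pow_one] at h2
      rw [sub_mul, one_mul, ← h2, ← Finset.sum_sub_distrib]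
      refine Finset.sum_congr rfl fun x _ => ?_
      rw [hMv u hu, ← sub_mul]
      congr 1
      by_cases hx : x ∈ A
      · simp [hφ, hx, hu x hx]
      · simp [hφ, hx, hu1 x hx]
    have h3 := hl i
    change p i * (p i / (1 - hM.eigenvalues i)) = p i * _
    congr 1
    rw [div_eq_iff h3, h1]; ring

end Spectral

section Survival

variable {V : Type} [Fintype V] [DecidableEq V] {K : Matrix V V ℝ} {A : Finset V} {ρ : ℝ}

lemma survival_le (hK : ∀ x y, K x y = K y x) (hρ1 : ρ ≤ 1)
    (hρ : ∀ f : V → ℝ, (∀ x ∈ A, f x = 0) →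
      ρ * ∑ x, f x ^ 2 ≤ ∑ x, f x * (f x - ∑ y, K x y * f y)) {t : ℝ} (ht : 0 ≤ t) :
    survival K A t ≤ Real.exp (-ρ * t) := by
  obtain ⟨w, lam, hw, hw1, hs, hr, -⟩ := survival_spectral hK A
  have hl := hr ρ hρ1 hρ
  rw [hs]
  calc _ ≤ ∑ i, w i * Real.exp (-ρ * t) := by
        refine Finset.sum_le_sum fun i _ => mul_le_mul_of_nonneg_left ?_ (hw i)
        apply Real.exp_le_exp.2
        nlinarith [hl i]
    _ ≤ 1 * Real.exp (-ρ * t) := by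
        rw [← Finset.sum_mul]
        exact mul_le_mul_of_nonneg_right hw1 (Real.exp_pos _).le
    _ = _ := one_mul _

lemma survival_ge (hK : ∀ x y, K x y = K y x) (hρ0 : 0 < ρ) (hρ1 : ρ ≤ 1)
    (hρ : ∀ f : V → ℝ, (∀ x ∈ A, f x = 0) →
      ρ * ∑ x, f x ^ 2 ≤ ∑ x, f x * (f x - ∑ y, K x y * f y)) {u : V → ℝ}
    (hu : ∀ x ∈ A, u x = 0) (hu1 : ∀ x ∉ A, u x - ∑ y, K x y * u y = 1) {m : ℝ}
    (hm : m = (Fintype.card V : ℝ)⁻¹ * ∑ x, u x) (hm0 : 0 < m) {t : ℝ} (ht : 0 ≤ t) :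
    ρ * m * Real.exp (-t / m) ≤ survival K A t := by
  obtain ⟨w, lam, hw, hw1, hs, hr, hm'⟩ := survival_spectral hK A
  have hl := hr ρ hρ1 hρ
  have hl0 : ∀ i, 0 < lam i := fun i => hρ0.trans_le (hl i)
  have hmw := hm' u hu hu1 fun i => (hl0 i).ne'
  rw [← hm] at hmw
  have hj := convexOn_exp.map_sum_le (t := Finset.univ) (w := fun i => w i / lam i / m)
    (p := fun i => -(lam i) * t) (fun i _ => by have := hw i; have := hl0 i; positivity)
    (by rw [← Finset.sum_div, hmw, div_self hm0.ne']) (fun _ _ => Set.mem_univ _)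
  simp only [smul_eq_mul] at hj
  have h1 : -t / m ≤ ∑ i, w i / lam i / m * (-(lam i) * t) := by
    have h2 : ∑ i, w i / lam i / m * (-(lam i) * t) = -(∑ i, w i) * t / m := by
      rw [← Finset.sum_neg_distrib, Finset.sum_mul, Finset.sum_div]
      refine Finset.sum_congr rfl fun i _ => ?_
      have := (hl0 i).ne'
      field_simp
    rw [h2]
    apply div_le_div_of_nonneg_right _ hm0.le
    nlinarith
  calc ρ * m * Real.exp (-t / m)
      ≤ ρ * m * ∑ i, w i / lam i / m * Real.exp (-(lam i) * t) := by
        apply mul_le_mul_of_nonneg_left _ (by positivity)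
        exact (Real.exp_le_exp.2 h1).trans hj
    _ = ∑ i, w i * Real.exp (-(lam i) * t) * (ρ / lam i) := by
        rw [Finset.mul_sum]
        refine Finset.sum_congr rfl fun i _ => ?_
        have := (hl0 i).ne'
        field_simp
    _ ≤ ∑ i, w i * Real.exp (-(lam i) * t) := by
        refine Finset.sum_le_sum fun i _ => mul_le_of_le_one_right ?_ ?_
        · exact mul_nonneg (hw i) (Real.exp_pos _).le
        · exact (div_le_one (hl0 i)).2 (hl i)
    _ = _ := (hs t).symm

lemma survival_integral (hK : ∀ x y, K x y = K y x) (hρ0 : 0 < ρ) (hρ1 : ρ ≤ 1)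
    (hρ : ∀ f : V → ℝ, (∀ x ∈ A, f x = 0) →
      ρ * ∑ x, f x ^ 2 ≤ ∑ x, f x * (f x - ∑ y, K x y * f y)) {u : V → ℝ}
    (hu : ∀ x ∈ A, u x = 0) (hu1 : ∀ x ∉ A, u x - ∑ y, K x y * u y = 1) :
    IntegrableOn (survival K A) (Set.Ioi 0) ∧
      ∫ t in Set.Ioi 0, survival K A t = (Fintype.card V : ℝ)⁻¹ * ∑ x, u x := by
  obtain ⟨w, lam, hw, hw1, hs, hr, hm'⟩ := survival_spectral hK A
  have hl := hr ρ hρ1 hρ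
  have hl0 : ∀ i, 0 < lam i := fun i => hρ0.trans_le (hl i)
  have hi : ∀ i, IntegrableOn (fun t => w i * Real.exp (-(lam i) * t)) (Set.Ioi 0) := fun i =>
    (integrableOn_exp_mul_Ioi (neg_lt_zero.2 (hl0 i)) 0).const_mul _
  rw [funext hs]
  refine ⟨integrable_finsetSum _ fun i _ => hi i, ?_⟩
  rw [integral_finsetSum _ fun i _ => hi i, ← hm' u hu hu1 fun i => (hl0 i).ne']
  refine Finset.sum_congr rfl fun i _ => ?_
  rw [integral_const_mul, integral_exp_mul_Ioi (neg_lt_zero.2 (hl0 i)) 0]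
  have := (hl0 i).ne'
  simp; field_simp

end Survival

/-- A perfect symmetric pairing of a finite abelian group with itself with values in the
unit circle; it identifies the group with its dual. -/
structure DualPairing (V : Type) [AddCommGroup V] [Fintype V] [DecidableEq V] where
  e : V → V → ℂ
  map_add : ∀ ξ x y, e ξ (x + y) = e ξ x * e ξ y
  symm : ∀ ξ x, e ξ x = e x ξ
  norm_one : ∀ ξ x, ‖e ξ x‖ = 1
  sum_eq : ∀ ξ, ∑ x, e ξ x = if ξ = 0 then (Fintype.card V : ℂ) else 0

/-- Transition matrix of the random walk with uniform increments in `S`. -/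
def stepMat {V : Type} [AddCommGroup V] [DecidableEq V] (S : Finset V) : Matrix V V ℝ :=
  Matrix.of fun x y => if y - x ∈ S then (S.card : ℝ)⁻¹ else 0

namespace DualPairing

variable {V : Type} [AddCommGroup V] [Fintype V] [DecidableEq V] (Φ : DualPairing V)

/-- Real part of the pairing. -/
def c (ξ x : V) : ℝ := (Φ.e ξ x).re
/-- Imaginary part of the pairing. -/
def s (ξ x : V) : ℝ := (Φ.e ξ x).im

lemma c_sq_add_s_sq (ξ x : V) : Φ.c ξ x ^ 2 + Φ.s ξ x ^ 2 = 1 := by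
  have h := Complex.sq_norm (Φ.e ξ x)
  rw [Φ.norm_one, Complex.normSq_apply] at h
  simp only [c, s]; linarith

lemma abs_c_le_one (ξ x : V) : |Φ.c ξ x| ≤ 1 := by
  rw [abs_le_one_iff_mul_self_le_one]
  nlinarith [Φ.c_sq_add_s_sq ξ x, sq_nonneg (Φ.s ξ x)]

lemma c_le_one (ξ x : V) : Φ.c ξ x ≤ 1 := (abs_le.1 (Φ.abs_c_le_one ξ x)).2

lemma neg_one_le_c (ξ x : V) : -1 ≤ Φ.c ξ x := (abs_le.1 (Φ.abs_c_le_one ξ x)).1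

lemma e_zero (ξ : V) : Φ.e ξ 0 = 1 := by
  have h := Φ.map_add ξ 0 0
  have h1 : Φ.e ξ 0 ≠ 0 := by
    intro h0; have := Φ.norm_one ξ 0; simp [h0] at this
  rw [add_zero] at h
  exact (mul_eq_left₀ h1).1 h.symm

@[simp] lemma c_zero (ξ : V) : Φ.c ξ 0 = 1 := by simp [c, e_zero]
@[simp] lemma s_zero (ξ : V) : Φ.s ξ 0 = 0 := by simp [s, e_zero]
lemma c_symm (ξ x : V) : Φ.c ξ x = Φ.c x ξ := by simp only [c, Φ.symm ξ x]
lemma s_symm (ξ x : V) : Φ.s ξ x = Φ.s x ξ := by simp only [s, Φ.symm ξ x]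
@[simp] lemma c_zero_left (x : V) : Φ.c 0 x = 1 := by rw [c_symm, c_zero]
@[simp] lemma s_zero_left (x : V) : Φ.s 0 x = 0 := by rw [s_symm, s_zero]

lemma e_neg (ξ x : V) : Φ.e ξ (-x) = starRingEnd ℂ (Φ.e ξ x) := by
  have h := Φ.map_add ξ x (-x)
  rw [add_neg_cancel, Φ.e_zero] at h
  have h1 : Φ.e ξ x * starRingEnd ℂ (Φ.e ξ x) = 1 := by
    rw [Complex.mul_conj, Complex.normSq_eq_norm_sq, Φ.norm_one]; simp
  have h0 : Φ.e ξ x ≠ 0 := by intro h0; rw [h0, zero_mul] at h; exact one_ne_zero h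
  exact mul_left_cancel₀ h0 (h.symm.trans h1.symm)

@[simp] lemma c_neg (ξ x : V) : Φ.c ξ (-x) = Φ.c ξ x := by simp [c, e_neg]
@[simp] lemma s_neg (ξ x : V) : Φ.s ξ (-x) = -Φ.s ξ x := by simp [s, e_neg]
@[simp] lemma c_neg_left (ξ x : V) : Φ.c (-ξ) x = Φ.c ξ x := by rw [c_symm, c_neg, c_symm]

lemma c_add (ξ x y : V) : Φ.c ξ (x + y) = Φ.c ξ x * Φ.c ξ y - Φ.s ξ x * Φ.s ξ y := by
  simp [c, s, Φ.map_add, Complex.mul_re]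

lemma s_add (ξ x y : V) : Φ.s ξ (x + y) = Φ.c ξ x * Φ.s ξ y + Φ.s ξ x * Φ.c ξ y := by
  simp [c, s, Φ.map_add, Complex.mul_im]

lemma c_sub (ξ x y : V) : Φ.c ξ (x - y) = Φ.c ξ x * Φ.c ξ y + Φ.s ξ x * Φ.s ξ y := by
  rw [sub_eq_add_neg, c_add, c_neg, s_neg]; ring

lemma sum_c (x : V) : ∑ ξ, Φ.c ξ x = if x = 0 then (Fintype.card V : ℝ) else 0 := by
  have h := congrArg Complex.re (Φ.sum_eq x)
  rw [Complex.re_sum] at h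
  rw [Finset.sum_congr rfl fun ξ _ => Φ.c_symm ξ x]
  refine h.trans ?_
  split_ifs <;> simp

/-- Real part of the Fourier transform. -/
def a (f : V → ℝ) (ξ : V) : ℝ := ∑ x, f x * Φ.c ξ x
/-- Imaginary part of the Fourier transform. -/
def b (f : V → ℝ) (ξ : V) : ℝ := ∑ x, f x * Φ.s ξ x

lemma a_mul_add_b_mul (f g : V → ℝ) (ξ : V) :
    Φ.a f ξ * Φ.a g ξ + Φ.b f ξ * Φ.b g ξ = ∑ x, ∑ y, f x * g y * Φ.c ξ (x - y) := by
  simp only [a, b, Finset.sum_mul_sum, ← Finset.sum_add_distrib]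
  refine Finset.sum_congr rfl fun x _ => Finset.sum_congr rfl fun y _ => ?_
  rw [c_sub]; ring

lemma parseval (f g : V → ℝ) :
    ∑ ξ, (Φ.a f ξ * Φ.a g ξ + Φ.b f ξ * Φ.b g ξ) = (Fintype.card V : ℝ) * ∑ x, f x * g x := by
  simp_rw [a_mul_add_b_mul]
  rw [Finset.sum_comm, Finset.mul_sum]
  refine Finset.sum_congr rfl fun x _ => ?_
  rw [Finset.sum_comm]
  simp_rw [← Finset.mul_sum, sum_c, sub_eq_zero]
  simp; ring

/-- Plancherel for the transform of an even function. -/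
lemma sum_even_sq (h : V → ℝ) (hev : ∀ ξ, h (-ξ) = h ξ) :
    ∑ x, (∑ ξ, h ξ * Φ.c ξ x) ^ 2 = (Fintype.card V : ℝ) * ∑ ξ, h ξ ^ 2 := by
  have hb : ∀ x, Φ.b h x = 0 := by
    intro x
    have h1 : Φ.b h x = -Φ.b h x := by
      conv_lhs => rw [b, ← Equiv.sum_comp (Equiv.neg V)]
      rw [b, ← Finset.sum_neg_distrib]
      exact Finset.sum_congr rfl fun y _ => by simp [hev]
    linarith
  have h2 := Φ.parseval h h
  simp only [hb, mul_zero, add_zero] at h2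
  simp only [← pow_two] at h2
  rw [← h2]
  refine Finset.sum_congr rfl fun x _ => ?_
  simp only [a]
  congr 1
  exact Finset.sum_congr rfl fun ξ _ => by rw [c_symm]

variable (S : Finset V)

/-- Eigenvalue of `1 - K`, where `K` is the walk with increments in `S`. -/
def mu (ξ : V) : ℝ := 1 - (S.card : ℝ)⁻¹ * ∑ g ∈ S, Φ.c ξ g

variable {S}

lemma mu_eq (hS : S.Nonempty) (ξ : V) :
    Φ.mu S ξ = (S.card : ℝ)⁻¹ * ∑ g ∈ S, (1 - Φ.c ξ g) := by
  have : (S.card : ℝ) ≠ 0 := by simpa using hS.ne_empty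
  simp only [mu, Finset.sum_sub_distrib, Finset.sum_const, nsmul_eq_mul]
  field_simp

lemma mu_zero (hS : S.Nonempty) : Φ.mu S 0 = 0 := by simp [mu_eq _ hS]

lemma mu_neg (ξ : V) : Φ.mu S (-ξ) = Φ.mu S ξ := by simp [mu]

lemma mu_le_two (hS : S.Nonempty) (ξ : V) : Φ.mu S ξ ≤ 2 := by
  have h0 : (0 : ℝ) < S.card := by simpa using hS
  rw [mu_eq _ hS, inv_mul_le_iff₀ h0]
  calc _ ≤ ∑ g ∈ S, (2 : ℝ) := Finset.sum_le_sum fun g _ => by linarith [Φ.neg_one_le_c ξ g]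
    _ = _ := by simp

lemma mu_nonneg (hS : S.Nonempty) (ξ : V) : 0 ≤ Φ.mu S ξ := by
  rw [mu_eq _ hS]
  exact mul_nonneg (by positivity) (Finset.sum_nonneg fun g _ => by linarith [Φ.c_le_one ξ g])

lemma le_mu (hS : S.Nonempty) (ξ : V) {g : V} (hg : g ∈ S) :
    (S.card : ℝ)⁻¹ * (1 - Φ.c ξ g) ≤ Φ.mu S ξ := by
  rw [mu_eq _ hS]
  refine mul_le_mul_of_nonneg_left ?_ (by positivity)
  exact Finset.single_le_sum (f := fun g => 1 - Φ.c ξ g)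
    (fun g _ => by linarith [Φ.c_le_one ξ g]) hg

lemma sum_s (hneg : ∀ g ∈ S, -g ∈ S) (ξ : V) : ∑ g ∈ S, Φ.s ξ g = 0 := by
  have h : ∑ g ∈ S, Φ.s ξ g = ∑ g ∈ S, Φ.s ξ (-g) := by
    refine Finset.sum_nbij' (fun g => -g) (fun g => -g) hneg hneg ?_ ?_ ?_ <;> simp
  simp only [s_neg, Finset.sum_neg_distrib] at h
  linarith

lemma avg_c (hneg : ∀ g ∈ S, -g ∈ S) (ξ x : V) :
    (S.card : ℝ)⁻¹ * ∑ g ∈ S, Φ.c ξ (x + g) = (1 - Φ.mu S ξ) * Φ.c ξ x := by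
  simp only [c_add, Finset.sum_sub_distrib, ← Finset.mul_sum, Φ.sum_s hneg, mu]
  ring

lemma avg_s (hneg : ∀ g ∈ S, -g ∈ S) (ξ x : V) :
    (S.card : ℝ)⁻¹ * ∑ g ∈ S, Φ.s ξ (x + g) = (1 - Φ.mu S ξ) * Φ.s ξ x := by
  simp only [s_add, Finset.sum_add_distrib, ← Finset.mul_sum, Φ.sum_s hneg, mu]
  ring

end DualPairing

section StepMat

variable {V : Type} [AddCommGroup V] [DecidableEq V] {S : Finset V}

lemma stepMat_symm (hneg : ∀ g ∈ S, -g ∈ S) (x y : V) : stepMat S x y = stepMat S y x := by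
  have h : y - x ∈ S ↔ x - y ∈ S :=
    ⟨fun h => by simpa using hneg _ h, fun h => by simpa using hneg _ h⟩
  simp [stepMat, h]

variable [Fintype V]

lemma sum_stepMat (S : Finset V) (f : V → ℝ) (x : V) :
    ∑ y, stepMat S x y * f y = (S.card : ℝ)⁻¹ * ∑ g ∈ S, f (x + g) := by
  rw [← Equiv.sum_comp (Equiv.addLeft x)]
  simp [stepMat, Finset.mul_sum, ite_mul]

namespace DualPairing

variable (Φ : DualPairing V)

lemma stepMat_pow (hneg : ∀ g ∈ S, -g ∈ S) (k : ℕ) (x y : V) :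
    (stepMat S ^ k) x y
      = ∑ ξ, (Fintype.card V : ℝ)⁻¹ * Φ.c ξ (y - x) * (1 - Φ.mu S ξ) ^ k := by
  have hn : (Fintype.card V : ℝ) ≠ 0 := Nat.cast_ne_zero.2 Fintype.card_ne_zero
  induction k generalizing x with
  | zero =>
    simp only [pow_zero, mul_one, ← Finset.mul_sum, sum_c, sub_eq_zero, Matrix.one_apply,
      eq_comm (a := y)]
    split_ifs <;> simp [hn]
  | succ k ih =>
    rw [pow_succ', Matrix.mul_apply, sum_stepMat S (fun z => (stepMat S ^ k) z y)]
    simp_rw [ih]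
    rw [Finset.sum_comm, Finset.mul_sum]
    refine Finset.sum_congr rfl fun ξ _ => ?_
    have h := Φ.avg_c hneg ξ (x - y)
    have h1 : ∀ z, Φ.c ξ (y - z) = Φ.c ξ (z - y) := fun z => by
      rw [← neg_sub, c_neg]
    simp_rw [h1, ← Finset.sum_mul, ← Finset.mul_sum, add_sub_right_comm]
    rw [pow_succ]
    linear_combination (Fintype.card V : ℝ)⁻¹ * (1 - Φ.mu S ξ) ^ k * h

lemma heatKer_stepMat (hneg : ∀ g ∈ S, -g ∈ S) (t : ℝ) (x y : V) :
    heatKer (stepMat S) t x y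
      = (Fintype.card V : ℝ)⁻¹ * ∑ ξ, Φ.c ξ (y - x) * Real.exp (-(Φ.mu S ξ) * t) := by
  rw [heatKer_eq_sum_exp Finset.univ _ x y _ _ (fun k => Φ.stepMat_pow hneg k x y), Finset.mul_sum]
  exact Finset.sum_congr rfl fun ξ _ => by rw [sub_sub_cancel, mul_assoc]

lemma a_sum_stepMat (hneg : ∀ g ∈ S, -g ∈ S) (f : V → ℝ) (ξ : V) :
    Φ.a (fun x => ∑ y, stepMat S x y * f y) ξ = (1 - Φ.mu S ξ) * Φ.a f ξ := by
  simp only [a, Finset.sum_mul, Finset.mul_sum]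
  rw [Finset.sum_comm]
  refine Finset.sum_congr rfl fun y _ => ?_
  have h := Φ.avg_c hneg ξ y
  rw [← sum_stepMat] at h
  rw [mul_left_comm, ← h, Finset.mul_sum]
  exact Finset.sum_congr rfl fun x _ => by rw [stepMat_symm hneg]; ring

lemma b_sum_stepMat (hneg : ∀ g ∈ S, -g ∈ S) (f : V → ℝ) (ξ : V) :
    Φ.b (fun x => ∑ y, stepMat S x y * f y) ξ = (1 - Φ.mu S ξ) * Φ.b f ξ := by
  simp only [b, Finset.sum_mul, Finset.mul_sum]
  rw [Finset.sum_comm]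
  refine Finset.sum_congr rfl fun y _ => ?_
  have h := Φ.avg_s hneg ξ y
  rw [← sum_stepMat] at h
  rw [mul_left_comm, ← h, Finset.mul_sum]
  exact Finset.sum_congr rfl fun x _ => by rw [stepMat_symm hneg]; ring

/-- Lower bound on the Dirichlet form of functions vanishing on the support of a
probability vector `ν`, in terms of the Fourier transform of `ν`. -/
lemma rayleigh (hS : S.Nonempty) (hneg : ∀ g ∈ S, -g ∈ S) {A : Finset V} {ν : V → ℝ}
    (hν : ∀ x ∉ A, ν x = 0) (hν1 : ∑ x, ν x = 1) {ρ : ℝ} (hρ0 : 0 ≤ ρ)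
    (hρμ : ∀ ξ ≠ 0, ρ < Φ.mu S ξ)
    (hρ : ρ * ∑ ξ ∈ {0}ᶜ, (Φ.a ν ξ ^ 2 + Φ.b ν ξ ^ 2) / (Φ.mu S ξ - ρ) ≤ 1)
    (f : V → ℝ) (hf : ∀ x ∈ A, f x = 0) :
    ρ * ∑ x, f x ^ 2 ≤ ∑ x, f x * (f x - ∑ y, stepMat S x y * f y) := by
  have hn : (0 : ℝ) < Fintype.card V := Nat.cast_pos.2 Fintype.card_pos
  have split : ∀ F : V → ℝ, ∑ ξ, F ξ = F 0 + ∑ ξ ∈ {0}ᶜ, F ξ := fun F => by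
    rw [← Finset.sum_add_sum_compl {0}, Finset.sum_singleton]
  have ha0 : ∀ g : V → ℝ, Φ.a g 0 = ∑ x, g x := fun g => by simp [a]
  have hb0 : ∀ g : V → ℝ, Φ.b g 0 = 0 := fun g => by simp [b]
  have h1 := Φ.parseval f f
  have h2 := Φ.parseval f (fun x => ∑ y, stepMat S x y * f y)
  have h3 := Φ.parseval f ν
  rw [split] at h1 h2 h3
  simp only [Φ.a_sum_stepMat hneg, Φ.b_sum_stepMat hneg, ha0, hb0, Φ.mu_zero hS, hν1] at h1 h2 h3
  have h4 : ∑ x, f x * ν x = 0 := Finset.sum_eq_zero fun x _ => by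
    by_cases hx : x ∈ A
    · rw [hf x hx, zero_mul]
    · rw [hν x hx, mul_zero]
  rw [h4] at h3
  set σ := ∑ x, f x with hσ
  have hcs : (∑ ξ ∈ {0}ᶜ, (Φ.a f ξ * Φ.a ν ξ + Φ.b f ξ * Φ.b ν ξ)) ^ 2 ≤
      (∑ ξ ∈ {0}ᶜ, (Φ.mu S ξ - ρ) * (Φ.a f ξ ^ 2 + Φ.b f ξ ^ 2)) *
      ∑ ξ ∈ {0}ᶜ, (Φ.a ν ξ ^ 2 + Φ.b ν ξ ^ 2) / (Φ.mu S ξ - ρ) := by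
    refine Finset.sum_sq_le_sum_mul_sum_of_sq_le_mul _ ?_ ?_ ?_
    · intro ξ hξ
      have := hρμ ξ (by simpa using hξ)
      exact mul_nonneg (by linarith) (by positivity)
    · intro ξ hξ
      have := hρμ ξ (by simpa using hξ)
      exact div_nonneg (by positivity) (by linarith)
    · intro ξ hξ
      have := sub_pos.2 (hρμ ξ (by simpa using hξ))
      rw [mul_assoc, ← mul_div_assoc, mul_div_cancel₀ _ this.ne']
      nlinarith [sq_nonneg (Φ.a f ξ * Φ.b ν ξ - Φ.b f ξ * Φ.a ν ξ)]
  set E := ∑ ξ ∈ {0}ᶜ, (Φ.mu S ξ - ρ) * (Φ.a f ξ ^ 2 + Φ.b f ξ ^ 2) with hE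
  have hE0 : 0 ≤ E := Finset.sum_nonneg fun ξ hξ => by
    have := hρμ ξ (by simpa using hξ)
    exact mul_nonneg (by linarith) (by positivity)
  have h5 : ρ * σ ^ 2 ≤ E := by
    have h6 : σ = -∑ ξ ∈ {0}ᶜ, (Φ.a f ξ * Φ.a ν ξ + Φ.b f ξ * Φ.b ν ξ) := by linarith
    rw [h6, neg_sq]
    nlinarith [mul_le_mul_of_nonneg_left hcs hρ0, mul_le_mul_of_nonneg_left hρ hE0]
  have h7 : E = ∑ ξ ∈ {0}ᶜ, (Φ.a f ξ * Φ.a f ξ + Φ.b f ξ * Φ.b f ξ)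
      - (∑ ξ ∈ {0}ᶜ, (Φ.a f ξ * ((1 - Φ.mu S ξ) * Φ.a f ξ) + Φ.b f ξ * ((1 - Φ.mu S ξ) * Φ.b f ξ)))
      - ρ * ∑ ξ ∈ {0}ᶜ, (Φ.a f ξ * Φ.a f ξ + Φ.b f ξ * Φ.b f ξ) := by
    rw [hE, Finset.mul_sum, ← Finset.sum_sub_distrib, ← Finset.sum_sub_distrib]
    exact Finset.sum_congr rfl fun ξ _ => by ring
  have h8 : ∑ x, f x * (f x - ∑ y, stepMat S x y * f y)
      = ∑ x, f x * f x - ∑ x, f x * ∑ y, stepMat S x y * f y := by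
    rw [← Finset.sum_sub_distrib]
    exact Finset.sum_congr rfl fun x _ => by ring
  have h9 : ∑ x, f x ^ 2 = ∑ x, f x * f x := Finset.sum_congr rfl fun x _ => by ring
  rw [h8, h9]
  refine le_of_mul_le_mul_left ?_ hn
  nlinarith

variable (S)

/-- Zero-mean Green function of the walk with increments in `S`. -/
def green (x : V) : ℝ := (Fintype.card V : ℝ)⁻¹ * ∑ ξ ∈ {0}ᶜ, Φ.c ξ x / Φ.mu S ξ

variable {S}

lemma green_neg (x : V) : Φ.green S (-x) = Φ.green S x := by simp [green]

lemma sum_green : ∑ x, Φ.green S x = 0 := by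
  simp only [green, ← Finset.mul_sum]
  rw [Finset.sum_comm]
  refine mul_eq_zero_of_right _ (Finset.sum_eq_zero fun ξ hξ => ?_)
  have h := Φ.sum_c ξ
  rw [if_neg (by simpa using hξ)] at h
  rw [← Finset.sum_div, Finset.sum_congr rfl fun x _ => Φ.c_symm ξ x, h, zero_div]

lemma green_sub_avg (hneg : ∀ g ∈ S, -g ∈ S) (hμ : ∀ ξ ≠ 0, 0 < Φ.mu S ξ) (x z : V) :
    Φ.green S (x - z) - ∑ y, stepMat S x y * Φ.green S (y - z)
      = (if x = z then 1 else 0) - (Fintype.card V : ℝ)⁻¹ := by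
  have hn : (Fintype.card V : ℝ) ≠ 0 := Nat.cast_ne_zero.2 Fintype.card_ne_zero
  rw [sum_stepMat S (fun y => Φ.green S (y - z))]
  have h1 : (S.card : ℝ)⁻¹ * ∑ g ∈ S, Φ.green S (x + g - z)
      = (Fintype.card V : ℝ)⁻¹ * ∑ ξ ∈ {0}ᶜ, (1 - Φ.mu S ξ) * Φ.c ξ (x - z) / Φ.mu S ξ := by
    simp only [green, ← Finset.mul_sum]
    rw [Finset.sum_comm, mul_left_comm, Finset.mul_sum]
    congr 1
    refine Finset.sum_congr rfl fun ξ _ => ?_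
    rw [← Φ.avg_c hneg, ← Finset.sum_div, mul_div_assoc]
    simp_rw [add_sub_right_comm]
  rw [h1, green, ← mul_sub, ← Finset.sum_sub_distrib]
  have h2 : ∑ ξ ∈ {0}ᶜ, (Φ.c ξ (x - z) / Φ.mu S ξ - (1 - Φ.mu S ξ) * Φ.c ξ (x - z) / Φ.mu S ξ)
      = ∑ ξ ∈ {0}ᶜ, Φ.c ξ (x - z) := by
    refine Finset.sum_congr rfl fun ξ hξ => ?_
    have := (hμ ξ (by simpa using hξ)).ne'
    field_simp
    ring
  have h3 := Φ.sum_c (x - z)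
  rw [← Finset.sum_add_sum_compl {0}, Finset.sum_singleton, c_zero_left] at h3
  simp only [sub_eq_zero] at h3
  rw [h2, eq_sub_of_add_eq' h3, mul_sub, mul_one]
  congr 1
  split_ifs <;> simp [hn]

/-- The energy of `ν` in terms of the Green function. -/
lemma energy_eq (ν : V → ℝ) :
    ∑ ξ ∈ {0}ᶜ, (Φ.a ν ξ ^ 2 + Φ.b ν ξ ^ 2) / Φ.mu S ξ
      = (Fintype.card V : ℝ) * ∑ x, ∑ y, ν x * ν y * Φ.green S (x - y) := by
  have hn : (Fintype.card V : ℝ) ≠ 0 := Nat.cast_ne_zero.2 Fintype.card_ne_zero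
  simp_rw [pow_two, a_mul_add_b_mul, Finset.sum_div]
  rw [Finset.sum_comm, Finset.mul_sum]
  refine Finset.sum_congr rfl fun x _ => ?_
  rw [Finset.sum_comm, Finset.mul_sum]
  refine Finset.sum_congr rfl fun y _ => ?_
  rw [green, mul_left_comm, mul_inv_cancel_left₀ hn, Finset.mul_sum]
  exact Finset.sum_congr rfl fun ξ _ => by rw [mul_div_assoc]

lemma a_sq_add_b_sq_le {ν : V → ℝ} (hν0 : ∀ x, 0 ≤ ν x) (hν1 : ∑ x, ν x = 1) (ξ : V) :
    Φ.a ν ξ ^ 2 + Φ.b ν ξ ^ 2 ≤ 1 := by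
  rw [pow_two, pow_two, a_mul_add_b_mul]
  calc _ ≤ ∑ x, ∑ y, ν x * ν y := Finset.sum_le_sum fun x _ => Finset.sum_le_sum fun y _ =>
        mul_le_of_le_one_right (mul_nonneg (hν0 x) (hν0 y)) (Φ.c_le_one _ _)
    _ = 1 := by rw [← Finset.sum_mul_sum, hν1, one_mul]

/-- Rayleigh bound with an explicit rate close to the inverse energy. -/
lemma rayleigh_energy (hS : S.Nonempty) (hneg : ∀ g ∈ S, -g ∈ S) {A : Finset V} {ν : V → ℝ}
    (hν : ∀ x ∉ A, ν x = 0) (hν0 : ∀ x, 0 ≤ ν x) (hν1 : ∑ x, ν x = 1) {E δ Q : ℝ} (hE : 0 < E)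
    (hEν : (Fintype.card V : ℝ) * ∑ x, ∑ y, ν x * ν y * Φ.green S (x - y) ≤ E)
    (hQ : ∑ ξ ∈ {0}ᶜ, (Φ.mu S ξ ^ 2)⁻¹ ≤ Q) (hδ : 2 * Q / E ^ 2 ≤ δ) (hδ1 : δ ≤ 1)
    (hEμ : ∀ ξ ≠ 0, 2 / E ≤ Φ.mu S ξ)
    (f : V → ℝ) (hf : ∀ x ∈ A, f x = 0) :
    (1 - δ) / E * ∑ x, f x ^ 2 ≤ ∑ x, f x * (f x - ∑ y, stepMat S x y * f y) := by
  have hQ0 : 0 ≤ Q := (Finset.sum_nonneg fun ξ _ => by positivity).trans hQ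
  have hδ0 : 0 ≤ δ := le_trans (by positivity) hδ
  have hle : (1 - δ) / E ≤ 1 / E := div_le_div_of_nonneg_right (by linarith) hE.le
  have h0 : 0 ≤ (1 - δ) / E := div_nonneg (by linarith) hE.le
  have hE2 : 2 / E = 2 * (1 / E) := by ring
  have hE1 : 0 < 1 / E := by positivity
  refine Φ.rayleigh hS hneg hν hν1 h0 (fun ξ hξ => ?_) ?_ f hf
  · have := hEμ ξ hξ
    linarith
  · have h1 : ∑ ξ ∈ {0}ᶜ, (Φ.a ν ξ ^ 2 + Φ.b ν ξ ^ 2) / (Φ.mu S ξ - (1 - δ) / E)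
        ≤ ∑ ξ ∈ {0}ᶜ, ((Φ.a ν ξ ^ 2 + Φ.b ν ξ ^ 2) / Φ.mu S ξ + 2 / E * (Φ.mu S ξ ^ 2)⁻¹) := by
      refine Finset.sum_le_sum fun ξ hξ => ?_
      have hμ := hEμ ξ (by simpa using hξ)
      have hμ0 : 0 < Φ.mu S ξ := by linarith
      have hd : 0 < Φ.mu S ξ - (1 - δ) / E := by linarith
      have hp := Φ.a_sq_add_b_sq_le hν0 hν1 ξ
      have hp0 : 0 ≤ Φ.a ν ξ ^ 2 + Φ.b ν ξ ^ 2 := by positivity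
      set p := Φ.a ν ξ ^ 2 + Φ.b ν ξ ^ 2
      set r := (1 - δ) / E
      have h2 : p / (Φ.mu S ξ - r) = p / Φ.mu S ξ + p * r / (Φ.mu S ξ * (Φ.mu S ξ - r)) := by
        field_simp; ring
      rw [h2]
      gcongr
      rw [← div_eq_mul_inv, div_le_div_iff₀ (by positivity) (by positivity)]
      have h3 : p * r ≤ 1 / E := by nlinarith
      have h4 : Φ.mu S ξ ≤ 2 * (Φ.mu S ξ - r) := by linarith
      rw [hE2]
      calc p * r * Φ.mu S ξ ^ 2 ≤ 1 / E * Φ.mu S ξ ^ 2 := by gcongr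
        _ = 1 / E * Φ.mu S ξ * Φ.mu S ξ := by ring
        _ ≤ 1 / E * Φ.mu S ξ * (2 * (Φ.mu S ξ - r)) := by gcongr
        _ = _ := by ring
    rw [Finset.sum_add_distrib, ← Finset.mul_sum, energy_eq] at h1
    have h5 : 2 / E * ∑ ξ ∈ {0}ᶜ, (Φ.mu S ξ ^ 2)⁻¹ ≤ 2 / E * Q := by gcongr
    have h6 : 2 / E * Q ≤ δ * E := by
      rw [div_le_iff₀ (by positivity)] at hδ
      rw [div_mul_eq_mul_div, div_le_iff₀ hE]
      nlinarith
    calc _ ≤ (1 - δ) / E * (E + δ * E) := mul_le_mul_of_nonneg_left (by linarith) h0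
      _ = 1 - δ ^ 2 := by field_simp; ring
      _ ≤ 1 := by nlinarith

end DualPairing

end StepMat

namespace StepWalk

/-- The standard exponential distribution. -/
def expo : Measure ℝ :=
  (volume.restrict (Set.Ioi 0)).withDensity fun x => ENNReal.ofReal (Real.exp (-x))

lemma lintegral_expo {f : ℝ → ENNReal} (hf : Measurable f) :
    ∫⁻ x, f x ∂expo = ∫⁻ x, if 0 < x then ENNReal.ofReal (Real.exp (-x)) * f x else 0 := by
  rw [expo, lintegral_withDensity_eq_lintegral_mul _ (by fun_prop) hf,
    ← lintegral_indicator measurableSet_Ioi]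
  simp [Set.indicator_apply]

instance : IsProbabilityMeasure expo := by
  constructor
  rw [expo, withDensity_apply _ MeasurableSet.univ, Measure.restrict_univ,
    ← ofReal_integral_eq_lintegral_ofReal, integral_exp_neg_Ioi_zero, ENNReal.ofReal_one]
  · exact integrableOn_exp_neg_Ioi 0
  · exact ae_of_all _ fun x => (Real.exp_pos _).le

lemma lintegral_expo_memoryless {t : ℝ} (ht : 0 ≤ t) {f : ℝ → ENNReal} (hf : Measurable f) :
    ∫⁻ x, (if t < x then f (x - t) else 0) ∂expo
      = ENNReal.ofReal (Real.exp (-t)) * ∫⁻ x, f x ∂expo := by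
  have hm' : Measurable fun x : ℝ => if t < x then f (x - t) else 0 :=
    Measurable.ite measurableSet_Ioi (by fun_prop) (by fun_prop)
  rw [lintegral_expo hf, lintegral_expo hm',
    ← lintegral_sub_right_eq_self
      (fun x : ℝ => if 0 < x then ENNReal.ofReal (Real.exp (-x)) * f x else 0) t,
    ← lintegral_const_mul' _ _ ENNReal.ofReal_ne_top]
  refine lintegral_congr fun x => ?_
  by_cases h : t < x
  · rw [if_pos (ht.trans_lt h), if_pos h, if_pos (sub_pos.2 h), ← mul_assoc,
      ← ENNReal.ofReal_mul (Real.exp_pos _).le, ← Real.exp_add]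
    congr 3; ring
  · rw [if_neg h, mul_zero, ite_self, if_neg (by linarith), mul_zero]

lemma lintegral_expo_poisson (k : ℕ) {t : ℝ} (ht : 0 ≤ t) :
    ∫⁻ x, (if x ≤ t then ENNReal.ofReal (Real.exp (-(t - x)) * (t - x) ^ k / k.factorial) else 0)
      ∂expo = ENNReal.ofReal (Real.exp (-t) * t ^ (k + 1) / (k + 1).factorial) := by
  rw [lintegral_expo (Measurable.ite measurableSet_Iic (by fun_prop) (by fun_prop))]
  have h1 : ∀ x : ℝ, (if 0 < x then ENNReal.ofReal (Real.exp (-x)) *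
      (if x ≤ t then ENNReal.ofReal (Real.exp (-(t - x)) * (t - x) ^ k / k.factorial) else 0)
        else 0) = (Set.Ioc 0 t).indicator (fun x =>
          ENNReal.ofReal (Real.exp (-t) / k.factorial * (t - x) ^ k)) x := by
    intro x
    simp only [Set.indicator_apply, Set.mem_Ioc]
    by_cases h0 : 0 < x <;> by_cases h2 : x ≤ t <;> simp only [h0, h2, if_true, if_false,
      and_self, and_true, mul_zero, and_false]
    rw [← ENNReal.ofReal_mul (Real.exp_pos _).le]
    congr 1
    rw [show -t = -x + -(t - x) by ring, Real.exp_add]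
    ring
  simp_rw [h1]
  rw [lintegral_indicator measurableSet_Ioc, ← ofReal_integral_eq_lintegral_ofReal,
    ← intervalIntegral.integral_of_le ht, intervalIntegral.integral_const_mul,
    intervalIntegral.integral_comp_sub_left (fun x => x ^ k), integral_pow]
  · congr 1
    rw [Nat.factorial_succ]
    push_cast
    field_simp
    simp
  · exact (Continuous.integrableOn_Icc (by fun_prop)).mono_set Set.Ioc_subset_Icc_self
  · refine (ae_restrict_iff' measurableSet_Ioc).2 (ae_of_all _ fun x hx => ?_)
    have : 0 ≤ t - x := by linarith [hx.2]
    positivity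

variable {V : Type} [MeasurableSpace V] (S : Finset V)

/-- Uniform distribution on `S`. -/
def unifM : Measure V := ∑ g ∈ S, (S.card : ENNReal)⁻¹ • Measure.dirac g

lemma lintegral_unifM [MeasurableSingletonClass V] (f : V → ENNReal) :
    ∫⁻ x, f x ∂(unifM S) = (S.card : ENNReal)⁻¹ * ∑ g ∈ S, f g := by
  rw [unifM, lintegral_finsetSum_measure, Finset.mul_sum]
  simp

lemma unifM_isProb (hS : S.Nonempty) : IsProbabilityMeasure (unifM S) := by
  constructor
  have h0 : (S.card : ENNReal) ≠ 0 := by simpa using hS.ne_empty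
  simp [unifM, ENNReal.mul_inv_cancel h0]

/-- Law of a waiting time and an increment. -/
def incr : Measure (ℝ × V) := expo.prod (unifM S)

/-- Law of the sequence of waiting times and increments. -/
def clockM : Measure (ℕ → ℝ × V) := Measure.infinitePi fun _ => incr S

variable [hS : Fact S.Nonempty]

instance : IsProbabilityMeasure (unifM S) := unifM_isProb S hS.out
instance : IsProbabilityMeasure (incr S) := by rw [incr]; infer_instance
instance : IsProbabilityMeasure (clockM S) := by rw [clockM]; infer_instance

/-- Prepend an element to a sequence. -/
def cons {α : Type} (p : α) (ω : ℕ → α) : ℕ → α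
  | 0 => p
  | i + 1 => ω i

@[simp] lemma cons_zero {α : Type} (p : α) (ω : ℕ → α) : cons p ω 0 = p := rfl
@[simp] lemma cons_succ {α : Type} (p : α) (ω : ℕ → α) (i : ℕ) : cons p ω (i + 1) = ω i := rfl

lemma measurable_cons {α : Type} [MeasurableSpace α] :
    Measurable fun q : α × (ℕ → α) => cons q.1 q.2 := by
  refine measurable_pi_lambda _ fun i => ?_
  cases i with
  | zero => exact measurable_fst
  | succ i => exact (measurable_pi_apply i).comp measurable_snd

lemma infinitePi_eq_map_cons {α : Type} [MeasurableSpace α] (μ : Measure α)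
    [IsProbabilityMeasure μ] :
    (μ.prod (Measure.infinitePi fun _ : ℕ => μ)).map (fun q => cons q.1 q.2)
      = Measure.infinitePi fun _ : ℕ => μ := by
  classical
  refine Measure.eq_infinitePi _ fun s t ht => ?_
  rw [Measure.map_apply measurable_cons
    (MeasurableSet.pi s.countable_toSet fun i _ => ht i)]
  have h : (fun q : α × (ℕ → α) => cons q.1 q.2) ⁻¹' ((s : Set ℕ).pi t)
      = (if 0 ∈ s then t 0 else Set.univ) ×ˢ
        (((s.preimage Nat.succ Nat.succ_injective.injOn : Finset ℕ) : Set ℕ).pi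
          fun i => t (i + 1)) := by
    ext ⟨p, ω⟩
    simp only [Set.mem_preimage, Set.mem_pi, Finset.mem_coe, Set.mem_prod, Finset.mem_preimage]
    constructor
    · intro hq
      refine ⟨?_, fun i hi => hq (i + 1) hi⟩
      split_ifs with h0
      · exact hq 0 h0
      · trivial
    · rintro ⟨h0, h1⟩ i hi
      cases i with
      | zero => rw [if_pos hi] at h0; exact h0
      | succ i => exact h1 i hi
  have h2 : ∏ i ∈ s.preimage Nat.succ Nat.succ_injective.injOn, μ (t (i + 1))
      = ∏ i ∈ s with i ∈ Set.range Nat.succ, μ (t i) :=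
    Finset.prod_preimage' Nat.succ s Nat.succ_injective.injOn fun i => μ (t i)
  rw [h, Measure.prod_prod, Measure.infinitePi_pi _ (fun i _ => ht (i + 1)), h2]
  by_cases h0 : 0 ∈ s
  · rw [if_pos h0, ← Finset.mul_prod_erase s _ h0]
    congr 1
    refine Finset.prod_congr ?_ fun _ _ => rfl
    ext i
    cases i <;> simp
  · rw [if_neg h0, measure_univ, one_mul]
    refine Finset.prod_congr ?_ fun _ _ => rfl
    ext i
    cases i <;> simp [h0]

lemma lintegral_clockM [Finite V] [MeasurableSingletonClass V] {f : (ℕ → ℝ × V) → ENNReal}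
    (hf : Measurable f) :
    ∫⁻ ω, f ω ∂(clockM S)
      = ∫⁻ τ, (S.card : ENNReal)⁻¹ * ∑ g ∈ S, ∫⁻ ω, f (cons (τ, g) ω) ∂(clockM S) ∂expo := by
  conv_lhs => rw [clockM, ← infinitePi_eq_map_cons]
  have h : Measurable fun q : (ℝ × V) × (ℕ → ℝ × V) => f (cons q.1 q.2) := hf.comp measurable_cons
  rw [lintegral_map hf measurable_cons, lintegral_prod _ h.aemeasurable, incr,
    lintegral_prod _ h.lintegral_prod_right'.aemeasurable]
  simp_rw [lintegral_unifM]
  rfl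

end StepWalk

lemma pow_apply_nonneg {V : Type} [Fintype V] [DecidableEq V] {M : Matrix V V ℝ}
    (hM : ∀ x y, 0 ≤ M x y) (k : ℕ) (x y : V) : 0 ≤ (M ^ k) x y := by
  induction k generalizing x with
  | zero => rw [pow_zero, Matrix.one_apply]; split_ifs <;> norm_num
  | succ k ih =>
    rw [pow_succ', Matrix.mul_apply]
    exact Finset.sum_nonneg fun z _ => mul_nonneg (hM x z) (ih z)

lemma stepMat_nonneg {V : Type} [AddCommGroup V] [DecidableEq V] (S : Finset V) (x y : V) :
    0 ≤ stepMat S x y := by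
  simp only [stepMat, Matrix.of_apply]; split_ifs <;> positivity

lemma killedMat_nonneg {V : Type} [Fintype V] [DecidableEq V] {K : Matrix V V ℝ}
    (hK : ∀ x y, 0 ≤ K x y) (A : Finset V) (x y : V) : 0 ≤ killedMat K A x y := by
  simp only [killedMat, Matrix.of_apply]; split_ifs
  exacts [le_rfl, hK x y]

namespace StepWalk

lemma ae_expo_pos : ∀ᵐ τ ∂expo, 0 < τ :=
  (withDensity_absolutelyContinuous _ _).ae_le (ae_restrict_mem measurableSet_Ioi)

variable {V : Type}

/-- Jump times. -/
def T (ω : ℕ → ℝ × V) (k : ℕ) : ℝ := ∑ i ∈ Finset.range k, (ω i).1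

/-- The sequence of waiting times and increments seen after time `t`, when `k` jumps have
occurred up to time `t`. -/
def theta (t : ℝ) (k : ℕ) (ω : ℕ → ℝ × V) : ℕ → ℝ × V :=
  cons (T ω (k + 1) - t, (ω k).2) fun i => ω (k + 1 + i)

@[simp] lemma T_zero (ω : ℕ → ℝ × V) : T ω 0 = 0 := by simp [T]

lemma T_succ (ω : ℕ → ℝ × V) (k : ℕ) : T ω (k + 1) = T ω k + (ω k).1 := by
  simp [T, Finset.sum_range_succ]

@[simp] lemma T_cons (p : ℝ × V) (ω : ℕ → ℝ × V) (k : ℕ) :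
    T (cons p ω) (k + 1) = p.1 + T ω k := by
  simp [T, Finset.sum_range_succ', add_comm]

lemma measurable_T [MeasurableSpace V] (k : ℕ) : Measurable fun ω : ℕ → ℝ × V => T ω k := by
  unfold T; fun_prop

lemma theta_cons_zero (t : ℝ) (p : ℝ × V) (ω : ℕ → ℝ × V) :
    theta t 0 (cons p ω) = cons (p.1 - t, p.2) ω := by
  funext i
  cases i with
  | zero => simp [theta]
  | succ i => simp [theta, add_comm 1 i]

lemma theta_cons_succ (t : ℝ) (k : ℕ) (p : ℝ × V) (ω : ℕ → ℝ × V) :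
    theta t (k + 1) (cons p ω) = theta (t - p.1) k ω := by
  funext i
  cases i with
  | zero => simp [theta]; ring
  | succ i => simp [theta, add_right_comm _ 1 i]

lemma measurable_theta [MeasurableSpace V] (t : ℝ) (k : ℕ) :
    Measurable fun ω : ℕ → ℝ × V => theta t k ω := by
  refine measurable_cons.comp (.prodMk (.prodMk ((measurable_T _).sub_const _) ?_) ?_)
  · fun_prop
  · fun_prop

variable [AddCommGroup V]

/-- Position after `k` jumps. -/
def pos (x : V) (ω : ℕ → ℝ × V) (k : ℕ) : V := x + ∑ i ∈ Finset.range k, (ω i).2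

@[simp] lemma pos_zero (x : V) (ω : ℕ → ℝ × V) : pos x ω 0 = x := by simp [pos]

lemma pos_succ (x : V) (ω : ℕ → ℝ × V) (k : ℕ) : pos x ω (k + 1) = pos x ω k + (ω k).2 := by
  simp [pos, Finset.sum_range_succ, add_assoc]

@[simp] lemma pos_cons (x : V) (p : ℝ × V) (ω : ℕ → ℝ × V) (k : ℕ) :
    pos x (cons p ω) (k + 1) = pos (x + p.2) ω k := by
  simp only [pos, Finset.sum_range_succ', cons_succ, cons_zero]
  abel

/-- The event that exactly `k` jumps occur up to time `t`, that the path started from `x`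
avoids `A` up to time `t` and is then at `y`. -/
def ev (A : Finset V) (k : ℕ) (x : V) (t : ℝ) (y : V) : Set (ℕ → ℝ × V) :=
  {ω | (∀ i < k, 0 < (ω i).1) ∧ T ω k ≤ t ∧ t < T ω (k + 1) ∧ (∀ j ≤ k, pos x ω j ∉ A) ∧
    pos x ω k = y}

lemma mem_ev_cons_zero {A : Finset V} {x y : V} {t : ℝ} {p : ℝ × V} {ω : ℕ → ℝ × V} :
    cons p ω ∈ ev A 0 x t y ↔ 0 ≤ t ∧ t < p.1 ∧ x ∉ A ∧ x = y := by
  simp [ev]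

lemma mem_ev_cons_succ {A : Finset V} {k : ℕ} {x y : V} {t : ℝ} {p : ℝ × V} {ω : ℕ → ℝ × V} :
    cons p ω ∈ ev A (k + 1) x t y ↔
      0 < p.1 ∧ x ∉ A ∧ ω ∈ ev A k (x + p.2) (t - p.1) y := by
  simp only [ev, Set.mem_ofPred_eq, T_cons, pos_cons]
  constructor
  · rintro ⟨h1, h2, h3, h4, h5⟩
    refine ⟨by simpa using h1 0 (by omega), by simpa using h4 0 (by omega),
      fun i hi => by simpa using h1 (i + 1) (by omega), by linarith, by linarith,
      fun j hj => by simpa using h4 (j + 1) (by omega), h5⟩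
  · rintro ⟨h0, hx, h1, h2, h3, h4, h5⟩
    refine ⟨fun i hi => ?_, by linarith, by linarith, fun j hj => ?_, h5⟩
    · cases i with
      | zero => exact h0
      | succ i => exact h1 i (by omega)
    · cases j with
      | zero => simpa using hx
      | succ j => simpa using h4 j (by omega)

variable [Fintype V] [MeasurableSpace V] [MeasurableSingletonClass V]

lemma measurable_pos (x : V) (k : ℕ) : Measurable fun ω : ℕ → ℝ × V => pos x ω k := by
  induction k with
  | zero => simp
  | succ k ih =>
    simp only [pos_succ]
    exact (Measurable.of_discrete (f := fun q : V × V => q.1 + q.2)).comp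
      (ih.prodMk (measurable_snd.comp (measurable_pi_apply k)))

lemma measurableSet_ev (A : Finset V) (k : ℕ) (x : V) (t : ℝ) (y : V) :
    MeasurableSet (ev A k x t y) := by
  have h : ev A k x t y = (⋂ i, ⋂ (_ : i < k), {ω : ℕ → ℝ × V | 0 < (ω i).1}) ∩
      ({ω | T ω k ≤ t} ∩ ({ω | t < T ω (k + 1)} ∩ ((⋂ j, ⋂ (_ : j ≤ k),
        (fun ω => pos x ω j) ⁻¹' (A : Set V)ᶜ) ∩ (fun ω => pos x ω k) ⁻¹' {y}))) := by
    ext ω; simp [ev]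
  rw [h]
  refine .inter (.iInter fun i => .iInter fun _ => measurableSet_lt (by fun_prop) (by fun_prop))
    (.inter (measurableSet_le (measurable_T k) measurable_const)
    (.inter (measurableSet_lt measurable_const (measurable_T _))
    (.inter (.iInter fun j => .iInter fun _ => measurable_pos x j ?_)
      (measurable_pos x k (measurableSet_singleton y)))))
  exact (Set.toFinite _).measurableSet

variable [DecidableEq V] (S : Finset V) [hS : Fact S.Nonempty]

lemma lintegral_ev (A : Finset V) (k : ℕ) (x : V) (t : ℝ) (y : V)
    {f : (ℕ → ℝ × V) → ENNReal} (hf : Measurable f) :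
    ∫⁻ ω, (ev A k x t y).indicator (fun ω => f (theta t k ω)) ω ∂(clockM S)
      = if 0 ≤ t ∧ x ∉ A then ENNReal.ofReal (Real.exp (-t) * t ^ k / k.factorial *
          (killedMat (stepMat S) A ^ k) x y) * ∫⁻ ω, f ω ∂(clockM S) else 0 := by
  classical
  have hm : ∀ k x t, Measurable ((ev A k x t y).indicator fun ω => f (theta t k ω)) :=
    fun k x t => (hf.comp (measurable_theta t k)).indicator (measurableSet_ev A k x t y)
  have hcard : (S.card : ENNReal) ≠ 0 := by simpa using hS.out.ne_empty
  induction k generalizing x t with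
  | zero =>
    rw [lintegral_clockM S (hm _ _ _)]
    by_cases h : 0 ≤ t ∧ x ∉ A
    · rw [if_pos h]
      by_cases hxy : x = y
      · have h1 : ∀ (τ : ℝ) (g : V) (ω : ℕ → ℝ × V), (ev A 0 x t y).indicator
            (fun ω => f (theta t 0 ω)) (cons (τ, g) ω)
              = if t < τ then f (cons (τ - t, g) ω) else 0 := by
          intro τ g ω
          rw [Set.indicator_apply, theta_cons_zero]
          simp only [mem_ev_cons_zero, h.1, hxy, true_and, and_true]
          congr 1
          rw [hxy] at h
          simp [h.2]
        simp_rw [h1]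
        obtain ⟨F, hF⟩ : ∃ F : ℝ → ENNReal, F = fun r =>
            (S.card : ENNReal)⁻¹ * ∑ g ∈ S, ∫⁻ ω, f (cons (r, g) ω) ∂(clockM S) := ⟨_, rfl⟩
        have h2 : ∀ τ : ℝ, ((S.card : ENNReal)⁻¹ * ∑ g ∈ S, ∫⁻ ω, (if t < τ then
            f (cons (τ - t, g) ω) else 0) ∂(clockM S)) = if t < τ then F (τ - t) else 0 := by
          intro τ
          split_ifs <;> simp [hF]
        rw [lintegral_congr h2, lintegral_expo_memoryless h.1, lintegral_clockM S hf]
        · simp [hxy, hF]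
        · rw [hF]
          refine Measurable.const_mul (Finset.measurable_sum _ fun g _ => ?_) _
          have : Measurable fun q : ℝ × (ℕ → ℝ × V) => f (cons (q.1, g) q.2) :=
            hf.comp (measurable_cons.comp (.prodMk (by fun_prop) measurable_snd))
          exact this.lintegral_prod_right'
      · simp [mem_ev_cons_zero, hxy]
    · rw [if_neg h]
      have h1 : ∀ (τ : ℝ) (g : V) (ω : ℕ → ℝ × V), cons (τ, g) ω ∉ ev A 0 x t y :=
        fun τ g ω hω => h ⟨(mem_ev_cons_zero.1 hω).1, (mem_ev_cons_zero.1 hω).2.2.1⟩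
      simp [Set.indicator_of_notMem (h1 _ _ _)]
  | succ k ih =>
    rw [lintegral_clockM S (hm _ _ _)]
    set I := ∫⁻ ω, f ω ∂(clockM S)
    have h1 : ∀ (τ : ℝ) (g : V), ∫⁻ ω, (ev A (k + 1) x t y).indicator
        (fun ω => f (theta t (k + 1) ω)) (cons (τ, g) ω) ∂(clockM S)
          = if 0 < τ ∧ x ∉ A then ∫⁻ ω, (ev A k (x + g) (t - τ) y).indicator
              (fun ω => f (theta (t - τ) k ω)) ω ∂(clockM S) else 0 := by
      intro τ g
      split_ifs with h
      · refine lintegral_congr fun ω => ?_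
        simp only [Set.indicator_apply, mem_ev_cons_succ, theta_cons_succ, h.1, h.2, true_and,
          not_false_eq_true]
      · rw [← lintegral_zero (μ := clockM S)]
        refine lintegral_congr fun ω => Set.indicator_of_notMem (fun hω => h ?_) _
        exact ⟨(mem_ev_cons_succ.1 hω).1, (mem_ev_cons_succ.1 hω).2.1⟩
    simp_rw [h1, ih]
    by_cases hx : x ∉ A
    · have hM := killedMat_nonneg (stepMat_nonneg S) A
      have hC : (S.card : ENNReal)⁻¹ * ∑ g ∈ S, (if x + g ∉ A then
          ENNReal.ofReal ((killedMat (stepMat S) A ^ k) (x + g) y) else 0)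
            = ENNReal.ofReal ((killedMat (stepMat S) A ^ (k + 1)) x y) := by
        have h3 : (killedMat (stepMat S) A ^ (k + 1)) x y = (S.card : ℝ)⁻¹ * ∑ g ∈ S,
            if x + g ∉ A then (killedMat (stepMat S) A ^ k) (x + g) y else 0 := by
          rw [pow_succ', Matrix.mul_apply, ← sum_stepMat S fun z => if z ∉ A then
            (killedMat (stepMat S) A ^ k) z y else 0]
          refine Finset.sum_congr rfl fun z _ => ?_
          by_cases hz : z ∈ A <;> simp [killedMat, hx, hz]
        rw [h3, ENNReal.ofReal_mul (by positivity), ENNReal.ofReal_sum_of_nonneg,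
          ENNReal.ofReal_inv_of_pos (by simpa using hS.out), ENNReal.ofReal_natCast]
        · congr 1
          refine Finset.sum_congr rfl fun g _ => ?_
          split_ifs <;> simp
        · intro g _
          split_ifs
          exacts [le_rfl, pow_apply_nonneg hM k _ _]
      have h2 : ∀ᵐ τ ∂expo, ((S.card : ENNReal)⁻¹ * ∑ g ∈ S, (if 0 < τ ∧ x ∉ A then
          if 0 ≤ t - τ ∧ x + g ∉ A then ENNReal.ofReal (Real.exp (-(t - τ)) * (t - τ) ^ k /
            k.factorial * (killedMat (stepMat S) A ^ k) (x + g) y) * I else 0 else 0))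
          = (if τ ≤ t then ENNReal.ofReal (Real.exp (-(t - τ)) * (t - τ) ^ k / k.factorial) else 0)
            * (ENNReal.ofReal ((killedMat (stepMat S) A ^ (k + 1)) x y) * I) := by
        filter_upwards [ae_expo_pos] with τ hτ
        rw [← hC]
        by_cases ht : τ ≤ t
        · have ht0 : 0 ≤ t - τ := by linarith
          simp only [hτ, hx, ht, ht0, true_and, if_true, not_false_eq_true]
          rw [mul_left_comm, mul_assoc (S.card : ENNReal)⁻¹, Finset.sum_mul]
          congr 1
          refine Finset.sum_congr rfl fun g _ => ?_
          split_ifs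
          · rw [zero_mul]
          · rw [ENNReal.ofReal_mul (by positivity), mul_assoc, mul_left_comm]
        · have ht0 : ¬ 0 ≤ t - τ := by linarith
          simp [ht, ht0]
      rw [lintegral_congr_ae h2, lintegral_mul_const _
        (Measurable.ite measurableSet_Iic (by fun_prop) (by fun_prop))]
      by_cases ht : 0 ≤ t
      · rw [if_pos ⟨ht, hx⟩, lintegral_expo_poisson k ht, ENNReal.ofReal_mul (by positivity),
          mul_assoc]
      · rw [if_neg (fun h => ht h.1)]
        have h3 : ∀ᵐ τ ∂expo, (if τ ≤ t then
            ENNReal.ofReal (Real.exp (-(t - τ)) * (t - τ) ^ k / k.factorial) else 0) = 0 := by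
          filter_upwards [ae_expo_pos] with τ hτ
          rw [if_neg (by linarith)]
        rw [lintegral_congr_ae h3]
        simp
    · simp [hx]

end StepWalk

lemma pow_apply_le_one {V : Type} [Fintype V] [DecidableEq V] {M : Matrix V V ℝ}
    (hM : ∀ x y, 0 ≤ M x y) (hM1 : ∀ x, ∑ y, M x y ≤ 1) (k : ℕ) (x y : V) : (M ^ k) x y ≤ 1 := by
  induction k generalizing x with
  | zero => rw [pow_zero, Matrix.one_apply]; split_ifs <;> norm_num
  | succ k ih =>
    rw [pow_succ', Matrix.mul_apply]
    calc _ ≤ ∑ z, M x z * 1 :=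
          Finset.sum_le_sum fun z _ => mul_le_mul_of_nonneg_left (ih z) (hM x z)
      _ ≤ 1 := by simpa using hM1 x

lemma ofReal_heatKer {V : Type} [Fintype V] [DecidableEq V] {M : Matrix V V ℝ}
    (hM : ∀ x y, 0 ≤ M x y) (hM1 : ∀ x, ∑ y, M x y ≤ 1) {t : ℝ} (ht : 0 ≤ t) (x y : V) :
    ENNReal.ofReal (heatKer M t x y)
      = ∑' k : ℕ, ENNReal.ofReal (Real.exp (-t) * t ^ k / k.factorial * (M ^ k) x y) := by
  refine ENNReal.ofReal_tsum_of_nonneg (fun k => ?_) ?_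
  · exact mul_nonneg (by positivity) (pow_apply_nonneg hM k x y)
  · refine Summable.of_nonneg_of_le
      (fun k => mul_nonneg (by positivity) (pow_apply_nonneg hM k x y)) (fun k => ?_)
      ((Real.summable_pow_div_factorial t).mul_left (Real.exp (-t)))
    rw [← mul_div_assoc]
    exact mul_le_of_le_one_right (by positivity) (pow_apply_le_one hM hM1 k x y)

lemma heatKer_nonneg {V : Type} [Fintype V] [DecidableEq V] {M : Matrix V V ℝ}
    (hM : ∀ x y, 0 ≤ M x y) {t : ℝ} (ht : 0 ≤ t) (x y : V) : 0 ≤ heatKer M t x y :=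
  tsum_nonneg fun k => mul_nonneg (by positivity) (pow_apply_nonneg hM k x y)

lemma sum_stepMat_eq_one {V : Type} [AddCommGroup V] [Fintype V] [DecidableEq V] {S : Finset V}
    (hS : S.Nonempty) (x : V) : ∑ y, stepMat S x y = 1 := by
  have h := sum_stepMat S (fun _ => 1) x
  have h0 : (S.card : ℝ) ≠ 0 := by simpa using hS.ne_empty
  simpa [h0] using h

lemma sum_killedMat_le_one {V : Type} [AddCommGroup V] [Fintype V] [DecidableEq V] {S : Finset V}
    (hS : S.Nonempty) (A : Finset V) (x : V) : ∑ y, killedMat (stepMat S) A x y ≤ 1 := by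
  rw [← sum_stepMat_eq_one hS x]
  refine Finset.sum_le_sum fun y _ => ?_
  simp only [killedMat, Matrix.of_apply]
  split_ifs
  exacts [stepMat_nonneg S x y, le_rfl]

lemma killedMat_empty {V : Type} [Fintype V] [DecidableEq V] (K : Matrix V V ℝ) :
    killedMat K ∅ = K := by
  ext; simp [killedMat]

lemma sum_pow_apply_eq_one {V : Type} [Fintype V] [DecidableEq V] {M : Matrix V V ℝ}
    (hM1 : ∀ x, ∑ y, M x y = 1) (k : ℕ) (x : V) : ∑ y, (M ^ k) x y = 1 := by
  induction k generalizing x with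
  | zero => simp [Matrix.one_apply]
  | succ k ih =>
    simp only [pow_succ', Matrix.mul_apply]
    rw [Finset.sum_comm]
    simp_rw [← Finset.mul_sum, ih, mul_one, hM1]

namespace StepWalk

variable {V : Type}

/-- The waiting times are positive and the jump times tend to infinity. -/
def Good (ω : ℕ → ℝ × V) : Prop := (∀ i, 0 < (ω i).1) ∧ ∀ M : ℕ, ∃ k, (M : ℝ) < T ω k

/-- Number of jumps up to time `t`. -/
def N (t : ℝ) (ω : ℕ → ℝ × V) : ℕ := sInf {k | t < T ω (k + 1)}

lemma T_strictMono {ω : ℕ → ℝ × V} (h : ∀ i, 0 < (ω i).1) : StrictMono (T ω) :=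
  strictMono_nat_of_lt_succ fun k => by rw [T_succ]; linarith [h k]

lemma Good.N_spec {ω : ℕ → ℝ × V} (h : Good ω) {t : ℝ} (ht : 0 ≤ t) :
    T ω (N t ω) ≤ t ∧ t < T ω (N t ω + 1) := by
  have hne : {k | t < T ω (k + 1)}.Nonempty := by
    obtain ⟨M, hM⟩ := exists_nat_gt t
    obtain ⟨k, hk⟩ := h.2 M
    exact ⟨k, (hM.trans hk).trans ((T_strictMono h.1) k.lt_succ_self)⟩
  refine ⟨?_, Nat.sInf_mem hne⟩
  rcases h0 : N t ω with _ | m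
  · simpa using ht
  · by_contra hlt
    have : N t ω ≤ m := Nat.sInf_le (not_le.1 hlt)
    omega

lemma Good.N_eq {ω : ℕ → ℝ × V} (h : Good ω) {t : ℝ} {k : ℕ} (h1 : T ω k ≤ t)
    (h2 : t < T ω (k + 1)) : N t ω = k := by
  have ht : 0 ≤ t := by
    refine le_trans ?_ h1
    rw [← T_zero ω]
    exact (T_strictMono h.1).monotone (Nat.zero_le k)
  obtain ⟨h3, h4⟩ := h.N_spec ht
  have h5 := (T_strictMono h.1).lt_iff_lt.1 (h3.trans_lt h2)
  have h6 := (T_strictMono h.1).lt_iff_lt.1 (h1.trans_lt h4)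
  omega

lemma T_theta {ω : ℕ → ℝ × V} (t : ℝ) (k j : ℕ) :
    T (theta t k ω) (j + 1) = T ω (k + 1 + j) - t := by
  rw [theta, T_cons]
  simp only [T, Finset.sum_range_add]
  ring

lemma Good.theta {ω : ℕ → ℝ × V} (h : Good ω) {t : ℝ} (ht : 0 ≤ t) :
    Good (theta t (N t ω) ω) := by
  constructor
  · intro i
    cases i with
    | zero => exact sub_pos.2 (h.N_spec ht).2
    | succ i => exact h.1 _
  · intro M
    obtain ⟨M', hM'⟩ := exists_nat_gt (M + t)
    obtain ⟨k, hk⟩ := h.2 M'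
    refine ⟨k + 1, ?_⟩
    rw [T_theta]
    have := (T_strictMono h.1).monotone (show k ≤ N t ω + 1 + k by omega)
    linarith

variable [AddCommGroup V]

open Classical in
/-- Position at time `t`. -/
def X (t : ℝ) (q : V × (ℕ → ℝ × V)) : V :=
  if Good q.2 ∧ 0 ≤ t then pos q.1 q.2 (N t q.2) else q.1

lemma Good.X_eq {ω : ℕ → ℝ × V} (h : Good ω) (x : V) {t : ℝ} (ht : 0 ≤ t) :
    X t (x, ω) = pos x ω (N t ω) := if_pos ⟨h, ht⟩

lemma Good.X_zero {ω : ℕ → ℝ × V} (h : Good ω) (x : V) : X 0 (x, ω) = x := by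
  rw [h.X_eq x le_rfl, h.N_eq (k := 0) (by simp) (by simpa [T] using h.1 0), pos_zero]

lemma Good.X_add {ω : ℕ → ℝ × V} (h : Good ω) (x : V) {t u : ℝ} (ht : 0 ≤ t) (hu : 0 ≤ u) :
    X (t + u) (x, ω) = X u (X t (x, ω), StepWalk.theta t (N t ω) ω) := by
  have hθ := h.theta ht
  obtain ⟨h1, h2⟩ := h.N_spec ht
  obtain ⟨h3, h4⟩ := h.N_spec (add_nonneg ht hu)
  have hk : N t ω < N (t + u) ω + 1 :=
    (T_strictMono h.1).lt_iff_lt.1 (h1.trans_lt (by linarith))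
  rw [h.X_eq x (add_nonneg ht hu), h.X_eq x ht, hθ.X_eq _ hu]
  generalize N (t + u) ω = m at *
  generalize N t ω = k at *
  obtain rfl | ⟨j, rfl⟩ : m = k ∨ ∃ j, m = k + 1 + j := by
    rcases Nat.lt_or_ge k m with h5 | h5
    · exact .inr ⟨m - (k + 1), by omega⟩
    · exact .inl (by omega)
  · rw [hθ.N_eq (k := 0) (by simpa using hu) (by rw [T_theta]; simp; linarith), pos_zero]
  · rw [hθ.N_eq (k := j + 1) (by rw [T_theta]; linarith)
      (by rw [T_theta, ← add_assoc]; linarith), StepWalk.theta, pos_cons]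
    simp only [pos, Finset.sum_range_add _ (k + 1), Finset.sum_range_succ _ k]
    abel

lemma mem_ev_iff {ω : ℕ → ℝ × V} (h : Good ω) (A : Finset V) (x y : V) {t : ℝ} (ht : 0 ≤ t)
    (k : ℕ) : ω ∈ ev A k x t y ↔
      N t ω = k ∧ (∀ u, 0 ≤ u → u ≤ t → X u (x, ω) ∉ A) ∧ X t (x, ω) = y := by
  constructor
  · rintro ⟨h1, h2, h3, h4, h5⟩
    have hN := h.N_eq h2 h3
    refine ⟨hN, fun u hu hut => ?_, by rw [h.X_eq x ht, hN, h5]⟩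
    rw [h.X_eq x hu]
    refine h4 _ ?_
    exact Nat.lt_succ_iff.1 ((T_strictMono h.1).lt_iff_lt.1
      ((h.N_spec hu).1.trans_lt (hut.trans_lt h3)))
  · rintro ⟨rfl, h1, h2⟩
    obtain ⟨h3, h4⟩ := h.N_spec ht
    refine ⟨fun i _ => h.1 i, h3, h4, fun j hj => ?_, by rw [← h2, h.X_eq x ht]⟩
    have h0 : 0 ≤ T ω j := Finset.sum_nonneg fun i _ => (h.1 i).le
    have h5 := h1 (T ω j) h0 (((T_strictMono h.1).monotone hj).trans h3)
    rwa [h.X_eq x h0, h.N_eq le_rfl ((T_strictMono h.1) j.lt_succ_self)] at h5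

variable [Fintype V] [MeasurableSpace V] [MeasurableSingletonClass V] [DecidableEq V]
  (S : Finset V) [hS : Fact S.Nonempty]

lemma clockM_ev {A : Finset V} {x : V} (hx : x ∉ A) {t : ℝ} (ht : 0 ≤ t) (k : ℕ) (y : V) :
    clockM S (ev A k x t y) = ENNReal.ofReal (Real.exp (-t) * t ^ k / k.factorial *
          (killedMat (stepMat S) A ^ k) x y) := by
  have h := lintegral_ev S A k x t y (f := fun _ => 1) measurable_const
  rw [if_pos ⟨ht, hx⟩, lintegral_one, measure_univ, mul_one] at h
  rw [← h, ← lintegral_indicator_one (measurableSet_ev A k x t y)]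
  rfl

lemma ae_good : ∀ᵐ ω ∂(clockM S), Good ω := by
  have h1 : ∀ᵐ ω ∂(clockM S), ∀ i, 0 < (ω i).1 := by
    rw [ae_all_iff]
    intro i
    have h2 : ∀ᵐ p ∂(incr S), 0 < p.1 :=
      (Measure.quasiMeasurePreserving_fst (μ := expo) (ν := unifM S)).ae ae_expo_pos
    exact (measurePreserving_eval_infinitePi (fun _ : ℕ => incr S) i).quasiMeasurePreserving.ae h2
  have h2 : ∀ᵐ ω ∂(clockM S), ∀ M : ℕ, ∃ k, (M : ℝ) < T ω k := by
    rw [ae_all_iff]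
    intro M
    have hd : Pairwise (Function.onFun Disjoint
        fun q : ℕ × V => ev (∅ : Finset V) q.1 0 (M : ℝ) q.2) := by
      rintro ⟨k, y⟩ ⟨k', y'⟩ hne
      refine Set.disjoint_left.2 ?_
      rintro ω ⟨a1, a2, a3, -, a5⟩ ⟨b1, b2, b3, -, b5⟩
      have mono : ∀ {i j : ℕ}, (∀ l < j, 0 < (ω l).1) → i ≤ j → T ω i ≤ T ω j := by
        intro i j hp hij
        refine Finset.sum_le_sum_of_subset_of_nonneg (Finset.range_mono hij) fun l hl _ => ?_
        exact (hp l (Finset.mem_range.1 hl)).le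
      rcases lt_trichotomy k k' with h | h | h
      · have := mono b1 h
        simp only [Nat.succ_eq_add_one] at this
        simp only at a3 b2
        linarith
      · subst h
        exact hne (by simp only at a5 b5; rw [← a5, ← b5])
      · have := mono a1 h
        simp only [Nat.succ_eq_add_one] at this
        simp only at a2 b3
        linarith
    have hm : clockM S (⋃ q : ℕ × V, ev (∅ : Finset V) q.1 0 (M : ℝ) q.2) = 1 := by
      rw [measure_iUnion hd fun q => measurableSet_ev _ _ _ _ _, ENNReal.tsum_prod']
      have h3 : ∀ k : ℕ, ∑' y : V, clockM S (ev (∅ : Finset V) k 0 (M : ℝ) y)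
          = ENNReal.ofReal (Real.exp (-(M : ℝ)) * ((M : ℝ) ^ k / k.factorial)) := by
        intro k
        simp_rw [tsum_fintype, clockM_ev S (Finset.notMem_empty _) M.cast_nonneg, killedMat_empty]
        rw [← ENNReal.ofReal_sum_of_nonneg, ← Finset.mul_sum,
          sum_pow_apply_eq_one (sum_stepMat_eq_one hS.out), mul_one, mul_div_assoc]
        exact fun y _ => mul_nonneg (by positivity) (pow_apply_nonneg (stepMat_nonneg S) _ _ _)
      simp_rw [h3]
      rw [← ENNReal.ofReal_tsum_of_nonneg (fun k => by positivity)
        ((Real.summable_pow_div_factorial _).mul_left _), tsum_mul_left]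
      have h4 : ∑' k : ℕ, (M : ℝ) ^ k / k.factorial = Real.exp M := by
        rw [Real.exp_eq_exp_ℝ, NormedSpace.exp_eq_tsum_div]
      rw [h4, ← Real.exp_add]
      simp
    have h5 := (prob_compl_eq_zero_iff (.iUnion fun q => measurableSet_ev _ _ _ _ _)).2 hm
    filter_upwards [measure_eq_zero_iff_ae_notMem.1 h5] with ω hω
    rw [Set.notMem_compl_iff, Set.mem_iUnion] at hω
    obtain ⟨q, hq⟩ := hω
    exact ⟨_, hq.2.2.1⟩
  filter_upwards [h1, h2] with ω hω1 hω2 using ⟨hω1, hω2⟩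

/-- Markov property at time `t`, for the path killed on hitting `A`. -/
lemma lintegral_markov (A : Finset V) (x y : V) {t : ℝ} (ht : 0 ≤ t)
    {f : (ℕ → ℝ × V) → ENNReal} (hf : Measurable f) :
    ∫⁻ ω, {ω | (∀ u, 0 ≤ u → u ≤ t → X u (x, ω) ∉ A) ∧ X t (x, ω) = y}.indicator
        (fun ω => f (theta t (N t ω) ω)) ω ∂(clockM S)
      = if x ∉ A then ENNReal.ofReal (heatKer (killedMat (stepMat S) A) t x y) *
          ∫⁻ ω, f ω ∂(clockM S) else 0 := by
  have h1 : ∀ᵐ ω ∂(clockM S),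
      {ω | (∀ u, 0 ≤ u → u ≤ t → X u (x, ω) ∉ A) ∧ X t (x, ω) = y}.indicator
        (fun ω => f (theta t (N t ω) ω)) ω
      = ∑' k, (ev A k x t y).indicator (fun ω => f (theta t k ω)) ω := by
    filter_upwards [ae_good S] with ω hω
    rw [tsum_eq_single (N t ω)]
    · classical
      simp only [Set.indicator_apply, mem_ev_iff hω A x y ht, true_and, Set.mem_ofPred_eq]
    · intro k hk
      exact Set.indicator_of_notMem (fun h => hk ((mem_ev_iff hω A x y ht k).1 h).1.symm) _
  have hm : ∀ k, Measurable ((ev A k x t y).indicator fun ω => f (theta t k ω)) := fun k =>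
    (hf.comp (measurable_theta t k)).indicator (measurableSet_ev A k x t y)
  rw [lintegral_congr_ae h1, lintegral_tsum fun k => (hm k).aemeasurable]
  simp_rw [lintegral_ev S A _ x t y hf]
  by_cases hx : x ∈ A
  · simp [hx]
  · simp only [ht, hx, not_false_eq_true, and_self, if_true]
    rw [ENNReal.tsum_mul_right, ofReal_heatKer (killedMat_nonneg (stepMat_nonneg S) A)
      (sum_killedMat_le_one hS.out A) ht]

end StepWalk

namespace StepWalk

variable {V : Type}

lemma measurableSet_good [MeasurableSpace V] : MeasurableSet {ω : ℕ → ℝ × V | Good ω} := by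
  have h : {ω : ℕ → ℝ × V | Good ω} = (⋂ i, {ω : ℕ → ℝ × V | 0 < (ω i).1}) ∩
      ⋂ M : ℕ, ⋃ k, {ω : ℕ → ℝ × V | (M : ℝ) < T ω k} := by
    ext ω; simp [Good]
  rw [h]
  exact .inter (.iInter fun i => measurableSet_lt (by fun_prop) (by fun_prop))
    (.iInter fun M => .iUnion fun k => measurableSet_lt measurable_const (measurable_T k))

variable [AddCommGroup V]

lemma eventually_X_eq (q : V × (ℕ → ℝ × V)) (t : ℝ) :
    ∃ ε > 0, ∀ s, t ≤ s → s < t + ε → X s q = X t q := by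
  obtain ⟨x, ω⟩ := q
  by_cases h : Good ω
  · rcases lt_or_ge t 0 with ht | ht
    · refine ⟨-t, by linarith, fun s _ h2 => ?_⟩
      rw [X, X, if_neg (by simp only [not_and]; intro _; linarith),
        if_neg (by simp only [not_and]; intro _; linarith)]
    · obtain ⟨h1, h2⟩ := h.N_spec ht
      refine ⟨T ω (N t ω + 1) - t, by linarith, fun s h3 h4 => ?_⟩
      rw [h.X_eq x ht, h.X_eq x (ht.trans h3), h.N_eq (k := N t ω) (h1.trans h3) (by linarith)]
  · refine ⟨1, one_pos, fun s _ _ => ?_⟩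
    simp [X, h]

variable [Fintype V] [MeasurableSpace V] [MeasurableSingletonClass V]

lemma measurable_pos_prod (k : ℕ) :
    Measurable fun q : V × (ℕ → ℝ × V) => pos q.1 q.2 k := by
  induction k with
  | zero => simpa using measurable_fst
  | succ k ih =>
    simp only [pos_succ]
    exact (Measurable.of_discrete (f := fun q : V × V => q.1 + q.2)).comp
      (ih.prodMk (measurable_snd.comp ((measurable_pi_apply k).comp measurable_snd)))

lemma measurable_X : Measurable fun p : ℝ × (V × (ℕ → ℝ × V)) => X p.1 p.2 := by
  refine measurable_to_countable' fun y => ?_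
  have hg : MeasurableSet {p : ℝ × (V × (ℕ → ℝ × V)) | Good p.2.2 ∧ 0 ≤ p.1} :=
    (measurable_snd.comp measurable_snd measurableSet_good).inter
      (measurableSet_le measurable_const measurable_fst)
  have h : (fun p : ℝ × (V × (ℕ → ℝ × V)) => X p.1 p.2) ⁻¹' {y}
      = ({p : ℝ × (V × (ℕ → ℝ × V)) | Good p.2.2 ∧ 0 ≤ p.1} ∩
          ⋃ k, ({p | T p.2.2 k ≤ p.1} ∩ {p | p.1 < T p.2.2 (k + 1)}) ∩
            {p | pos p.2.1 p.2.2 k = y}) ∪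
        ({p : ℝ × (V × (ℕ → ℝ × V)) | Good p.2.2 ∧ 0 ≤ p.1}ᶜ ∩ {p | p.2.1 = y}) := by
    ext ⟨t, x, ω⟩
    by_cases hq : Good ω ∧ 0 ≤ t
    · simp only [Set.mem_preimage, Set.mem_singleton_iff, Set.mem_union, Set.mem_inter_iff,
        Set.mem_ofPred_eq, Set.mem_iUnion, Set.mem_compl_iff, hq, not_true_eq_false, false_and,
        or_false, true_and, hq.1.X_eq x hq.2, and_self]
      constructor
      · exact fun h => ⟨_, hq.1.N_spec hq.2, h⟩
      · rintro ⟨k, ⟨h1, h2⟩, h3⟩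
        rwa [hq.1.N_eq h1 h2]
    · simp only [Set.mem_preimage, Set.mem_singleton_iff, Set.mem_union, Set.mem_inter_iff,
        Set.mem_ofPred_eq, Set.mem_compl_iff, hq, not_false_eq_true, false_and, false_or, true_and,
        X, if_false]
  have hT : ∀ k, Measurable fun p : ℝ × (V × (ℕ → ℝ × V)) => T p.2.2 k := fun k =>
    (measurable_T k).comp (measurable_snd.comp measurable_snd)
  rw [h]
  refine .union (.inter hg (.iUnion fun k => .inter (.inter (measurableSet_le (hT k) measurable_fst)
    (measurableSet_lt measurable_fst (hT _))) ?_)) (.inter hg.compl ?_)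
  · exact (measurable_pos_prod k).comp measurable_snd (measurableSet_singleton y)
  · exact (measurable_fst.comp measurable_snd) (measurableSet_singleton y)

lemma measurable_X_time (t : ℝ) : Measurable fun q : V × (ℕ → ℝ × V) => X t q :=
  measurable_X.comp measurable_prodMk_left

lemma measurable_X_path (t : ℝ) (x : V) : Measurable fun ω : ℕ → ℝ × V => X t (x, ω) :=
  (measurable_X_time t).comp measurable_prodMk_left

lemma measurableSet_avoid (A : Finset V) {t : ℝ} (ht : 0 ≤ t) :
    MeasurableSet ({q : V × (ℕ → ℝ × V) | ∀ u, 0 ≤ u → u ≤ t → X u q ∉ A} ∩ {q | Good q.2}) := by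
  have h : {q : V × (ℕ → ℝ × V) | ∀ u, 0 ≤ u → u ≤ t → X u q ∉ A} ∩ {q | Good q.2}
      = (⋃ x : V, ⋃ k : ℕ, ⋃ y : V, {x} ×ˢ ev A k x t y) ∩ {q | Good q.2} := by
    ext ⟨x, ω⟩
    simp only [Set.mem_inter_iff, and_congr_left_iff, Set.mem_ofPred_eq, Set.mem_iUnion,
      Set.mem_prod, Set.mem_singleton_iff]
    intro hg
    constructor
    · exact fun h => ⟨x, N t ω, X t (x, ω), rfl, (mem_ev_iff hg A x _ ht _).2 ⟨rfl, h, rfl⟩⟩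
    · rintro ⟨_, k, y, rfl, h⟩
      exact ((mem_ev_iff hg A x _ ht _).1 h).2.1
  rw [h]
  exact .inter (.iUnion fun x => .iUnion fun k => .iUnion fun y =>
    (measurableSet_singleton x).prod (measurableSet_ev _ _ _ _ _))
      (measurable_snd measurableSet_good)

variable [DecidableEq V] (S : Finset V) [hS : Fact S.Nonempty]

lemma clockM_fdd (n : ℕ) (x : V) (t : Fin (n + 1) → ℝ) (ht : Monotone t) (ht0 : t 0 = 0)
    (y : Fin (n + 1) → V) :
    clockM S {ω | ∀ i, X (t i) (x, ω) = y i} =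
      ENNReal.ofReal ((if y 0 = x then (1 : ℝ) else 0) *
        ∏ i : Fin n, heatKer (stepMat S) (t i.succ - t i.castSucc) (y i.castSucc) (y i.succ)) := by
  by_cases hy : y 0 = x
  swap
  · rw [if_neg hy, zero_mul, ENNReal.ofReal_zero, measure_eq_zero_iff_ae_notMem]
    filter_upwards [ae_good S] with ω hω h
    refine hy ?_
    rw [← h 0, ht0, hω.X_zero]
  rw [if_pos hy, one_mul]
  induction n generalizing x with
  | zero =>
    have h : ∀ᵐ ω ∂(clockM S), ω ∈ {ω : ℕ → ℝ × V | ∀ i, X (t i) (x, ω) = y i} := by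
      filter_upwards [ae_good S] with ω hω i
      rw [Fin.fin_one_eq_zero i, ht0, hω.X_zero, hy]
    rw [measure_eq_measure_of_null_sdiff (Set.subset_univ _)
      (by rw [← Set.compl_eq_univ_sdiff]; exact h)]
    simp
  | succ n ih =>
    have h01 : 0 ≤ t 1 := ht0 ▸ ht (Fin.zero_le 1)
    set E' : Set (ℕ → ℝ × V) := {ω | ∀ i : Fin (n + 1), X (t i.succ - t 1) (y 1, ω) = y i.succ}
      with hE'
    have hE'm : MeasurableSet E' := by
      have : E' = ⋂ i : Fin (n + 1), (fun ω => X (t i.succ - t 1) (y 1, ω)) ⁻¹' {y i.succ} := by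
        ext; simp [hE']
      rw [this]
      exact .iInter fun i => measurable_X_path _ _ (measurableSet_singleton _)
    have hE : MeasurableSet {ω : ℕ → ℝ × V | ∀ i, X (t i) (x, ω) = y i} := by
      have : {ω : ℕ → ℝ × V | ∀ i, X (t i) (x, ω) = y i}
          = ⋂ i, (fun ω => X (t i) (x, ω)) ⁻¹' {y i} := by
        ext; simp
      rw [this]
      exact .iInter fun i => measurable_X_path _ _ (measurableSet_singleton _)
    have h := ih (y 1) (fun i => t i.succ - t 1)
      (fun i j hij => sub_le_sub_right (ht (Fin.succ_le_succ_iff.2 hij)) _) (by simp)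
      (fun i => y i.succ) (by simp)
    have hm := lintegral_markov S ∅ x (y 1) h01 (measurable_one.indicator hE'm)
    rw [lintegral_indicator_one hE'm, killedMat_empty, if_pos (Finset.notMem_empty x), hE', h] at hm
    rw [← lintegral_indicator_one hE]
    have h2 : ∀ᵐ ω ∂(clockM S),
        {ω : ℕ → ℝ × V | ∀ i, X (t i) (x, ω) = y i}.indicator (1 : (ℕ → ℝ × V) → ENNReal) ω
        = {ω | (∀ u, 0 ≤ u → u ≤ t 1 → X u (x, ω) ∉ (∅ : Finset V)) ∧
            X (t 1) (x, ω) = y 1}.indicator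
          (fun ω => E'.indicator (1 : (ℕ → ℝ × V) → ENNReal) (theta (t 1) (N (t 1) ω) ω)) ω := by
      filter_upwards [ae_good S] with ω hω
      classical
      simp only [Set.indicator_apply, Finset.notMem_empty, not_false_eq_true, implies_true,
        true_and, Set.mem_ofPred_eq, hE', Pi.one_apply]
      have key : (∀ i, X (t i) (x, ω) = y i) ↔ X (t 1) (x, ω) = y 1 ∧
          ∀ i : Fin (n + 1), X (t i.succ - t 1) (y 1, theta (t 1) (N (t 1) ω) ω) = y i.succ := by
        have step : ∀ i : Fin (n + 1), X (t 1) (x, ω) = y 1 →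
            X (t i.succ - t 1) (y 1, theta (t 1) (N (t 1) ω) ω) = X (t i.succ) (x, ω) := by
          intro i hi
          have h1 : t 1 ≤ t i.succ := ht (Fin.succ_le_succ_iff.2 (Fin.zero_le i))
          rw [← hi, ← hω.X_add x h01 (sub_nonneg.2 h1), add_sub_cancel]
        constructor
        · exact fun h => ⟨h 1, fun i => (step i (h 1)).trans (h i.succ)⟩
        · rintro ⟨h1, h3⟩ i
          refine Fin.cases ?_ (fun i => ?_) i
          · rw [ht0, hω.X_zero, hy]
          · rw [← step i h1, h3]
      by_cases hc : X (t 1) (x, ω) = y 1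
      · simp only [key, hc, true_and, if_true]
      · simp only [key, hc, false_and, if_false]
    rw [lintegral_congr_ae h2, hm, ← ENNReal.ofReal_mul
      (heatKer_nonneg (stepMat_nonneg S) h01 _ _), Fin.prod_univ_succ]
    congr 2
    · simp [ht0, hy]
    · refine Finset.prod_congr rfl fun i _ => ?_
      simp

/-- The continuous-time random walk with increments uniform in `S`. -/
def walk {K : Matrix V V ℝ} (hK : K = stepMat S) : CTMC V K where
  Ω := V × (ℕ → ℝ × V)
  mΩ := inferInstance
  P x := (clockM S).map (Prod.mk x)
  prob x := Measure.isProbabilityMeasure_map measurable_prodMk_left.aemeasurable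
  X := X
  measX t y := measurable_X_time t (measurableSet_singleton y)
  rightCts := eventually_X_eq
  fdd x n t ht ht0 y := by
    subst hK
    rw [Measure.map_apply measurable_prodMk_left]
    · exact clockM_fdd S n x t ht ht0 y
    · have : {q : V × (ℕ → ℝ × V) | ∀ i, X (t i) q = y i} =
          ⋂ i, (fun q => X (t i) q) ⁻¹' {y i} := by
        ext; simp
      rw [this]
      exact .iInter fun i => measurable_X_time _ (measurableSet_singleton _)

lemma clockM_avoid (A : Finset V) (x : V) {t : ℝ} (ht : 0 ≤ t) :
    clockM S {ω | ∀ u, 0 ≤ u → u ≤ t → X u (x, ω) ∉ A}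
      = ENNReal.ofReal (if x ∈ A then 0 else ∑ y, heatKer (killedMat (stepMat S) A) t x y) := by
  have hn : ∀ y, NullMeasurableSet
      {ω : ℕ → ℝ × V | (∀ u, 0 ≤ u → u ≤ t → X u (x, ω) ∉ A) ∧ X t (x, ω) = y} (clockM S) := by
    intro y
    have h2 : {ω : ℕ → ℝ × V | (∀ u, 0 ≤ u → u ≤ t → X u (x, ω) ∉ A) ∧ X t (x, ω) = y}
        =ᵐ[clockM S] ⋃ k, ev A k x t y := by
      filter_upwards [ae_good S] with ω hω
      refine propext ?_
      change _ ↔ ω ∈ ⋃ k, ev A k x t y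
      rw [Set.mem_iUnion]
      simp only [mem_ev_iff hω A x y ht]
      exact ⟨fun h => ⟨_, rfl, h⟩, fun ⟨k, h⟩ => h.2⟩
    exact (MeasurableSet.iUnion fun k => measurableSet_ev A k x t y).nullMeasurableSet.congr
      h2.symm
  have h1 : ∀ y, clockM S {ω | (∀ u, 0 ≤ u → u ≤ t → X u (x, ω) ∉ A) ∧ X t (x, ω) = y}
      = if x ∉ A then ENNReal.ofReal (heatKer (killedMat (stepMat S) A) t x y) else 0 := by
    intro y
    have h := lintegral_markov S A x y ht (f := fun _ => 1) measurable_const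
    rw [lintegral_one, measure_univ, mul_one] at h
    rw [← h, ← lintegral_indicator_one₀ (hn y)]
    rfl
  have h3 : {ω : ℕ → ℝ × V | ∀ u, 0 ≤ u → u ≤ t → X u (x, ω) ∉ A}
      = ⋃ y, {ω : ℕ → ℝ × V | (∀ u, 0 ≤ u → u ≤ t → X u (x, ω) ∉ A) ∧ X t (x, ω) = y} := by
    ext ω; simp
  rw [h3, measure_iUnion₀ (fun y z hyz => (Set.disjoint_left.2 fun ω h h' =>
    hyz (h.2.symm.trans h'.2)).aedisjoint) hn, tsum_fintype]
  simp only [h1]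
  by_cases hx : x ∈ A
  · simp [hx]
  · simp only [hx, not_false_eq_true, if_true, if_false]
    rw [ENNReal.ofReal_sum_of_nonneg fun y _ =>
      heatKer_nonneg (killedMat_nonneg (stepMat_nonneg S) A) ht _ _]

end StepWalk

/-- Probability that the chain with jump matrix `K` started at `x` avoids `A` up to time `t`. -/
def avoidProb {V : Type} [Fintype V] [DecidableEq V] (K : Matrix V V ℝ) (A : Finset V) (t : ℝ)
    (x : V) : ℝ :=
  if x ∈ A then 0 else ∑ y, heatKer (killedMat K A) t x y

namespace CTMC

variable {V : Type} [Fintype V] [DecidableEq V] {K : Matrix V V ℝ}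

/-- The path avoids `A` up to time `t`. -/
def avoid (W : CTMC V K) (A : Finset V) (t : ℝ) : Set W.Ω :=
  {ω | ∀ u, 0 ≤ u → u ≤ t → W.X u ω ∉ A}

attribute [local instance] CTMC.mΩ CTMC.prob

/-- Measurability of the path and of avoidance events, together with the value of the
probability of the latter. -/
structure Regular (W : CTMC V K) : Prop where
  measure_avoid : ∀ x A t, 0 ≤ t → W.P x (W.avoid A t) = ENNReal.ofReal (avoidProb K A t x)
  nullMeas : ∀ x A t, 0 ≤ t → NullMeasurableSet (W.avoid A t) (W.P x)
  joint : ∀ y, MeasurableSet {p : ℝ × W.Ω | W.X p.1 p.2 = y}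

lemma exists_regular [AddCommGroup V] {S : Finset V} (hS : S.Nonempty) (hK : K = stepMat S) :
    ∃ W : CTMC V K, W.Regular := by
  let _ : MeasurableSpace V := ⊤
  have : Fact S.Nonempty := ⟨hS⟩
  have hmap : ∀ (x : V) (A : Finset V) (t : ℝ), 0 ≤ t →
      NullMeasurableSet ((StepWalk.walk S hK).avoid A t) ((StepWalk.walk S hK).P x) := by
    intro x A t ht
    refine (StepWalk.measurableSet_avoid A ht).nullMeasurableSet.congr ?_
    have h : ∀ᵐ q ∂((StepWalk.clockM S).map (Prod.mk x)), StepWalk.Good q.2 := by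
      exact (ae_map_iff measurable_prodMk_left.aemeasurable
        (measurable_snd StepWalk.measurableSet_good)).2 (StepWalk.ae_good S)
    change _ =ᵐ[(StepWalk.clockM S).map (Prod.mk x)] _
    filter_upwards [h] with q hq
    refine propext ⟨fun h => h.1, fun h => ⟨h, hq⟩⟩
  refine ⟨StepWalk.walk S hK, ⟨fun x A t ht => ?_, hmap, fun y => ?_⟩⟩
  · have h := Measure.map_apply₀ (μ := StepWalk.clockM S)
      (measurable_prodMk_left (x := x)).aemeasurable (hmap x A t ht)
    refine h.trans ?_
    subst hK
    exact StepWalk.clockM_avoid S A x ht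
  · exact StepWalk.measurable_X (measurableSet_singleton y)

end CTMC

section AvoidProb

variable {V : Type} [Fintype V] [DecidableEq V] {K : Matrix V V ℝ}

lemma avoidProb_nonneg (hK : ∀ x y, 0 ≤ K x y) (A : Finset V) {t : ℝ} (ht : 0 ≤ t) (x : V) :
    0 ≤ avoidProb K A t x := by
  unfold avoidProb
  split_ifs
  · rfl
  · exact Finset.sum_nonneg fun y _ => heatKer_nonneg (killedMat_nonneg hK A) ht _ _

lemma killedMat_pow_eq_zero (A : Finset V) (k : ℕ) {x y : V} (hx : x ∉ A) (hy : y ∈ A) :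
    (killedMat K A ^ k) x y = 0 := by
  cases k with
  | zero => rw [pow_zero, Matrix.one_apply_ne]; rintro rfl; exact hx hy
  | succ k =>
    rw [pow_succ, Matrix.mul_apply]
    exact Finset.sum_eq_zero fun z _ => by simp [killedMat, hy]

lemma sum_avoidProb (A : Finset V) (t : ℝ) :
    ∑ x, avoidProb K A t x = Fintype.card V * survival K A t := by
  rcases isEmpty_or_nonempty V with h | h
  · simp
  have hn : (Fintype.card V : ℝ) ≠ 0 := Nat.cast_ne_zero.2 Fintype.card_ne_zero
  rw [survival, mul_inv_cancel_left₀ hn, ← Finset.sum_add_sum_compl A,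
    Finset.sum_eq_zero (s := A) fun x hx => by rw [avoidProb, if_pos hx], zero_add]
  refine Finset.sum_congr rfl fun x hx => ?_
  have hx' : x ∉ A := Finset.mem_compl.1 hx
  rw [avoidProb, if_neg hx', ← Finset.sum_add_sum_compl A, Finset.sum_eq_zero (s := A), zero_add]
  intro y hy
  simp [heatKer, killedMat_pow_eq_zero A _ hx' hy]

lemma survival_nonneg (hK : ∀ x y, 0 ≤ K x y) (A : Finset V) {t : ℝ} (ht : 0 ≤ t) :
    0 ≤ survival K A t :=
  mul_nonneg (by positivity) (Finset.sum_nonneg fun _ _ => Finset.sum_nonneg fun _ _ =>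
    heatKer_nonneg (killedMat_nonneg hK A) ht _ _)

variable [AddCommGroup V] {S : Finset V}

lemma killedMat_stepMat_pow_add (A : Finset V) (g : V) (k : ℕ) (x y : V) :
    (killedMat (stepMat S) (A.map (addRightEmbedding g)) ^ k) (x + g) (y + g)
      = (killedMat (stepMat S) A ^ k) x y := by
  induction k generalizing x with
  | zero => simp [Matrix.one_apply]
  | succ k ih =>
    rw [pow_succ', pow_succ', Matrix.mul_apply, Matrix.mul_apply,
      ← Equiv.sum_comp (Equiv.addRight g)]
    refine Finset.sum_congr rfl fun z _ => ?_
    rw [Equiv.coe_addRight, ih]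
    simp [killedMat, stepMat]

lemma avoidProb_stepMat_add (A : Finset V) (g : V) (t : ℝ) (x : V) :
    avoidProb (stepMat S) (A.map (addRightEmbedding g)) t (x + g) =
      avoidProb (stepMat S) A t x := by
  unfold avoidProb
  simp only [Finset.mem_map, addRightEmbedding_apply, add_left_inj, exists_eq_right]
  rw [← Equiv.sum_comp (Equiv.addRight g)]
  simp only [Equiv.coe_addRight, heatKer, killedMat_stepMat_pow_add]

lemma sum_avoidProb_translate (A : Finset V) (t : ℝ) (x : V) :
    ∑ g, avoidProb (stepMat S) (A.map (addRightEmbedding g)) t x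
      = Fintype.card V * survival (stepMat S) A t := by
  rw [← sum_avoidProb, ← Equiv.sum_comp (Equiv.subLeft x)]
  refine Finset.sum_congr rfl fun g _ => ?_
  simpa using avoidProb_stepMat_add (S := S) A (x - g) t g

end AvoidProb

/-- A second-order Bonferroni bound in which each point of `U` is compared with the points of `U`
in a prescribed relative position. -/
lemma one_le_sum_bonferroni {V : Type} [AddCommGroup V] [DecidableEq V] {U F : Finset V}
    (hU : U.Nonempty) (hF : (0 : V) ∉ F) (d : V → ℝ)
    (hd : ∀ y, d y = (F.filter fun w => y + w ∈ U).card) :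
    1 ≤ ∑ y ∈ U, (1 - d y / 2 + d y * (d y - 1) / 2) := by
  have hhalf : ∀ y, 1 / 2 ≤ 1 - d y / 2 + d y * (d y - 1) / 2 := fun y => by
    nlinarith [sq_nonneg (d y - 1)]
  by_cases h : ∃ y ∈ U, d y ≠ 1
  · obtain ⟨y, hy, hy1⟩ := h
    refine le_trans ?_ (Finset.single_le_sum (fun z _ => le_trans (by norm_num) (hhalf z)) hy)
    rw [hd] at hy1 ⊢
    set k := (F.filter fun w => y + w ∈ U).card
    rcases Nat.lt_or_ge k 2 with hk | hk
    · interval_cases k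
      · norm_num
      · norm_num at hy1
    · have : (2 : ℝ) ≤ k := by exact_mod_cast hk
      nlinarith
  · push Not at h
    obtain ⟨y, hy⟩ := hU
    have h1 : (F.filter fun w => y + w ∈ U).card = 1 := by exact_mod_cast (hd y).symm.trans (h y hy)
    obtain ⟨w, hw⟩ := Finset.card_pos.1 (h1 ▸ one_pos)
    rw [Finset.mem_filter] at hw
    have hne : y ≠ y + w := fun h => hF (by rw [left_eq_add.1 h] at hw; exact hw.1)
    have h2 : ({y, y + w} : Finset V) ⊆ U := by
      intro z hz
      rcases Finset.mem_insert.1 hz with rfl | hz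
      · exact hy
      · rw [Finset.mem_singleton.1 hz]; exact hw.2
    refine le_trans ?_ (Finset.sum_le_sum_of_subset_of_nonneg h2
      fun z _ _ => le_trans (by norm_num) (hhalf z))
    rw [Finset.sum_pair hne]
    linarith [hhalf y, hhalf (y + w)]

lemma sum_bonferroni {V : Type} [AddCommGroup V] [Fintype V] [DecidableEq V] (U F : Finset V)
    (hF : (0 : V) ∉ F) (I : Finset V → ℝ) (hI : ∀ A, I A = if A ⊆ U then 1 else 0) :
    (if U.Nonempty then 1 else 0) ≤ ∑ y, (I {y} - (∑ w ∈ F, I {y, w + y}) / 2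
      + (∑ w ∈ F, ∑ w' ∈ F.erase w, I {y, w + y, w' + y}) / 2) := by
  set J : V → ℝ := fun z => if z ∈ U then 1 else 0 with hJ
  set d : V → ℝ := fun y => (F.filter fun w => y + w ∈ U).card with hd
  have hJJ : ∀ z, J z * J z = J z := fun z => by simp [hJ]
  have a1 : ∀ y, I {y} = J y := fun y => by simp [hI, hJ]
  have a2 : ∀ y w, I {y, w + y} = J y * J (y + w) := fun y w => by
    simp only [hI, hJ, add_comm w y, Finset.insert_subset_iff, Finset.singleton_subset_iff]
    by_cases h1 : y ∈ U <;> by_cases h2 : y + w ∈ U <;> simp [h1, h2]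
  have a3 : ∀ y w w', I {y, w + y, w' + y} = J y * (J (y + w) * J (y + w')) := fun y w w' => by
    simp only [hI, hJ, add_comm w y, add_comm w' y, Finset.insert_subset_iff,
      Finset.singleton_subset_iff]
    by_cases h1 : y ∈ U <;> by_cases h2 : y + w ∈ U <;> by_cases h3 : y + w' ∈ U <;>
      simp [h1, h2, h3]
  have a4 : ∀ y, ∑ w ∈ F, J (y + w) = d y := fun y => by
    simp only [hd, Finset.card_filter]; push_cast; rfl
  have a5 : ∀ y, ∑ w ∈ F, ∑ w' ∈ F.erase w, J (y + w) * J (y + w') = d y * (d y - 1) := by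
    intro y
    rw [← a4, mul_sub, mul_one, Finset.sum_mul_sum, ← Finset.sum_sub_distrib]
    refine Finset.sum_congr rfl fun w hw => ?_
    rw [← Finset.add_sum_erase F _ hw, hJJ]; ring
  have a6 : ∀ y, I {y} - (∑ w ∈ F, I {y, w + y}) / 2
      + (∑ w ∈ F, ∑ w' ∈ F.erase w, I {y, w + y, w' + y}) / 2
      = J y * (1 - d y / 2 + d y * (d y - 1) / 2) := by
    intro y
    have : ∑ w ∈ F, ∑ w' ∈ F.erase w, I {y, w + y, w' + y} = J y * (d y * (d y - 1)) := by
      rw [← a5, Finset.mul_sum]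
      exact Finset.sum_congr rfl fun w _ => by simp only [a3, Finset.mul_sum]
    rw [this, a1]
    simp only [a2, ← Finset.mul_sum, a4]
    ring
  have key : ∑ y, (I {y} - (∑ w ∈ F, I {y, w + y}) / 2
      + (∑ w ∈ F, ∑ w' ∈ F.erase w, I {y, w + y, w' + y}) / 2)
      = ∑ y ∈ U, (1 - d y / 2 + d y * (d y - 1) / 2) := by
    rw [← Finset.sum_filter_add_sum_filter_not Finset.univ (· ∈ U), Finset.filter_univ_mem,
      add_eq_left.2]
    · refine Finset.sum_congr rfl fun y hy => ?_
      rw [a6]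
      simp [hJ, hy]
    · refine Finset.sum_eq_zero fun y hy => ?_
      rw [a6]
      simp [hJ, (Finset.mem_filter.1 hy).2]
  rw [key]
  split_ifs with h
  · exact one_le_sum_bonferroni h hF d fun y => rfl
  · rw [Finset.not_nonempty_iff_eq_empty.1 h]; simp

namespace CTMC

attribute [local instance] CTMC.mΩ CTMC.prob

variable {V : Type} [Fintype V] [DecidableEq V] {K : Matrix V V ℝ}

lemma Regular.integral_avoid {W : CTMC V K} (hW : W.Regular) (hK : ∀ x y, 0 ≤ K x y)
    (x : V) (A : Finset V) {t : ℝ} (ht : 0 ≤ t) :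
    Integrable ((W.avoid A t).indicator fun _ => (1 : ℝ)) (W.P x) ∧
    ∫ ω, (W.avoid A t).indicator (fun _ => (1 : ℝ)) ω ∂(W.P x) = avoidProb K A t x := by
  refine ⟨(integrable_const 1).indicator₀ (hW.nullMeas x A t ht), ?_⟩
  rw [integral_indicator₀ (hW.nullMeas x A t ht), setIntegral_const, smul_eq_mul, mul_one,
    measureReal_def, hW.measure_avoid x A t ht, ENNReal.toReal_ofReal (avoidProb_nonneg hK A ht x)]

/-- Upper bound on the tail of the cover time by survival probabilities of at most three
points. -/
lemma Regular.prx_cov_le [AddCommGroup V] {S : Finset V} {W : CTMC V K} (hW : W.Regular)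
    (hK : K = stepMat S) (x : V) {t : ℝ} (ht : 0 ≤ t) {F : Finset V} (hF : (0 : V) ∉ F) :
    W.prx x {ω | t < W.cov ω} ≤ Fintype.card V * (survival K {0} t
      - (∑ w ∈ F, survival K {0, w} t) / 2
      + (∑ w ∈ F, ∑ w' ∈ F.erase w, survival K {0, w, w'} t) / 2) := by
  classical
  have hK0 : ∀ x y, 0 ≤ K x y := hK ▸ stepMat_nonneg S
  set I : Finset V → W.Ω → ℝ := fun A => (W.avoid A t).indicator fun _ => (1 : ℝ) with hI
  set tr : Finset V → V → Finset V := fun A y => A.map (addRightEmbedding y) with htr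
  have hint : ∀ A, Integrable (I A) (W.P x) := fun A => (hW.integral_avoid hK0 x A ht).1
  have hsum : ∀ A, ∑ y, ∫ ω, I (tr A y) ω ∂(W.P x) = Fintype.card V * survival K A t := by
    intro A
    have h := sum_avoidProb_translate (S := S) A t x
    rw [← hK] at h
    rw [← h]
    exact Finset.sum_congr rfl fun y _ => (hW.integral_avoid hK0 x _ ht).2
  set f : W.Ω → ℝ := fun ω => ∑ y, (I (tr {0} y) ω - (∑ w ∈ F, I (tr {0, w} y) ω) / 2
    + (∑ w ∈ F, ∑ w' ∈ F.erase w, I (tr {0, w, w'} y) ω) / 2) with hf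
  have hfint : Integrable f (W.P x) :=
    integrable_finsetSum _ fun y _ => ((hint _).sub ((integrable_finsetSum _ fun w _ =>
      hint _).div_const 2)).add ((integrable_finsetSum _ fun w _ =>
        integrable_finsetSum _ fun w' _ => hint _).div_const 2)
  have hfI : ∫ ω, f ω ∂(W.P x) = Fintype.card V * (survival K {0} t
      - (∑ w ∈ F, survival K {0, w} t) / 2
      + (∑ w ∈ F, ∑ w' ∈ F.erase w, survival K {0, w, w'} t) / 2) := by
    have : ∀ y, ∫ ω, (I (tr {0} y) ω - (∑ w ∈ F, I (tr {0, w} y) ω) / 2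
        + (∑ w ∈ F, ∑ w' ∈ F.erase w, I (tr {0, w, w'} y) ω) / 2) ∂(W.P x)
        = ∫ ω, I (tr {0} y) ω ∂(W.P x) - (∑ w ∈ F, ∫ ω, I (tr {0, w} y) ω ∂(W.P x)) / 2
        + (∑ w ∈ F, ∑ w' ∈ F.erase w, ∫ ω, I (tr {0, w, w'} y) ω ∂(W.P x)) / 2 := by
      intro y
      rw [integral_add, integral_sub, integral_div, integral_div, integral_finsetSum,
        integral_finsetSum]
      · congr 2
        exact Finset.sum_congr rfl fun w _ => integral_finsetSum _ fun w' _ => hint _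
      · exact fun w _ => integrable_finsetSum _ fun w' _ => hint _
      · exact fun w _ => hint _
      · exact hint _
      · exact (integrable_finsetSum _ fun w _ => hint _).div_const 2
      · exact (hint _).sub ((integrable_finsetSum _ fun w _ => hint _).div_const 2)
      · exact (integrable_finsetSum _ fun w _ => integrable_finsetSum _ fun w' _ =>
          hint _).div_const 2
    rw [hf, integral_finsetSum]
    · rw [Finset.sum_congr rfl fun y _ => this y, Finset.sum_add_distrib, Finset.sum_sub_distrib,
        ← Finset.sum_div, ← Finset.sum_div, Finset.sum_comm, hsum]
      have e1 : ∑ y, ∑ w ∈ F, ∫ ω, I (tr {0, w} y) ω ∂(W.P x)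
          = Fintype.card V * ∑ w ∈ F, survival K {0, w} t := by
        rw [Finset.sum_comm, Finset.mul_sum]
        exact Finset.sum_congr rfl fun w _ => hsum _
      have e2 : ∑ y, ∑ w ∈ F, ∑ w' ∈ F.erase w, ∫ ω, I (tr {0, w, w'} y) ω ∂(W.P x)
          = Fintype.card V * ∑ w ∈ F, ∑ w' ∈ F.erase w, survival K {0, w, w'} t := by
        rw [Finset.sum_comm, Finset.mul_sum]
        refine Finset.sum_congr rfl fun w _ => ?_
        rw [Finset.sum_comm, Finset.mul_sum]
        exact Finset.sum_congr rfl fun w' _ => hsum _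
      rw [Finset.sum_comm, e1, e2]
      ring
    · exact fun y _ => ((hint _).sub ((integrable_finsetSum _ fun w _ =>
      hint _).div_const 2)).add ((integrable_finsetSum _ fun w _ =>
        integrable_finsetSum _ fun w' _ => hint _).div_const 2)
  have hIval : ∀ A ω, I A ω = if A ⊆ Finset.univ.filter (· ∈ W.uncov t ω) then 1 else 0 := by
    intro A ω
    simp only [hI, Set.indicator_apply]
    refine if_congr ⟨fun h z hz => Finset.mem_filter.2 ⟨Finset.mem_univ _,
      fun s h0 h1 he => h s h0 h1 (he ▸ hz)⟩,
      fun h u h0 h1 hu => (Finset.mem_filter.1 (h hu)).2 u h0 h1 rfl⟩ rfl rfl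
  have hfge : ∀ ω, (⋃ y, W.avoid {y} t).indicator (fun _ => (1 : ℝ)) ω ≤ f ω := by
    intro ω
    refine le_trans (le_of_eq ?_) ((sum_bonferroni (Finset.univ.filter (· ∈ W.uncov t ω)) F hF
      (fun A => I A ω) fun A => hIval A ω).trans (le_of_eq ?_))
    · rw [Set.indicator_apply]
      refine if_congr ?_ rfl rfl
      rw [Set.mem_iUnion, Finset.filter_nonempty_iff]
      refine exists_congr fun y => ⟨fun h => ⟨Finset.mem_univ _, fun s h0 h1 he => h s h0 h1
        (Finset.mem_singleton.2 he)⟩, fun h u h0 h1 hu => h.2 u h0 h1 (Finset.mem_singleton.1 hu)⟩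
    · simp [hf, htr]
  have hE : NullMeasurableSet (⋃ y, W.avoid {y} t) (W.P x) :=
    .iUnion fun y => hW.nullMeas x {y} t ht
  rw [← hfI]
  refine le_trans ?_ (integral_mono ((integrable_const 1).indicator₀ hE) hfint hfge)
  rw [integral_indicator₀ hE, setIntegral_const, smul_eq_mul, mul_one, measureReal_def, prx]
  refine ENNReal.toReal_mono (measure_ne_top _ _) (measure_mono fun ω hω => ?_)
  by_contra h
  simp only [Set.mem_iUnion, not_exists] at h
  have hb : BddBelow {t : ℝ | 0 ≤ t ∧ ∀ y : V, ∃ s, 0 ≤ s ∧ s ≤ t ∧ W.X s ω = y} :=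
    ⟨0, fun s hs => hs.1⟩
  refine not_lt.2 (csInf_le hb ⟨ht, fun y => ?_⟩) hω
  have := h y
  simp only [avoid, Set.mem_ofPred_eq, not_forall, not_not, Finset.mem_singleton] at this
  obtain ⟨u, h0, h1, h2⟩ := this
  exact ⟨u, h0, h1, h2⟩

end CTMC

namespace CTMC

attribute [local instance] CTMC.mΩ CTMC.prob

variable {V : Type} [Fintype V] [DecidableEq V] {K : Matrix V V ℝ}

lemma hit_nonneg (W : CTMC V K) (A : Set V) (ω : W.Ω) : 0 ≤ W.hit A ω :=
  Real.sInf_nonneg fun _ h => h.1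

lemma lt_hit_iff (W : CTMC V K) (o : V) {ω : W.Ω} (hω : ∃ u, 0 ≤ u ∧ W.X u ω = o) {t : ℝ}
    (ht : 0 ≤ t) : t < W.hit {o} ω ↔ ω ∈ W.avoid {o} t := by
  have hb : BddBelow {t : ℝ | 0 ≤ t ∧ W.X t ω ∈ ({o} : Set V)} := ⟨0, fun s hs => hs.1⟩
  constructor
  · intro h u h0 h1 hu
    exact (h.trans_le (csInf_le hb ⟨h0, Finset.mem_singleton.1 hu⟩)).not_ge h1
  · intro h
    obtain ⟨ε, hε, h2⟩ := W.rightCts ω t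
    obtain ⟨u, hu0, hu⟩ := hω
    refine (lt_add_of_pos_right t hε).trans_le (le_csInf ⟨u, hu0, hu⟩ fun s hs => ?_)
    by_contra! hlt
    rcases le_total s t with hst | hst
    · exact h s hs.1 hst (Finset.mem_singleton.2 hs.2)
    · exact h t ht le_rfl (Finset.mem_singleton.2 ((h2 s hst hlt).symm.trans hs.2))

/-- The expected hitting time of a point from stationarity. -/
lemma Regular.epi_hit {W : CTMC V K} (hW : W.Regular) (hK0 : ∀ x y, 0 ≤ K x y)
    (hK : ∀ x y, K x y = K y x) {ρ : ℝ} (hρ0 : 0 < ρ) (hρ1 : ρ ≤ 1) {o : V}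
    (hρ : ∀ f : V → ℝ, f o = 0 →
      ρ * ∑ x, f x ^ 2 ≤ ∑ x, f x * (f x - ∑ y, K x y * f y)) {u : V → ℝ}
    (hu : u o = 0) (hu1 : ∀ x ≠ o, u x - ∑ y, K x y * u y = 1) :
    W.epi (W.hit {o}) = (Fintype.card V : ℝ)⁻¹ * ∑ x, u x := by
  have hn : 0 < (Fintype.card V : ℝ) := Nat.cast_pos.2 (Fintype.card_pos_iff.2 ⟨o⟩)
  have hρ' : ∀ f : V → ℝ, (∀ x ∈ ({o} : Finset V), f x = 0) →
      ρ * ∑ x, f x ^ 2 ≤ ∑ x, f x * (f x - ∑ y, K x y * f y) :=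
    fun f hf => hρ f (hf o (Finset.mem_singleton_self o))
  obtain ⟨hsi, hsv⟩ := survival_integral hK hρ0 hρ1 hρ' (u := u) (by simpa using hu)
    (by simpa using hu1)
  have hae : ∀ x, ∀ᵐ ω ∂(W.P x), ∃ v, 0 ≤ v ∧ W.X v ω = o := by
    intro x
    have hle : ∀ t : ℝ, 0 ≤ t → W.P x {ω | ¬ ∃ v, 0 ≤ v ∧ W.X v ω = o} ≤
        ENNReal.ofReal (Fintype.card V * Real.exp (-ρ * t)) := by
      intro t ht
      refine (measure_mono fun ω hω => ?_).trans ((hW.measure_avoid x {o} t ht).trans_le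
        (ENNReal.ofReal_le_ofReal ?_))
      · exact fun v h0 _ hv => hω ⟨v, h0, Finset.mem_singleton.1 hv⟩
      · refine (Finset.single_le_sum (fun y _ => avoidProb_nonneg hK0 {o} ht y)
          (Finset.mem_univ x)).trans ?_
        rw [sum_avoidProb]
        exact mul_le_mul_of_nonneg_left (survival_le hK hρ1 hρ' ht) hn.le
    have hlim : Tendsto (fun t : ℝ => ENNReal.ofReal (Fintype.card V * Real.exp (-ρ * t))) atTop
        (nhds 0) := by
      rw [← ENNReal.ofReal_zero]
      refine (ENNReal.continuous_ofReal.tendsto 0).comp ?_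
      rw [← mul_zero (Fintype.card V : ℝ)]
      refine Tendsto.const_mul _ (Real.tendsto_exp_atBot.comp ?_)
      exact tendsto_id.const_mul_atTop_of_neg (neg_lt_zero.2 hρ0)
    exact nonpos_iff_eq_zero.1 (ge_of_tendsto hlim (eventually_atTop.2 ⟨0, hle⟩))
  have hset : ∀ x t, 0 ≤ t → {ω | t < W.hit {o} ω} =ᵐ[W.P x] W.avoid {o} t := by
    intro x t ht
    filter_upwards [hae x] with ω hω
    exact propext (lt_hit_iff W o hω ht)
  have hmeas : ∀ x, AEMeasurable (W.hit {o}) (W.P x) := by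
    intro x
    refine NullMeasurable.aemeasurable ?_
    refine @measurable_of_Ioi ℝ (NullMeasurableSpace W.Ω (W.P x)) _ _ _ _ _ _ _
      (W.hit {o}) fun t => ?_
    change NullMeasurableSet {ω | t < W.hit {o} ω} (W.P x)
    rcases lt_or_ge t 0 with ht | ht
    · convert nullMeasurableSet_univ
      exact Set.eq_univ_of_forall fun ω => ht.trans_le (W.hit_nonneg _ ω)
    · exact (hW.nullMeas x {o} t ht).congr (hset x t ht).symm
  have hlin : ∀ x, ∫⁻ ω, ENNReal.ofReal (W.hit {o} ω) ∂(W.P x)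
      = ∫⁻ t in Set.Ioi 0, W.P x {ω | t < W.hit {o} ω} := fun x =>
    lintegral_eq_lintegral_meas_lt _ (ae_of_all _ fun ω => W.hit_nonneg _ ω) (hmeas x)
  have htot : ∑ x, ∫⁻ ω, ENNReal.ofReal (W.hit {o} ω) ∂(W.P x) = ENNReal.ofReal (∑ x, u x) := by
    simp only [hlin]
    rw [← lintegral_finsetSum]
    · have : ∫⁻ t in Set.Ioi (0 : ℝ), ∑ x, W.P x {ω | t < W.hit {o} ω}
          = ∫⁻ t in Set.Ioi (0 : ℝ), ENNReal.ofReal (Fintype.card V * survival K {o} t) := by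
        refine setLIntegral_congr_fun measurableSet_Ioi fun t ht => ?_
        have ht : 0 ≤ t := le_of_lt ht
        rw [← sum_avoidProb, ENNReal.ofReal_sum_of_nonneg fun x _ => avoidProb_nonneg hK0 _ ht x]
        exact Finset.sum_congr rfl fun x _ =>
          (measure_congr (hset x t ht)).trans (hW.measure_avoid x {o} t ht)
      rw [this, ← ofReal_integral_eq_lintegral_ofReal (hsi.const_mul _), integral_const_mul, hsv,
        mul_inv_cancel_left₀ hn.ne']
      exact ae_restrict_of_forall_mem measurableSet_Ioi fun t ht =>
        mul_nonneg hn.le (survival_nonneg hK0 _ (le_of_lt ht))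
    · intro x _
      exact Antitone.measurable fun s t hst => measure_mono fun ω hω => lt_of_le_of_lt hst hω
  have hu0 : 0 ≤ ∑ x, u x := by
    have h : 0 ≤ (Fintype.card V : ℝ)⁻¹ * ∑ x, u x := hsv ▸
      setIntegral_nonneg measurableSet_Ioi fun t ht => survival_nonneg hK0 _ (le_of_lt ht)
    exact nonneg_of_mul_nonneg_right h (inv_pos.2 hn)
  rw [epi]
  congr 1
  have hex : ∀ x, W.ex x (W.hit {o}) = (∫⁻ ω, ENNReal.ofReal (W.hit {o} ω) ∂(W.P x)).toReal :=
    fun x => integral_eq_lintegral_of_nonneg_ae (ae_of_all _ fun ω => W.hit_nonneg _ ω)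
      (hmeas x).aestronglyMeasurable
  simp only [hex]
  rw [← ENNReal.toReal_sum, htot, ENNReal.toReal_ofReal hu0]
  exact fun x hx => ENNReal.sum_ne_top.1 (htot.trans_ne ENNReal.ofReal_ne_top) x hx

lemma measure_X_eq (W : CTMC V K) (hK0 : ∀ x y, 0 ≤ K x y) (x y : V) {u : ℝ} (hu : 0 ≤ u) :
    (W.P x).real {ω | W.X u ω = y} = heatKer K u x y := by
  have h := W.fdd x 1 ![0, u] (by intro i j hij; fin_cases i <;> fin_cases j <;> simp_all)
    rfl ![x, y]
  have h0 := W.fdd x 0 ![0] (fun i j _ => by simp) rfl ![x]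
  simp only [Nat.reduceAdd, Fin.forall_fin_one, Matrix.cons_val_fin_one, if_true, one_mul,
    Finset.univ_eq_empty, Finset.prod_empty, ENNReal.ofReal_one] at h0
  simp at h
  have h1 : ∀ᵐ ω ∂(W.P x), W.X 0 ω = x := by
    rw [ae_iff]
    exact (prob_compl_eq_zero_iff (W.measX 0 x)).2 h0
  rw [measureReal_def, ← ENNReal.toReal_ofReal (heatKer_nonneg hK0 hu x y), ← h]
  congr 1
  refine measure_congr ?_
  filter_upwards [h1] with ω hω
  exact propext ⟨fun h => ⟨hω, h⟩, fun h => h.2⟩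

/-- Expected local time at the starting point over a time interval. -/
lemma Regular.ex_loc_sub {W : CTMC V K} (hW : W.Regular) (hK0 : ∀ x y, 0 ≤ K x y) (x : V) {s t : ℝ}
    (hs : 0 ≤ s) (hst : s ≤ t) :
    W.ex x (fun ω => W.loc x t ω - W.loc x s ω) = ∫ u in s..t, heatKer K u x x := by
  have hm : Measurable fun p : ℝ × W.Ω => if W.X p.1 p.2 = x then (1 : ℝ) else 0 :=
    Measurable.ite (hW.joint x) measurable_const measurable_const
  have hb : ∀ u ω, ‖if W.X u ω = x then (1 : ℝ) else 0‖ ≤ 1 := fun u ω => by split_ifs <;> simp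
  have hi : ∀ ω a b, IntervalIntegrable (fun u => if W.X u ω = x then (1 : ℝ) else 0) volume a b :=
    fun ω a b => (intervalIntegrable_const (c := (1 : ℝ))).mono_fun
      (hm.comp measurable_prodMk_right).aestronglyMeasurable
      (ae_of_all _ fun u => by simpa using hb u ω)
  have h1 : ∀ ω, W.loc x t ω - W.loc x s ω
      = ∫ u in s..t, if W.X u ω = x then (1 : ℝ) else 0 := fun ω =>
    intervalIntegral.integral_interval_sub_left (hi ω 0 t) (hi ω 0 s)
  rw [ex]
  simp only [h1, intervalIntegral.integral_of_le hst]
  rw [integral_integral_swap]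
  · refine setIntegral_congr_fun measurableSet_Ioc fun u hu => ?_
    have h2 : ∀ ω, (if W.X u ω = x then (1 : ℝ) else 0)
        = {ω | W.X u ω = x}.indicator (fun _ => (1 : ℝ)) ω := fun ω => by
      simp [Set.indicator_apply]
    simp only [h2]
    rw [integral_indicator (W.measX u x), setIntegral_const, smul_eq_mul, mul_one,
      measure_X_eq W hK0 x x (hs.trans hu.1.le)]
  · refine (integrable_const (1 : ℝ)).mono' ?_ (ae_of_all _ fun p => hb p.2 p.1)
    exact (hm.comp measurable_swap).aestronglyMeasurable

end CTMC

namespace DualPairing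

variable {V : Type} [AddCommGroup V] [Fintype V] [DecidableEq V] (Φ : DualPairing V) (S : Finset V)

/-- Normalized Green function. -/
def corr (x : V) : ℝ := Φ.green S x / Φ.green S 0

/-- Total mass `n G(0)` of the inverse eigenvalues, which is the expected hitting time of a
point from stationarity. -/
def hitMean : ℝ := Fintype.card V * Φ.green S 0

/-- Sum of the squared inverse eigenvalues. -/
def invSq : ℝ := ∑ ξ ∈ {0}ᶜ, (Φ.mu S ξ ^ 2)⁻¹

variable {S}

lemma card_pos' {V : Type} [AddCommGroup V] [Fintype V] :
    (0 : ℝ) < Fintype.card V := Nat.cast_pos.2 Fintype.card_pos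

lemma hitMean_eq : Φ.hitMean S = ∑ ξ ∈ {0}ᶜ, (Φ.mu S ξ)⁻¹ := by
  simp [hitMean, green, card_pos'.ne']

lemma corr_neg (x : V) : Φ.corr S (-x) = Φ.corr S x := by rw [corr, green_neg, corr]

lemma corr_zero (h : 0 < Φ.green S 0) : Φ.corr S 0 = 1 := div_self h.ne'

lemma sum_corr : ∑ x, Φ.corr S x = 0 := by
  simp only [corr, ← Finset.sum_div, sum_green, zero_div]

lemma abs_green_le (hμ : ∀ ξ ≠ 0, 0 < Φ.mu S ξ) (x : V) : |Φ.green S x| ≤ Φ.green S 0 := by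
  rw [green, green, abs_mul, abs_of_pos (inv_pos.2 card_pos')]
  refine mul_le_mul_of_nonneg_left ((Finset.abs_sum_le_sum_abs _ _).trans
    (Finset.sum_le_sum fun ξ hξ => ?_)) (inv_pos.2 card_pos').le
  have := hμ ξ (by simpa using hξ)
  rw [abs_div, abs_of_pos this, c_zero]
  exact div_le_div_of_nonneg_right (Φ.abs_c_le_one _ _) this.le

lemma abs_corr_le_one (h : 0 < Φ.green S 0) (hμ : ∀ ξ ≠ 0, 0 < Φ.mu S ξ) (x : V) :
    |Φ.corr S x| ≤ 1 := by
  rw [corr, abs_div, abs_of_pos h]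
  exact (div_le_one h).2 (Φ.abs_green_le hμ x)

/-- Distinct points are not fully correlated. -/
lemma green_le_sub_half (hS : S.Nonempty) (hμ : ∀ ξ ≠ 0, 0 < Φ.mu S ξ) {x : V} (hx : x ≠ 0) :
    Φ.green S x ≤ Φ.green S 0 - 1 / 2 := by
  have h := Φ.sum_c x
  rw [if_neg hx] at h
  have h1 : ∑ ξ ∈ {0}ᶜ, (1 - Φ.c ξ x) / 2 ≤
      ∑ ξ ∈ {0}ᶜ, (Φ.c ξ 0 / Φ.mu S ξ - Φ.c ξ x / Φ.mu S ξ) := by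
    refine Finset.sum_le_sum fun ξ hξ => ?_
    have := hμ ξ (by simpa using hξ)
    rw [c_zero, ← sub_div]
    exact div_le_div_of_nonneg_left (sub_nonneg.2 (Φ.c_le_one _ _)) this (Φ.mu_le_two hS ξ)
  have h2 : ∑ ξ ∈ {0}ᶜ, (1 - Φ.c ξ x) / 2 = (Fintype.card V : ℝ) / 2 := by
    have : ∑ ξ, (1 - Φ.c ξ x) / 2 = (Fintype.card V : ℝ) / 2 := by
      rw [← Finset.sum_div, Finset.sum_sub_distrib, h]; simp
    rw [← this, ← Finset.sum_add_sum_compl {0}]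
    simp
  rw [h2, Finset.sum_sub_distrib] at h1
  have h3 := mul_le_mul_of_nonneg_left h1 (inv_pos.2 (card_pos' (V := V))).le
  rw [mul_sub] at h3
  have h4 : (Fintype.card V : ℝ)⁻¹ * (Fintype.card V / 2) = 1 / 2 := by
    field_simp [(card_pos' (V := V)).ne']
  rw [h4] at h3
  simp only [green] at h3 ⊢
  linarith

lemma sum_green_sq : ∑ x, Φ.green S x ^ 2 = (Fintype.card V : ℝ)⁻¹ * Φ.invSq S := by
  have h := Φ.sum_even_sq (fun ξ => if ξ ∈ ({0} : Finset V)ᶜ then (Φ.mu S ξ)⁻¹ else 0)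
    (fun ξ => by simp [mu_neg])
  have hn := (card_pos' (V := V)).ne'
  simp only [ite_mul, zero_mul, ite_pow, ne_eq, OfNat.ofNat_ne_zero, not_false_eq_true, zero_pow,
    Finset.sum_ite_mem, Finset.univ_inter, inv_pow] at h
  simp only [green, mul_pow, ← Finset.mul_sum, div_eq_inv_mul]
  rw [h, invSq]
  field_simp

lemma invSq_nonneg : 0 ≤ Φ.invSq S := Finset.sum_nonneg fun ξ _ => by positivity

/-- Upper bound on survival probabilities by the energy of a probability vector. -/
lemma survival_le_energy (hS : S.Nonempty) (hneg : ∀ g ∈ S, -g ∈ S)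
    (hμ : ∀ ξ ≠ 0, 0 < Φ.mu S ξ) {A : Finset V} {ν : V → ℝ}
    (hν : ∀ x ∉ A, ν x = 0) (hν0 : ∀ x, 0 ≤ ν x) (hν1 : ∑ x, ν x = 1) {θ δ τ : ℝ}
    (hG : 0 < Φ.green S 0) (hθ : 0 < θ)
    (hE : ∑ x, ∑ y, ν x * ν y * Φ.corr S (x - y) ≤ θ)
    (hQ : 2 * Φ.invSq S / Φ.hitMean S ^ 2 ≤ δ * θ ^ 2) (hδ : δ ≤ 1 / 2)
    (hm : 1 ≤ θ * Φ.hitMean S) (hτ : 0 ≤ τ) :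
    survival (stepMat S) A (Φ.hitMean S * τ) ≤ Real.exp (-((1 - δ) / θ * τ)) ∧
    ∀ f : V → ℝ, (∀ x ∈ A, f x = 0) → (1 - δ) / (θ * Φ.hitMean S) * ∑ x, f x ^ 2 ≤
      ∑ x, f x * (f x - ∑ y, stepMat S x y * f y) := by
  set m := Φ.hitMean S with hmdef
  have hm0 : 0 < m := mul_pos card_pos' hG
  have hE0 : 0 < θ * m := mul_pos hθ hm0
  have hδ' : 2 * Φ.invSq S / (θ * m) ^ 2 ≤ δ := by
    rw [div_le_iff₀ (by positivity)] at hQ ⊢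
    linarith [mul_pow θ m 2]
  have hδ0 : 0 ≤ δ := le_trans (div_nonneg (mul_nonneg two_pos.le Φ.invSq_nonneg)
    (by positivity)) hδ'
  have hEμ : ∀ ξ ≠ 0, 2 / (θ * m) ≤ Φ.mu S ξ := by
    intro ξ hξ
    have h1 : (Φ.mu S ξ ^ 2)⁻¹ ≤ Φ.invSq S := Finset.single_le_sum
      (f := fun ξ => (Φ.mu S ξ ^ 2)⁻¹) (fun η _ => by positivity) (by simpa using hξ)
    have h2 : Φ.invSq S ≤ (θ * m) ^ 2 / 4 := by
      rw [div_le_iff₀ (by positivity)] at hδ'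
      nlinarith [sq_nonneg (θ * m)]
    have h3 := hμ ξ hξ
    rw [div_le_iff₀ hE0]
    refine le_of_sq_le_sq ?_ (by positivity)
    have h4 := h1.trans h2
    rw [inv_le_iff_one_le_mul₀ (by positivity)] at h4
    nlinarith
  have hray := Φ.rayleigh_energy hS hneg hν hν0 hν1 hE0 (by
    calc (Fintype.card V : ℝ) * ∑ x, ∑ y, ν x * ν y * Φ.green S (x - y)
        = m * ∑ x, ∑ y, ν x * ν y * Φ.corr S (x - y) := by
          simp only [hmdef, hitMean, corr, Finset.mul_sum]
          refine Finset.sum_congr rfl fun x _ => Finset.sum_congr rfl fun y _ => ?_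
          field_simp
      _ ≤ m * θ := mul_le_mul_of_nonneg_left hE hm0.le
      _ = θ * m := mul_comm _ _) le_rfl hδ' (by linarith) hEμ
  refine ⟨?_, hray⟩
  refine (survival_le (stepMat_symm hneg) ((div_le_one hE0).2 (by linarith)) hray
    (mul_nonneg hm0.le hτ)).trans_eq ?_
  congr 1
  field_simp

/-- Lower bound on the survival probability of a pair. -/
lemma le_survival_pair (hS : S.Nonempty) (hneg : ∀ g ∈ S, -g ∈ S)
    (hμ : ∀ ξ ≠ 0, 0 < Φ.mu S ξ) {w : V} (hw : w ≠ 0) {θ δ τ : ℝ}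
    (hG : 0 < Φ.green S 0) (hθ : 0 < θ) (hθr : θ = (1 + Φ.corr S w) / 2)
    (hQ : 2 * Φ.invSq S / Φ.hitMean S ^ 2 ≤ δ * θ ^ 2) (hδ : δ ≤ 1 / 2)
    (hm : 1 ≤ θ * Φ.hitMean S) (hτ : 0 ≤ τ) :
    (1 - δ) * Real.exp (-(τ / θ)) ≤ survival (stepMat S) {0, w} (Φ.hitMean S * τ) := by
  have hm0 : 0 < Φ.hitMean S := mul_pos card_pos' hG
  have hδ0 : 0 ≤ δ := by
    have : 0 ≤ δ * θ ^ 2 := le_trans (div_nonneg (mul_nonneg two_pos.le Φ.invSq_nonneg)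
      (by positivity)) hQ
    exact nonneg_of_mul_nonneg_left this (by positivity)
  have hE0 : 0 < θ * Φ.hitMean S := mul_pos hθ hm0
  set ν : V → ℝ := fun x => if x = 0 ∨ x = w then 1 / 2 else 0 with hν
  have hsum : ∀ f : V → ℝ, ∑ x, ν x * f x = (f 0 + f w) / 2 := by
    intro f
    simp only [hν, ite_mul, zero_mul, ← Finset.sum_filter]
    rw [show Finset.univ.filter (fun x => x = 0 ∨ x = w) = {0, w} by ext; simp,
      Finset.sum_pair hw.symm]
    ring
  have hray := (Φ.survival_le_energy hS hneg hμ (A := {0, w}) (ν := ν) (θ := θ) (δ := δ) (τ := τ)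
    (fun x hx => if_neg (by simpa using hx)) (fun x => by simp only [hν]; split_ifs <;> norm_num)
    (by simpa using hsum 1) hG hθ (by
      simp only [mul_assoc, ← Finset.mul_sum, hsum]
      simp only [sub_zero, zero_sub, sub_self, corr_neg, Φ.corr_zero hG]
      rw [hθr]; apply le_of_eq; ring) hQ hδ hm hτ).2
  have h := survival_ge (stepMat_symm hneg) (A := {0, w}) (ρ := (1 - δ) / (θ * Φ.hitMean S))
    (div_pos (by linarith) hE0) ((div_le_one hE0).2 (by linarith)) hray
    (u := fun x => (Fintype.card V : ℝ) / 2 *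
      (Φ.green S 0 + Φ.green S w - Φ.green S (x - 0) - Φ.green S (x - w)))
    (by simp [Φ.green_neg]) (by
      intro x hx
      simp only [Finset.mem_insert, Finset.mem_singleton, not_or] at hx
      have e1 := Φ.green_sub_avg hneg hμ x 0
      have e2 := Φ.green_sub_avg hneg hμ x w
      rw [if_neg hx.1] at e1
      rw [if_neg hx.2] at e2
      have e3 : ∑ y, stepMat S x y = 1 := sum_stepMat_eq_one hS x
      have e4 : ∑ y, stepMat S x y * ((Fintype.card V : ℝ) / 2 *
          (Φ.green S 0 + Φ.green S w - Φ.green S (y - 0) - Φ.green S (y - w)))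
          = (Fintype.card V : ℝ) / 2 * ((Φ.green S 0 + Φ.green S w) * ∑ y, stepMat S x y
            - ∑ y, stepMat S x y * Φ.green S (y - 0) - ∑ y, stepMat S x y * Φ.green S (y - w)) := by
        simp only [Finset.mul_sum, ← Finset.sum_sub_distrib]
        exact Finset.sum_congr rfl fun y _ => by ring
      rw [e4, e3, mul_one]
      have hn := (card_pos' (V := V)).ne'
      have e5 : Φ.green S (x - 0) - ∑ y, stepMat S x y * Φ.green S (y - 0)
          + (Φ.green S (x - w) - ∑ y, stepMat S x y * Φ.green S (y - w))
          = -2 * (Fintype.card V : ℝ)⁻¹ := by rw [e1, e2]; ring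
      have e6 : (Fintype.card V : ℝ) / 2 * (2 * (Fintype.card V : ℝ)⁻¹) = 1 := by field_simp
      linear_combination (-(Fintype.card V : ℝ) / 2) * e5 + e6)
    (m := θ * Φ.hitMean S) (by
      rw [← Finset.mul_sum]
      simp only [Finset.sum_sub_distrib]
      have e7 : ∀ z, ∑ x, Φ.green S (x - z) = 0 := fun z =>
        (Equiv.sum_comp (Equiv.subRight z) (Φ.green S)).trans Φ.sum_green
      rw [e7, e7, hθr, hitMean, corr]
      have hn := (card_pos' (V := V)).ne'
      simp
      field_simp) hE0 (mul_nonneg hm0.le hτ)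
  refine le_trans (le_of_eq ?_) h
  congr 1
  · field_simp
  · congr 1; field_simp

end DualPairing

/-- A quadratic lower bound for the exponential on a bounded interval. -/
lemma one_add_add_sq_le_exp {z Z : ℝ} (hZ : 2 ≤ Z) (hz : |z| ≤ Z) :
    1 + z + z ^ 2 / (2 * Z) ≤ Real.exp z := by
  have hz' := abs_le.1 hz
  have h4 : z ^ 2 / (2 * Z) ≤ z ^ 2 / 4 :=
    div_le_div_of_nonneg_left (sq_nonneg z) (by norm_num) (by linarith)
  rcases le_total (-2) z with h | h
  · have h1 := Real.add_one_le_exp (z / 2)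
    have h2 : Real.exp z = Real.exp (z / 2) ^ 2 := by
      rw [← Real.exp_nat_mul]; congr 1; push_cast; ring
    nlinarith
  · have h1 := Real.exp_pos z
    have h2 : z ^ 2 / (2 * Z) ≤ -z / 2 := by
      rw [div_le_div_iff₀ (by linarith) (by norm_num)]
      nlinarith
    linarith

namespace DualPairing

variable {V : Type} [AddCommGroup V] [Fintype V] [DecidableEq V] (Φ : DualPairing V) {S : Finset V}

/-- Survival at three points, in terms of the energy of a symmetric weighting. -/
lemma survival_triple_le (hS : S.Nonempty) (hneg : ∀ g ∈ S, -g ∈ S)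
    (hμ : ∀ ξ ≠ 0, 0 < Φ.mu S ξ) {w w' : V} (hw : w ≠ 0) (hw' : w' ≠ 0) (hww : w ≠ w')
    {p θ δ τ : ℝ} (hp0 : 0 ≤ p) (hp1 : p ≤ 1) (hG : 0 < Φ.green S 0) (hθ : 0 < θ)
    (hE : (1 - p) ^ 2 + p ^ 2 * (1 + Φ.corr S (w - w')) / 2
      + p * (1 - p) * (Φ.corr S w + Φ.corr S w') ≤ θ)
    (hQ : 2 * Φ.invSq S / Φ.hitMean S ^ 2 ≤ δ * θ ^ 2) (hδ : δ ≤ 1 / 2)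
    (hm : 1 ≤ θ * Φ.hitMean S) (hτ : 0 ≤ τ) :
    survival (stepMat S) {0, w, w'} (Φ.hitMean S * τ) ≤ Real.exp (-((1 - δ) / θ * τ)) := by
  set ν : V → ℝ := fun x => if x = 0 then 1 - p else if x ∈ ({w, w'} : Finset V) then p / 2 else 0
    with hν
  have hsum : ∀ f : V → ℝ, ∑ x, ν x * f x = (1 - p) * f 0 + p / 2 * (f w + f w') := by
    intro f
    rw [← Finset.sum_subset (Finset.subset_univ {0, w, w'})]
    · rw [Finset.sum_insert (by simp [hw.symm, hw'.symm]), Finset.sum_pair hww]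
      simp [hν, hw, hw']
      ring
    · intro x _ hx
      simp only [Finset.mem_insert, Finset.mem_singleton, not_or] at hx
      simp [hν, hx]
  refine (Φ.survival_le_energy hS hneg hμ (A := {0, w, w'}) (ν := ν) ?_ ?_ ?_ hG hθ ?_ hQ hδ
    hm hτ).1
  · intro x hx
    simp only [Finset.mem_insert, Finset.mem_singleton, not_or] at hx
    simp [hν, hx]
  · intro x
    simp only [hν]
    split_ifs <;> linarith
  · have := hsum 1
    simp only [Pi.one_apply, mul_one] at this
    rw [this]; ring
  · refine le_trans (le_of_eq ?_) hE
    simp only [mul_assoc, ← Finset.mul_sum, hsum]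
    have h1 : Φ.corr S (w' - w) = Φ.corr S (w - w') := by rw [← neg_sub, corr_neg]
    simp only [sub_zero, zero_sub, sub_self, corr_neg, Φ.corr_zero hG, h1]
    ring

/-- Explicit second order bound on the tail of the cover time. The parameters are the largest
correlation `2 * q - 1`, the typical correlation `ε`, the number `N` of atypical points, and the
second moment `v` of the correlations. -/
theorem prx_cov_le (hS : S.Nonempty) (hneg : ∀ g ∈ S, -g ∈ S) (hμ : ∀ ξ ≠ 0, 0 < Φ.mu S ξ)
    {W : CTMC V (stepMat S)} (hW : W.Regular) (x : V)
    {q δ ε N v Z Λ s : ℝ} (hG : 0 < Φ.green S 0) (hq : 1 / 2 ≤ q)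
    (hcorr : ∀ y ≠ 0, Φ.corr S y ≤ 2 * q - 1)
    (hm : 3 ≤ Φ.hitMean S) (hQ : 18 * Φ.invSq S ≤ δ * Φ.hitMean S ^ 2) (hδ : δ ≤ 1 / 2)
    (hε0 : 0 ≤ ε) (hε : ε ≤ 1 / 4)
    (hN : ((Finset.univ.filter fun w => w = 0 ∨ ε < |Φ.corr S w|).card : ℝ) ≤ N)
    (hv : v * Fintype.card V ≤ 4 * Λ ^ 2 * ∑ y, Φ.corr S y ^ 2)
    (hZ : 2 ≤ Z) (hΛε : 2 * Λ * ε ≤ Z) (hΛ : 0 ≤ Λ) (hs : 0 ≤ s) :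
    W.prx x {ω | Φ.hitMean S * (Λ + s) < W.cov ω} ≤
      Fintype.card V * (Real.exp (-((1 - δ) * (Λ + s)))
        - ((1 - δ) * (Real.exp (-(2 * (Λ + s)) - (2 * s * ε + 4 * (Λ + s) * ε ^ 2)) *
          (Fintype.card V * (1 + v / (2 * Z)) - N * (1 + 2 * Λ + 4 * Λ ^ 2 / (2 * Z))))) / 2
        + ((Fintype.card V : ℝ) ^ 2 * Real.exp (-((1 - δ) / ((1 + 2 * ε) / 3) * (Λ + s)))
          + Fintype.card V * N * Real.exp (-((1 - δ) / (q / (1 + q) + ε) * (Λ + s)))) / 2) := by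
  have hn := card_pos' (V := V)
  have hm0 : 0 < Φ.hitMean S := by linarith
  have hτ : 0 ≤ Λ + s := by linarith
  set F := Finset.univ.filter fun w => w ≠ 0 ∧ |Φ.corr S w| ≤ ε with hF
  have hFc : Fᶜ = Finset.univ.filter fun w => w = 0 ∨ ε < |Φ.corr S w| := by
    ext w; simp [hF, imp_iff_not_or]
  have hFcard : (Fᶜ.card : ℝ) ≤ N := by rwa [hFc]
  have hQθ : ∀ θ : ℝ, 1 / 3 ≤ θ → 2 * Φ.invSq S / Φ.hitMean S ^ 2 ≤ δ * θ ^ 2 := by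
    intro θ hθ
    have h0 := Φ.invSq_nonneg (S := S)
    have hδ0 : 0 ≤ δ := by
      by_contra h
      push Not at h
      nlinarith [mul_neg_of_neg_of_pos h (pow_pos hm0 2)]
    rw [div_le_iff₀ (by positivity)]
    have : (1 / 9 : ℝ) ≤ θ ^ 2 := by nlinarith
    have h1 := mul_le_mul_of_nonneg_left this (mul_nonneg hδ0 (sq_nonneg (Φ.hitMean S)))
    nlinarith
  have hmθ : ∀ θ : ℝ, 1 / 3 ≤ θ → 1 ≤ θ * Φ.hitMean S := fun θ hθ => by nlinarith
  have hr1 := Φ.abs_corr_le_one hG hμ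
  refine (hW.prx_cov_le rfl x (mul_nonneg hm0.le hτ) (F := F) (by simp [hF])).trans ?_
  refine mul_le_mul_of_nonneg_left ?_ hn.le
  refine add_le_add (sub_le_sub ?_ ?_) ?_
  · have := (Φ.survival_le_energy hS hneg hμ (A := {0}) (ν := fun x => if x = 0 then 1 else 0)
      (θ := 1) (δ := δ) (τ := Λ + s) (by simp) (fun x => by positivity) (by simp) hG one_pos
      (by simp [Φ.corr_zero hG]) (hQθ 1 (by norm_num)) hδ (hmθ 1 (by norm_num)) hτ).1
    simpa using this
  · refine div_le_div_of_nonneg_right ?_ two_pos.le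
    have hpt : ∀ w ∈ F, (1 - δ) * (Real.exp (-(2 * (Λ + s)) - (2 * s * ε + 4 * (Λ + s) * ε ^ 2)) *
        (1 + 2 * Λ * Φ.corr S w + 4 * Λ ^ 2 / (2 * Z) * Φ.corr S w ^ 2))
        ≤ survival (stepMat S) {0, w} (Φ.hitMean S * (Λ + s)) := by
      intro w hw
      simp only [hF, Finset.mem_filter, Finset.mem_univ, true_and] at hw
      obtain ⟨hw0, hw1⟩ := hw
      have hw2 := abs_le.1 hw1
      set r := Φ.corr S w with hr
      refine le_trans ?_ (Φ.le_survival_pair hS hneg hμ hw0 hG (θ := (1 + r) / 2) (by linarith)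
        rfl (hQθ _ (by linarith)) hδ (hmθ _ (by linarith)) hτ)
      refine mul_le_mul_of_nonneg_left ?_ (by linarith)
      have h1 := one_add_add_sq_le_exp (z := 2 * Λ * r) hZ (by
        rw [abs_mul, abs_of_nonneg (by linarith)]
        exact (mul_le_mul_of_nonneg_left hw1 (by linarith)).trans hΛε)
      have h2 : (1 + 2 * Λ * r + 4 * Λ ^ 2 / (2 * Z) * r ^ 2) ≤ Real.exp (2 * Λ * r) := by
        refine le_trans (le_of_eq ?_) h1
        ring
      refine (mul_le_mul_of_nonneg_left h2 (Real.exp_pos _).le).trans ?_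
      rw [← Real.exp_add]
      apply Real.exp_le_exp.2
      have hsq : r ^ 2 ≤ ε ^ 2 := sq_le_sq.2 (by rwa [abs_of_nonneg hε0])
      have h3 : (Λ + s) / ((1 + r) / 2) ≤ 2 * (Λ + s) * (1 - r + 2 * r ^ 2) := by
        rw [div_le_iff₀ (by linarith)]
        have h4 : 1 ≤ (1 - r + 2 * r ^ 2) * (1 + r) := by nlinarith [sq_nonneg r]
        nlinarith
      have h5 : (Λ + s) * r ^ 2 ≤ (Λ + s) * ε ^ 2 := mul_le_mul_of_nonneg_left hsq hτ
      have h6 : s * -ε ≤ s * r := mul_le_mul_of_nonneg_left hw2.1 hs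
      nlinarith
    refine le_trans ?_ (Finset.sum_le_sum hpt)
    simp only [← Finset.mul_sum]
    refine mul_le_mul_of_nonneg_left (mul_le_mul_of_nonneg_left ?_ (Real.exp_pos _).le)
      (by linarith)
    have h1 : ∑ w, (1 + 2 * Λ * Φ.corr S w + 4 * Λ ^ 2 / (2 * Z) * Φ.corr S w ^ 2)
        = Fintype.card V + 4 * Λ ^ 2 / (2 * Z) * ∑ w, Φ.corr S w ^ 2 := by
      simp only [Finset.sum_add_distrib, ← Finset.mul_sum, sum_corr]
      simp
    have h2 : ∑ w ∈ Fᶜ, (1 + 2 * Λ * Φ.corr S w + 4 * Λ ^ 2 / (2 * Z) * Φ.corr S w ^ 2)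
        ≤ N * (1 + 2 * Λ + 4 * Λ ^ 2 / (2 * Z)) := by
      have h0 : 0 ≤ 1 + 2 * Λ + 4 * Λ ^ 2 / (2 * Z) := by positivity
      calc _ ≤ ∑ w ∈ Fᶜ, (1 + 2 * Λ + 4 * Λ ^ 2 / (2 * Z)) := by
            refine Finset.sum_le_sum fun w _ => ?_
            have h3 := abs_le.1 (hr1 w)
            have h4 : Φ.corr S w ^ 2 ≤ 1 := (sq_le_one_iff_abs_le_one _).2 (hr1 w)
            have h5 : 0 ≤ 4 * Λ ^ 2 / (2 * Z) := by positivity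
            nlinarith
        _ = Fᶜ.card * (1 + 2 * Λ + 4 * Λ ^ 2 / (2 * Z)) := by
            rw [Finset.sum_const, nsmul_eq_mul]
        _ ≤ _ := mul_le_mul_of_nonneg_right hFcard h0
    have h3 := Finset.sum_add_sum_compl F
      (fun w => 1 + 2 * Λ * Φ.corr S w + 4 * Λ ^ 2 / (2 * Z) * Φ.corr S w ^ 2)
    have h4 : v / (2 * Z) * Fintype.card V ≤ 4 * Λ ^ 2 / (2 * Z) * ∑ y, Φ.corr S y ^ 2 := by
      rw [div_mul_eq_mul_div, div_mul_eq_mul_div]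
      exact div_le_div_of_nonneg_right hv (by linarith)
    linarith
  · refine div_le_div_of_nonneg_right ?_ two_pos.le
    set e1 := Real.exp (-((1 - δ) / ((1 + 2 * ε) / 3) * (Λ + s)))
    set e2 := Real.exp (-((1 - δ) / (q / (1 + q) + ε) * (Λ + s)))
    have hpt : ∀ w ∈ F, ∀ w' ∈ F.erase w,
        survival (stepMat S) {0, w, w'} (Φ.hitMean S * (Λ + s))
          ≤ e1 + if w - w' ∈ Fᶜ then e2 else 0 := by
      intro w hw w' hw'
      simp only [hF, Finset.mem_filter, Finset.mem_univ, true_and, Finset.mem_erase] at hw hw'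
      obtain ⟨hw0, hw1⟩ := hw
      obtain ⟨hww, hw0', hw1'⟩ := hw'
      have hw2 := abs_le.1 hw1
      have hw2' := abs_le.1 hw1'
      have hd : w - w' ≠ 0 := sub_ne_zero.2 (Ne.symm hww)
      by_cases hnear : w - w' ∈ Fᶜ
      · rw [if_pos hnear]
        have hq2 : 1 / 3 ≤ q / (1 + q) := by
          rw [div_le_div_iff₀ (by norm_num) (by linarith)]; linarith
        have hcw := hcorr _ hd
        refine le_trans (Φ.survival_triple_le hS hneg hμ hw0 hw0' (Ne.symm hww) (p := 1 / (1 + q))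
          (by positivity) ((div_le_one (by linarith)).2 (by linarith)) hG
          (θ := q / (1 + q) + ε) (δ := δ) (by linarith) ?_
          (hQθ _ (by linarith)) hδ (hmθ _ (by linarith)) hτ)
          (le_add_of_nonneg_left (Real.exp_pos _).le)
        set p := 1 / (1 + q) with hp
        have hp0 : 0 ≤ p := by positivity
        have hp1 : p ≤ 1 := (div_le_one (by linarith)).2 (by linarith)
        have hpq : q / (1 + q) = (1 - p) ^ 2 + p ^ 2 * q := by
          rw [hp]; field_simp; ring
        rw [hpq]
        have h1 : p ^ 2 * (1 + Φ.corr S (w - w')) / 2 ≤ p ^ 2 * q := by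
          rw [mul_div_assoc]
          exact mul_le_mul_of_nonneg_left (by linarith) (by positivity)
        have h2 : p * (1 - p) * (Φ.corr S w + Φ.corr S w') ≤ p * (1 - p) * (2 * ε) :=
          mul_le_mul_of_nonneg_left (by linarith) (mul_nonneg hp0 (by linarith))
        have h3 : p * (1 - p) ≤ 1 / 4 := by
          have h5 : 1 / 4 - p * (1 - p) = (p - 1 / 2) ^ 2 := by ring
          exact sub_nonneg.1 (h5 ▸ sq_nonneg _)
        have h4 : p * (1 - p) * (2 * ε) ≤ 1 / 4 * (2 * ε) :=
          mul_le_mul_of_nonneg_right h3 (by linarith only [hε0])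
        linarith only [h1, h2, h4, hε0]
      · rw [if_neg hnear, add_zero]
        have h1 : |Φ.corr S (w - w')| ≤ ε := by
          simp only [hF, Finset.mem_compl, not_not, Finset.mem_filter] at hnear
          exact hnear.2.2
        have h1' := abs_le.1 h1
        exact Φ.survival_triple_le hS hneg hμ hw0 hw0' (Ne.symm hww) (p := 2 / 3)
          (by norm_num) (by norm_num) hG (by linarith) (by linarith)
          (hQθ _ (by linarith)) hδ (hmθ _ (by linarith)) hτ
    have he1 : 0 < e1 := Real.exp_pos _
    have he2 : 0 < e2 := Real.exp_pos _
    have hin : ∀ w ∈ F, ∑ w' ∈ F.erase w, survival (stepMat S) {0, w, w'} (Φ.hitMean S * (Λ + s))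
        ≤ Fintype.card V * e1 + N * e2 := by
      intro w hw
      calc _ ≤ ∑ w' ∈ F.erase w, (e1 + if w - w' ∈ Fᶜ then e2 else 0) :=
            Finset.sum_le_sum (hpt w hw)
        _ ≤ ∑ w', (e1 + if w - w' ∈ Fᶜ then e2 else 0) :=
            Finset.sum_le_sum_of_subset_of_nonneg (Finset.subset_univ _)
              fun _ _ _ => by positivity
        _ = Fintype.card V * e1 + ∑ w', if w' ∈ Fᶜ then e2 else 0 := by
            rw [Finset.sum_add_distrib]
            congr 1
            · simp
            · exact Equiv.sum_comp (Equiv.subLeft w) fun z => if z ∈ Fᶜ then e2 else 0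
        _ = Fintype.card V * e1 + Fᶜ.card * e2 := by
            rw [Finset.sum_ite_mem, Finset.univ_inter]; simp
        _ ≤ _ := by gcongr
    have hN0 : 0 ≤ N := (Nat.cast_nonneg _).trans hFcard
    calc _ ≤ ∑ w ∈ F, ((Fintype.card V : ℝ) * e1 + N * e2) := Finset.sum_le_sum hin
      _ = F.card * ((Fintype.card V : ℝ) * e1 + N * e2) := by rw [Finset.sum_const, nsmul_eq_mul]
      _ ≤ Fintype.card V * ((Fintype.card V : ℝ) * e1 + N * e2) := by
          refine mul_le_mul_of_nonneg_right ?_ (by positivity)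
          exact_mod_cast Finset.card_le_univ F
      _ = _ := by ring

end DualPairing

lemma Real.exp_neg_le_two_div_sq {y : ℝ} (hy : 0 < y) : Real.exp (-y) ≤ 2 / y ^ 2 := by
  rw [Real.exp_neg, inv_eq_one_div, div_le_div_iff₀ (Real.exp_pos y) (by positivity)]
  have := Real.quadratic_le_exp_of_nonneg hy.le
  linarith

namespace DualPairing

variable {V : Type} [AddCommGroup V] [Fintype V] [DecidableEq V] (Φ : DualPairing V) {S : Finset V}

/-- The expected hitting time of a point from stationarity. -/
lemma epi_hit (hS : S.Nonempty) (hneg : ∀ g ∈ S, -g ∈ S) (hμ : ∀ ξ ≠ 0, 0 < Φ.mu S ξ)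
    {W : CTMC V (stepMat S)} (hW : W.Regular) (o : V) (hG : 0 < Φ.green S 0)
    (hm : 1 ≤ Φ.hitMean S) (hQ : 4 * Φ.invSq S ≤ Φ.hitMean S ^ 2) :
    W.epi (W.hit {o}) = Φ.hitMean S := by
  have hn := (card_pos' (V := V)).ne'
  have hm0 : 0 < Φ.hitMean S := by linarith
  have hray := (Φ.survival_le_energy hS hneg hμ (A := {o}) (ν := fun x => if x = o then 1 else 0)
      (θ := 1) (δ := 1 / 2) (τ := 0) (by simp) (fun x => by positivity) (by simp) hG one_pos
      (by simp [Φ.corr_zero hG])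
      (by rw [div_le_iff₀ (by positivity)]; linarith) le_rfl (by linarith) le_rfl).2
  rw [hW.epi_hit (fun x y => by simp only [stepMat, Matrix.of_apply]; positivity)
    (stepMat_symm hneg) (ρ := (1 - 1 / 2) / (1 * Φ.hitMean S))
    (by rw [one_mul]; exact div_pos (by norm_num) hm0)
    (by rw [one_mul, div_le_one hm0]; linarith)
    (fun f hf => hray f (by simpa using hf))
    (u := fun x => Fintype.card V * (Φ.green S 0 - Φ.green S (x - o))) (by simp)]
  · rw [← Finset.mul_sum, Finset.sum_sub_distrib,
      show ∑ x, Φ.green S (x - o) = 0 from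
        (Equiv.sum_comp (Equiv.subRight o) (Φ.green S)).trans Φ.sum_green]
    simp [hitMean, hn]
  · intro x hx
    have e1 := Φ.green_sub_avg hneg hμ x o
    rw [if_neg hx] at e1
    have e3 : ∑ y, stepMat S x y = 1 := sum_stepMat_eq_one hS x
    have e4 : ∑ y, stepMat S x y * (Fintype.card V * (Φ.green S 0 - Φ.green S (y - o)))
        = Fintype.card V * (Φ.green S 0 * ∑ y, stepMat S x y
          - ∑ y, stepMat S x y * Φ.green S (y - o)) := by
      simp only [Finset.mul_sum, ← Finset.sum_sub_distrib]
      exact Finset.sum_congr rfl fun y _ => by ring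
    have e6 : (Fintype.card V : ℝ) * (Fintype.card V : ℝ)⁻¹ = 1 := mul_inv_cancel₀ hn
    rw [e4, e3, mul_one]
    linear_combination (-(Fintype.card V : ℝ)) * e1 + e6

lemma heatKer_sub_inv_card (hS : S.Nonempty) (hneg : ∀ g ∈ S, -g ∈ S) (t : ℝ) (x y : V) :
    heatKer (stepMat S) t x y - (Fintype.card V : ℝ)⁻¹
      = (Fintype.card V : ℝ)⁻¹ * ∑ ξ ∈ {0}ᶜ, Φ.c ξ (y - x) * Real.exp (-(Φ.mu S ξ) * t) := by
  rw [Φ.heatKer_stepMat hneg, ← Finset.sum_add_sum_compl {0}, Finset.sum_singleton, Φ.mu_zero hS]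
  simp
  ring

/-- Upper bound on the total variation distance to stationarity. -/
lemma sum_abs_heatKer_sub_le (hS : S.Nonempty) (hneg : ∀ g ∈ S, -g ∈ S)
    (hμ : ∀ ξ ≠ 0, 0 < Φ.mu S ξ) {t : ℝ} (ht : 0 < t) (hQ : 2 * Φ.invSq S ≤ t ^ 2) (x : V) :
    ∑ y, |heatKer (stepMat S) t x y - (Fintype.card V : ℝ)⁻¹| ≤ 1 / 2 := by
  have hn := card_pos' (V := V)
  have h1 := sq_sum_le_card_mul_sum_sq (s := Finset.univ)
    (f := fun y => |heatKer (stepMat S) t x y - (Fintype.card V : ℝ)⁻¹|)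
  have h2 : ∑ y, |heatKer (stepMat S) t x y - (Fintype.card V : ℝ)⁻¹| ^ 2
      = (Fintype.card V : ℝ)⁻¹ * ∑ ξ ∈ {0}ᶜ, Real.exp (-(Φ.mu S ξ) * t) ^ 2 := by
    have h := Φ.sum_even_sq
      (fun ξ => if ξ ∈ ({0} : Finset V)ᶜ then Real.exp (-(Φ.mu S ξ) * t) else 0)
      (fun ξ => by simp [mu_neg])
    simp only [ite_mul, zero_mul, ite_pow, ne_eq, OfNat.ofNat_ne_zero, not_false_eq_true, zero_pow,
      Finset.sum_ite_mem, Finset.univ_inter] at h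
    simp only [sq_abs, Φ.heatKer_sub_inv_card hS hneg, mul_pow, ← Finset.mul_sum]
    have h4 : ∑ y, (∑ ξ ∈ {0}ᶜ, Φ.c ξ (y - x) * Real.exp (-(Φ.mu S ξ) * t)) ^ 2
        = ∑ z, (∑ ξ ∈ {0}ᶜ, Φ.c ξ z * Real.exp (-(Φ.mu S ξ) * t)) ^ 2 :=
      Equiv.sum_comp (Equiv.subRight x)
        (fun z => (∑ ξ ∈ {0}ᶜ, Φ.c ξ z * Real.exp (-(Φ.mu S ξ) * t)) ^ 2)
    rw [h4]
    simp only [mul_comm (Φ.c _ _)]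
    rw [h, pow_two, mul_assoc, inv_mul_cancel_left₀ hn.ne']
  have h3 : ∑ ξ ∈ {0}ᶜ, Real.exp (-(Φ.mu S ξ) * t) ^ 2 ≤ 1 / 4 := by
    calc _ ≤ ∑ ξ ∈ {0}ᶜ, 1 / (2 * t ^ 2) * (Φ.mu S ξ ^ 2)⁻¹ := by
          refine Finset.sum_le_sum fun ξ hξ => ?_
          have hp := hμ ξ (by simpa using hξ)
          have := Real.exp_neg_le_two_div_sq (y := 2 * (Φ.mu S ξ * t)) (by positivity)
          rw [← Real.exp_nat_mul]
          refine (le_of_eq ?_).trans (this.trans_eq ?_)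
          · congr 1; push_cast; ring
          · field_simp
      _ = 1 / (2 * t ^ 2) * Φ.invSq S := by rw [← Finset.mul_sum, invSq]
      _ ≤ 1 / 4 := by
          rw [div_mul_eq_mul_div, div_le_div_iff₀ (by positivity) (by norm_num)]
          linarith
  rw [h2, Finset.card_univ, mul_inv_cancel_left₀ hn.ne'] at h1
  refine le_of_sq_le_sq ?_ (by norm_num)
  linarith

lemma exp_le_of_sum_abs_heatKer_sub_le (hS : S.Nonempty) (hneg : ∀ g ∈ S, -g ∈ S) {t : ℝ} {ξ : V}
    (hξ : ξ ≠ 0)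
    (h : ∀ x, ∑ y, |heatKer (stepMat S) t x y - (Fintype.card V : ℝ)⁻¹| ≤ 1 / 2) :
    Real.exp (-(Φ.mu S ξ) * t) ≤ 1 / 2 := by
  have hn := card_pos' (V := V)
  have h0 : ∀ η, ∑ y, Φ.c η y * Φ.c ξ y
      = (if η = ξ then (Fintype.card V : ℝ) / 2 else 0)
        + (if η = -ξ then (Fintype.card V : ℝ) / 2 else 0) := by
    intro η
    have e1 := Φ.sum_c (η - ξ)
    have e2 := Φ.sum_c (η + ξ)
    have e3 : ∀ y, Φ.c η y * Φ.c ξ y = (Φ.c y (η - ξ) + Φ.c y (η + ξ)) / 2 := fun y => by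
      rw [c_sub, c_add, Φ.c_symm η, Φ.c_symm ξ]; ring
    simp only [e3]
    rw [← Finset.sum_div, Finset.sum_add_distrib, e1, e2]
    simp only [sub_eq_zero, add_eq_zero_iff_eq_neg]
    split_ifs <;> ring
  have h1 : ∑ y, (heatKer (stepMat S) t 0 y - (Fintype.card V : ℝ)⁻¹) * Φ.c ξ y
      = Real.exp (-(Φ.mu S ξ) * t) := by
    simp only [Φ.heatKer_sub_inv_card hS hneg, sub_zero, mul_assoc, Finset.sum_mul]
    rw [← Finset.mul_sum, Finset.sum_comm]
    have : ∀ η, ∑ y, Φ.c η y * (Real.exp (-(Φ.mu S η) * t) * Φ.c ξ y)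
        = (if η = ξ then (Fintype.card V : ℝ) / 2 * Real.exp (-(Φ.mu S ξ) * t) else 0)
        + (if η = -ξ then (Fintype.card V : ℝ) / 2 * Real.exp (-(Φ.mu S ξ) * t) else 0) := by
      intro η
      rw [Finset.sum_congr rfl fun y _ =>
        (by ring : Φ.c η y * (Real.exp (-(Φ.mu S η) * t) * Φ.c ξ y) =
          Real.exp (-(Φ.mu S η) * t) * (Φ.c η y * Φ.c ξ y)), ← Finset.mul_sum, h0]
      rw [mul_add, mul_ite, mul_ite, mul_zero]
      congr 1
      · split_ifs with h
        · rw [h]; ring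
        · rfl
      · split_ifs with h
        · rw [h, mu_neg]; ring
        · rfl
    simp only [this]
    rw [Finset.sum_add_distrib, Finset.sum_ite_eq', Finset.sum_ite_eq', if_pos (by simpa using hξ),
      if_pos (by simpa using hξ)]
    field_simp
    norm_num
  rw [← h1]
  refine le_trans ?_ (h 0)
  refine Finset.sum_le_sum fun y _ => (le_abs_self _).trans ?_
  rw [abs_mul]
  exact mul_le_of_le_one_right (abs_nonneg _) (Φ.abs_c_le_one _ _)

/-- Bounds on the mixing time: the relaxation time from below and the `ℓ²` norm of the inverse
eigenvalues from above. -/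
lemma tmixTV_bounds (hS : S.Nonempty) (hneg : ∀ g ∈ S, -g ∈ S) (hμ : ∀ ξ ≠ 0, 0 < Φ.mu S ξ)
    {t : ℝ} (ht : 0 < t) (hQ : 2 * Φ.invSq S ≤ t ^ 2) {ξ : V} (hξ : ξ ≠ 0) :
    1 / (2 * Φ.mu S ξ) ≤ tmixTV (stepMat S) ∧ tmixTV (stepMat S) ≤ t := by
  have hmem : t ∈ {t : ℝ | 0 ≤ t ∧ ∀ x : V,
      ∑ y : V, |heatKer (stepMat S) t x y - (Fintype.card V : ℝ)⁻¹| ≤ 1 / 2} :=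
    ⟨ht.le, Φ.sum_abs_heatKer_sub_le hS hneg hμ ht hQ⟩
  refine ⟨le_csInf ⟨t, hmem⟩ ?_, csInf_le ⟨0, fun t ht => ht.1⟩ hmem⟩
  rintro u ⟨-, hu⟩
  have h1 := Φ.exp_le_of_sum_abs_heatKer_sub_le hS hneg hξ hu
  have h2 := Real.add_one_le_exp (-(Φ.mu S ξ) * u)
  rw [div_le_iff₀ (by have := hμ ξ hξ; positivity)]
  linarith

/-- Expected time spent at the starting point between a fixed time and the mixing time. -/
lemma ex_loc_sub_bounds (hS : S.Nonempty) (hneg : ∀ g ∈ S, -g ∈ S) (hμ : ∀ ξ ≠ 0, 0 < Φ.mu S ξ)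
    {W : CTMC V (stepMat S)} (hW : W.Regular) (x : V) {s t : ℝ} (hs : 0 ≤ s) (hst : s ≤ t) :
    0 ≤ W.ex x (fun ω => W.loc x t ω - W.loc x s ω) ∧
    W.ex x (fun ω => W.loc x t ω - W.loc x s ω) ≤ (Fintype.card V : ℝ)⁻¹ * (t
      + ∑ ξ ∈ {0}ᶜ, Real.exp (-(Φ.mu S ξ) * s) / Φ.mu S ξ) := by
  have hn := card_pos' (V := V)
  rw [hW.ex_loc_sub (fun x y => by simp only [stepMat, Matrix.of_apply]; positivity) x hs hst]
  simp only [Φ.heatKer_stepMat hneg, sub_self, c_zero, one_mul]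
  refine ⟨intervalIntegral.integral_nonneg hst fun u _ => by positivity, ?_⟩
  rw [intervalIntegral.integral_const_mul]
  refine mul_le_mul_of_nonneg_left ?_ (by positivity)
  rw [intervalIntegral.integral_finsetSum (fun ξ _ =>
    (by fun_prop : Continuous fun u => Real.exp (-(Φ.mu S ξ) * u)).intervalIntegrable _ _),
    ← Finset.sum_add_sum_compl {0}, Finset.sum_singleton, Φ.mu_zero hS]
  refine add_le_add ?_ (Finset.sum_le_sum fun ξ hξ => ?_)
  · simp; exact hs
  · have hp := hμ ξ (by simpa using hξ)
    have hd : ∀ u ∈ Set.uIcc s t, HasDerivAt (fun u => -(Real.exp (-(Φ.mu S ξ) * u) / Φ.mu S ξ))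
        (Real.exp (-(Φ.mu S ξ) * u)) u := by
      intro u _
      have h1 := (((hasDerivAt_id u).const_mul (-(Φ.mu S ξ))).exp.div_const (Φ.mu S ξ)).neg
      refine h1.congr_deriv ?_
      simp
      field_simp
    rw [intervalIntegral.integral_eq_sub_of_hasDerivAt hd
      ((by fun_prop : Continuous fun u => Real.exp (-(Φ.mu S ξ) * u)).intervalIntegrable _ _)]
    have : 0 ≤ Real.exp (-(Φ.mu S ξ) * t) / Φ.mu S ξ := by positivity
    linarith

end DualPairing

namespace DualPairing

variable {V : Type} [AddCommGroup V] [Fintype V] [DecidableEq V] (Φ : DualPairing V)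
  {S R : Finset V}

/-- Quantitative description of the spectrum of a walk which looks transient except for the
frequencies outside `R`, which are those of a one dimensional walk of relaxation time `M`, of
order `n / log n`. -/
structure SpectralBounds (S R : Finset V) (C M : ℝ) : Prop where
  nonempty : S.Nonempty
  neg : ∀ g ∈ S, -g ∈ S
  pos : ∀ ξ ≠ 0, 0 < Φ.mu S ξ
  zero_notMem : (0 : V) ∉ R
  neg_mem : ∀ ξ ∈ R, -ξ ∈ R
  one_le : 1 ≤ C
  M_pos : 0 < M
  M_le : M * Real.log (Fintype.card V) ≤ C * Fintype.card V
  le_M : Fintype.card V ≤ C * (M * Real.log (Fintype.card V))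
  sum_R : ∑ ξ ∈ R, (Φ.mu S ξ ^ 2)⁻¹ ≤ C * Fintype.card V
  sum_inv : ∑ ξ ∈ (insert 0 R)ᶜ, (Φ.mu S ξ)⁻¹ ≤ C * M
  sum_inv_sq : ∑ ξ ∈ (insert 0 R)ᶜ, (Φ.mu S ξ ^ 2)⁻¹ ≤ C * M ^ 2
  slow : ∃ ξ ≠ 0, Φ.mu S ξ ≤ C / M
  one_le_log : 1 ≤ Real.log (Fintype.card V)
  log_sq_le : Real.log (Fintype.card V) ^ 2 ≤ Fintype.card V

namespace SpectralBounds

variable {Φ} {C M : ℝ} (H : Φ.SpectralBounds S R C M)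

lemma sum_compl_zero (H : Φ.SpectralBounds S R C M) (f : V → ℝ) :
    ∑ ξ ∈ {0}ᶜ, f ξ = ∑ ξ ∈ R, f ξ + ∑ ξ ∈ (insert 0 R)ᶜ, f ξ := by
  rw [← Finset.sum_union]
  · congr 1
    ext ξ
    simp only [Finset.mem_compl, Finset.mem_singleton, Finset.mem_union, Finset.mem_insert, not_or]
    have := H.zero_notMem
    grind
  · rw [Finset.disjoint_left]
    intro ξ h1 h2
    simp [h1] at h2

lemma quarter_le_green (H : Φ.SpectralBounds S R C M) : 1 / 4 ≤ Φ.green S 0 := by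
  have hn := card_pos' (V := V)
  have h2 : (2 : ℝ) ≤ Fintype.card V := by
    have h := Real.log_le_sub_one_of_pos hn
    linarith [H.one_le_log]
  have h1 : ∑ ξ ∈ ({0} : Finset V)ᶜ, (1 / 2 : ℝ) ≤ ∑ ξ ∈ {0}ᶜ, Φ.c ξ 0 / Φ.mu S ξ := by
    refine Finset.sum_le_sum fun ξ hξ => ?_
    have hp := H.pos ξ (by simpa using hξ)
    rw [c_zero]
    exact div_le_div_of_nonneg_left zero_le_one hp (Φ.mu_le_two H.nonempty ξ)
  have h3 : ∑ ξ ∈ ({0} : Finset V)ᶜ, (1 / 2 : ℝ) = ((Fintype.card V : ℝ) - 1) / 2 := by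
    have := Finset.sum_add_sum_compl {0} fun _ : V => (1 / 2 : ℝ)
    simp only [Finset.sum_singleton, Finset.sum_const (s := Finset.univ), Finset.card_univ,
      nsmul_eq_mul] at this
    linarith
  rw [green, ← div_eq_inv_mul, le_div_iff₀ hn]
  linarith

lemma green_pos (H : Φ.SpectralBounds S R C M) : 0 < Φ.green S 0 := by
  linarith [H.quarter_le_green]

lemma M_le_card (H : Φ.SpectralBounds S R C M) : M ≤ C * Fintype.card V :=
  (le_mul_of_one_le_right H.M_pos.le H.one_le_log).trans H.M_le

lemma hitMean_le (H : Φ.SpectralBounds S R C M) :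
    Φ.hitMean S ≤ ((1 + C) / 2 + C ^ 2) * Fintype.card V := by
  have hn := card_pos' (V := V)
  have hC := H.one_le
  rw [hitMean_eq, H.sum_compl_zero]
  have h1 : ∑ ξ ∈ R, (Φ.mu S ξ)⁻¹ ≤ ∑ ξ ∈ R, (1 + (Φ.mu S ξ ^ 2)⁻¹) / 2 :=
    Finset.sum_le_sum fun ξ _ => by
      rw [← inv_pow]
      nlinarith [sq_nonneg ((Φ.mu S ξ)⁻¹ - 1)]
  have h2 : ∑ ξ ∈ R, (1 + (Φ.mu S ξ ^ 2)⁻¹) / 2 ≤ (Fintype.card V + C * Fintype.card V) / 2 := by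
    rw [← Finset.sum_div, Finset.sum_add_distrib]
    refine div_le_div_of_nonneg_right (add_le_add ?_ H.sum_R) two_pos.le
    simpa using Finset.card_le_univ R
  have h3 : C * M ≤ C * (C * Fintype.card V) := mul_le_mul_of_nonneg_left H.M_le_card (by linarith)
  have h4 := H.sum_inv
  nlinarith

lemma green_le (H : Φ.SpectralBounds S R C M) : Φ.green S 0 ≤ (1 + C) / 2 + C ^ 2 := by
  have hn := card_pos' (V := V)
  have h := H.hitMean_le
  rw [hitMean, mul_comm] at h
  exact le_of_mul_le_mul_right h hn

lemma invSq_le (H : Φ.SpectralBounds S R C M) :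
    Φ.invSq S ≤ (C + C ^ 3) * Fintype.card V ^ 2 / Real.log (Fintype.card V) ^ 2 := by
  have hn := card_pos' (V := V)
  have hC := H.one_le
  have hΛ := H.one_le_log
  set n : ℝ := (Fintype.card V : ℝ)
  set Λ := Real.log n
  rw [le_div_iff₀ (by positivity), invSq, H.sum_compl_zero]
  have h1 := H.sum_R
  have h2 := H.sum_inv_sq
  have h3 : (M * Λ) ^ 2 ≤ (C * n) ^ 2 :=
    pow_le_pow_left₀ (mul_nonneg H.M_pos.le (by linarith)) H.M_le 2
  have h4 : C * n * Λ ^ 2 ≤ C * n * n := mul_le_mul_of_nonneg_left H.log_sq_le (by positivity)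
  calc _ ≤ (C * n + C * M ^ 2) * Λ ^ 2 := by gcongr
    _ = C * n * Λ ^ 2 + C * (M * Λ) ^ 2 := by ring
    _ ≤ C * n * n + C * (C * n) ^ 2 := by gcongr
    _ = _ := by ring

lemma card_sq_le_invSq (H : Φ.SpectralBounds S R C M) :
    (Fintype.card V : ℝ) ^ 2 / (C ^ 4 * Real.log (Fintype.card V) ^ 2) ≤ Φ.invSq S := by
  have hn := card_pos' (V := V)
  have hC := H.one_le
  have hΛ := H.one_le_log
  have hM := H.M_pos
  obtain ⟨ξ, hξ, hs⟩ := H.slow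
  have hp := H.pos ξ hξ
  have h1 : (Φ.mu S ξ ^ 2)⁻¹ ≤ Φ.invSq S := Finset.single_le_sum
    (f := fun ξ => (Φ.mu S ξ ^ 2)⁻¹) (fun η _ => by positivity) (by simpa using hξ)
  refine le_trans ?_ h1
  have h2 : (C / M)⁻¹ ≤ (Φ.mu S ξ)⁻¹ := inv_anti₀ hp hs
  have h3 : (M / C) ^ 2 ≤ (Φ.mu S ξ)⁻¹ ^ 2 := by
    rw [inv_div] at h2
    exact pow_le_pow_left₀ (by positivity) h2 2
  rw [inv_pow] at h3
  refine le_trans ?_ h3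
  rw [div_pow, div_le_div_iff₀ (by positivity) (by positivity)]
  have h4 := pow_le_pow_left₀ hn.le H.le_M 2
  calc _ ≤ (C * (M * Real.log (Fintype.card V))) ^ 2 * C ^ 2 := by gcongr
    _ = _ := by ring

lemma quarter_card_le_hitMean (H : Φ.SpectralBounds S R C M) :
    (Fintype.card V : ℝ) / 4 ≤ Φ.hitMean S := by
  have := mul_le_mul_of_nonneg_left H.quarter_le_green (card_pos' (V := V)).le
  rw [hitMean]; linarith

lemma invSq_le_hitMean (H : Φ.SpectralBounds S R C M) :
    18 * Φ.invSq S ≤ 288 * (C + C ^ 3) / Real.log (Fintype.card V) ^ 2 * Φ.hitMean S ^ 2 := by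
  have hn := card_pos' (V := V)
  have hC := H.one_le
  have hΛ := H.one_le_log
  have h1 := H.invSq_le
  have h2 := pow_le_pow_left₀ (by positivity) H.quarter_card_le_hitMean 2
  have h3 : 0 ≤ 288 * (C + C ^ 3) / Real.log (Fintype.card V) ^ 2 := by positivity
  calc 18 * Φ.invSq S
      ≤ 18 * ((C + C ^ 3) * Fintype.card V ^ 2 / Real.log (Fintype.card V) ^ 2) := by linarith
    _ = 288 * (C + C ^ 3) / Real.log (Fintype.card V) ^ 2 * ((Fintype.card V : ℝ) / 4) ^ 2 := by
        ring
    _ ≤ _ := mul_le_mul_of_nonneg_left h2 h3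

lemma le_sum_corr_sq (H : Φ.SpectralBounds S R C M) :
    4 / (C ^ 4 * ((1 + C) / 2 + C ^ 2) ^ 2) * Fintype.card V
      ≤ 4 * Real.log (Fintype.card V) ^ 2 * ∑ y, Φ.corr S y ^ 2 := by
  have hn := card_pos' (V := V)
  have hC := H.one_le
  have hΛ := H.one_le_log
  have hG := H.green_pos
  simp only [corr, div_pow]
  rw [← Finset.sum_div, sum_green_sq]
  have h1 := pow_le_pow_left₀ hG.le H.green_le 2
  have h2 := H.card_sq_le_invSq
  have h0 : (0 : ℝ) < (1 + C) / 2 + C ^ 2 := by positivity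
  have h3 := Φ.invSq_nonneg (S := S)
  calc _ = 4 * Real.log (Fintype.card V) ^ 2 * ((Fintype.card V : ℝ)⁻¹ *
        ((Fintype.card V : ℝ) ^ 2 / (C ^ 4 * Real.log (Fintype.card V) ^ 2))
          / ((1 + C) / 2 + C ^ 2) ^ 2) := by field_simp
    _ ≤ _ := by gcongr

lemma card_corr_le (H : Φ.SpectralBounds S R C M) :
    ((Finset.univ.filter fun w =>
      w = 0 ∨ 4 * (C ^ 2 + 1) / Real.log (Fintype.card V) < |Φ.corr S w|).card : ℝ)
      ≤ C * Real.log (Fintype.card V) ^ 2 + 1 := by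
  have hn := card_pos' (V := V)
  have hC := H.one_le
  have hΛ := H.one_le_log
  have hG := H.green_pos
  set Λ := Real.log (Fintype.card V)
  set r : V → ℝ := fun x => (Fintype.card V : ℝ)⁻¹ * ∑ ξ ∈ R, Φ.c ξ x / Φ.mu S ξ with hr
  have hsq : ∑ x, r x ^ 2 ≤ C := by
    have h := Φ.sum_even_sq (fun ξ => if ξ ∈ R then (Φ.mu S ξ)⁻¹ else 0) (fun ξ => by
      have : -ξ ∈ R ↔ ξ ∈ R := ⟨fun h => by simpa using H.neg_mem _ h, H.neg_mem ξ⟩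
      simp [mu_neg, this])
    simp only [ite_mul, zero_mul, ite_pow, ne_eq, OfNat.ofNat_ne_zero, not_false_eq_true, zero_pow,
      Finset.sum_ite_mem, Finset.univ_inter, inv_pow] at h
    simp only [hr, mul_pow, ← Finset.mul_sum, div_eq_inv_mul]
    rw [h, pow_two, mul_assoc, inv_mul_cancel_left₀ hn.ne', inv_mul_le_iff₀ hn, mul_comm]
    exact H.sum_R
  have hgr : ∀ x, |Φ.green S x| ≤ C ^ 2 / Λ + |r x| := by
    intro x
    rw [green, H.sum_compl_zero, mul_add, add_comm]
    refine (abs_add_le _ _).trans (add_le_add ?_ le_rfl)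
    rw [abs_mul, abs_of_pos (inv_pos.2 hn), inv_mul_le_iff₀ hn]
    calc |∑ ξ ∈ (insert 0 R)ᶜ, Φ.c ξ x / Φ.mu S ξ|
        ≤ ∑ ξ ∈ (insert 0 R)ᶜ, (Φ.mu S ξ)⁻¹ := by
          refine (Finset.abs_sum_le_sum_abs _ _).trans (Finset.sum_le_sum fun ξ hξ => ?_)
          have hp := Φ.mu_nonneg H.nonempty ξ
          rw [abs_div, abs_of_nonneg hp, div_eq_mul_inv]
          exact mul_le_of_le_one_left (inv_nonneg.2 hp) (Φ.abs_c_le_one _ _)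
      _ ≤ C * M := H.sum_inv
      _ ≤ _ := by
          rw [mul_div_assoc', le_div_iff₀ (by linarith)]
          nlinarith [H.M_le]
  have hsub : (Finset.univ.filter fun w => w = 0 ∨ 4 * (C ^ 2 + 1) / Λ < |Φ.corr S w|)
      ⊆ insert 0 (Finset.univ.filter fun w => Λ⁻¹ ≤ |r w|) := by
    intro w hw
    simp only [Finset.mem_filter, Finset.mem_univ, true_and, Finset.mem_insert] at hw ⊢
    refine hw.imp_right fun h => ?_
    by_contra hlt
    push Not at hlt
    have h1 : |Φ.corr S w| ≤ 4 * |Φ.green S w| := by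
      rw [corr, abs_div, abs_of_pos hG, div_le_iff₀ hG]
      nlinarith [abs_nonneg (Φ.green S w), H.quarter_le_green]
    have h2 := hgr w
    have h3 : 4 * (C ^ 2 + 1) / Λ = 4 * (C ^ 2 / Λ + Λ⁻¹) := by field_simp
    linarith
  have hcard : ((Finset.univ.filter fun w => Λ⁻¹ ≤ |r w|).card : ℝ) ≤ C * Λ ^ 2 := by
    have h1 : ∑ w ∈ Finset.univ.filter (fun w => Λ⁻¹ ≤ |r w|), (Λ⁻¹) ^ 2 ≤ C := by
      calc _ ≤ ∑ w ∈ Finset.univ.filter (fun w => Λ⁻¹ ≤ |r w|), r w ^ 2 := by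
            refine Finset.sum_le_sum fun w hw => ?_
            rw [← sq_abs (r w)]
            exact pow_le_pow_left₀ (by positivity) (by simpa using hw) 2
        _ ≤ ∑ w, r w ^ 2 := Finset.sum_le_sum_of_subset_of_nonneg (Finset.subset_univ _)
            fun _ _ _ => sq_nonneg _
        _ ≤ C := hsq
    rw [Finset.sum_const, nsmul_eq_mul, inv_pow, ← div_eq_mul_inv,
      div_le_iff₀ (by positivity)] at h1
    exact h1
  have h1 : ((Finset.univ.filter fun w => w = 0 ∨ 4 * (C ^ 2 + 1) / Λ < |Φ.corr S w|).card : ℝ)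
      ≤ ((Finset.univ.filter fun w => Λ⁻¹ ≤ |r w|).card : ℝ) + 1 := by
    exact_mod_cast (Finset.card_le_card hsub).trans (Finset.card_insert_le _ _)
  linarith

lemma corr_le (H : Φ.SpectralBounds S R C M) {y : V} (hy : y ≠ 0) :
    Φ.corr S y ≤ 2 * (1 - 1 / (4 * ((1 + C) / 2 + C ^ 2))) - 1 := by
  have hG := H.green_pos
  have hC := H.one_le
  have h1 := Φ.green_le_sub_half H.nonempty H.pos hy
  have h2 : Φ.corr S y ≤ 1 - 1 / (2 * Φ.green S 0) := by
    rw [corr, div_le_iff₀ hG, sub_mul, one_mul]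
    have : 1 / (2 * Φ.green S 0) * Φ.green S 0 = 1 / 2 := by field_simp
    linarith
  have h3 : 1 / (2 * ((1 + C) / 2 + C ^ 2)) ≤ 1 / (2 * Φ.green S 0) :=
    one_div_le_one_div_of_le (by linarith) (by linarith [H.green_le])
  have h4 : 1 / (4 * ((1 + C) / 2 + C ^ 2)) = 1 / (2 * ((1 + C) / 2 + C ^ 2)) / 2 := by
    rw [div_div]; congr 1; ring
  linarith


end SpectralBounds

end DualPairing

lemma tendsto_pow_mul_exp_neg_mul (k : ℕ) {η : ℝ} (hη : 0 < η) :
    Tendsto (fun x : ℝ => x ^ k * Real.exp (-(η * x))) atTop (nhds 0) := by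
  have h := ((Real.tendsto_pow_mul_exp_neg_atTop_nhds_zero k).comp
    (tendsto_id.const_mul_atTop hη)).const_mul ((η ^ k)⁻¹)
  rw [mul_zero] at h
  refine h.congr fun x => ?_
  simp only [Function.comp, id, mul_pow]
  field_simp

/-- The bound of `DualPairing.prx_cov_le` for a graph with `exp l` vertices, with the error
parameters of size given by powers of `l`. -/
def tailBound (C D E Z v q l s : ℝ) : ℝ :=
  Real.exp l * (Real.exp (-((1 - D / l ^ 2) * (l + s)))
    - ((1 - D / l ^ 2) *
      (Real.exp (-(2 * (l + s)) - (2 * s * (E / l) + 4 * (l + s) * (E / l) ^ 2)) *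
      (Real.exp l * (1 + v / (2 * Z))
        - (C * l ^ 2 + 1) * (1 + 2 * l + 4 * l ^ 2 / (2 * Z))))) / 2
    + (Real.exp l ^ 2 * Real.exp (-((1 - D / l ^ 2) / ((1 + 2 * (E / l)) / 3) * (l + s)))
      + Real.exp l * (C * l ^ 2 + 1)
        * Real.exp (-((1 - D / l ^ 2) / (q / (1 + q) + E / l) * (l + s)))) / 2)

lemma tendsto_tailBound (C D Z v s : ℝ) {E q : ℝ} (hE : 0 ≤ E) (hq0 : 0 < q) (hq1 : q < 1) :
    Tendsto (fun l => tailBound C D E Z v q l s) atTop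
      (nhds (Real.exp (-s) - Real.exp (-2 * s) * (1 + v / (2 * Z)) / 2
        + Real.exp (6 * E - 3 * s) / 2)) := by
  have hinv : Tendsto (fun l : ℝ => l⁻¹) atTop (nhds 0) := tendsto_inv_atTop_zero
  have hlim : ∀ f : ℝ → ℝ, ContinuousAt f 0 → Tendsto (fun l : ℝ => f l⁻¹) atTop (nhds (f 0)) :=
    fun f hf => hf.tendsto.comp hinv
  have h1 : Tendsto (fun l : ℝ => Real.exp (-s + D * l⁻¹ + D * s * l⁻¹ ^ 2)) atTop
      (nhds (Real.exp (-s))) := by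
    convert hlim (fun x => Real.exp (-s + D * x + D * s * x ^ 2)) (by fun_prop) using 2
    simp
  have h2 : Tendsto (fun l : ℝ => (1 - D * l⁻¹ ^ 2) *
      Real.exp (-2 * s - (2 * s * E * l⁻¹ + 4 * E ^ 2 * l⁻¹ + 4 * s * E ^ 2 * l⁻¹ ^ 2))) atTop
      (nhds (Real.exp (-2 * s))) := by
    convert hlim (fun x => (1 - D * x ^ 2) *
      Real.exp (-2 * s - (2 * s * E * x + 4 * E ^ 2 * x + 4 * s * E ^ 2 * x ^ 2)))
      (by fun_prop) using 2
    simp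
  have h2' : Tendsto (fun l : ℝ => (1 + v / (2 * Z))
      - (C * l ^ 2 + 1) * (1 + 2 * l + 4 * l ^ 2 / (2 * Z)) * Real.exp (-l)) atTop
      (nhds (1 + v / (2 * Z))) := by
    have p := fun k => Real.tendsto_pow_mul_exp_neg_atTop_nhds_zero k
    have := ((((p 4).const_mul (C * 4 / (2 * Z))).add ((p 3).const_mul (2 * C))).add
      ((p 2).const_mul (C + 4 / (2 * Z)))).add (((p 1).const_mul 2).add (p 0))
    have h := this.const_sub (1 + v / (2 * Z))
    simp only [mul_zero, add_zero, sub_zero] at h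
    refine h.congr fun l => ?_
    ring
  have h3 : Tendsto (fun l : ℝ => Real.exp ((6 * E - 3 * s + 3 * D * l⁻¹ + 3 * D * s * l⁻¹ ^ 2)
      / (1 + 2 * E * l⁻¹))) atTop (nhds (Real.exp (6 * E - 3 * s))) := by
    have := hlim (fun x => Real.exp ((6 * E - 3 * s + 3 * D * x + 3 * D * s * x ^ 2)
      / (1 + 2 * E * x))) (by
        refine ContinuousAt.rexp (ContinuousAt.div (by fun_prop) (by fun_prop) (by simp)))
    simpa using this
  have h4 : Tendsto (fun l : ℝ => (C * l ^ 2 + 1) * Real.exp (l *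
      (2 - (1 - D * l⁻¹ ^ 2) / (q / (1 + q) + E * l⁻¹) * (1 + s * l⁻¹)))) atTop (nhds 0) := by
    have hβ : Tendsto (fun l : ℝ =>
        2 - (1 - D * l⁻¹ ^ 2) / (q / (1 + q) + E * l⁻¹) * (1 + s * l⁻¹)) atTop
        (nhds (2 - 1 / (q / (1 + q)))) := by
      have h0 : q / (1 + q) ≠ 0 := by positivity
      have := hlim (fun x => 2 - (1 - D * x ^ 2) / (q / (1 + q) + E * x) * (1 + s * x)) (by
        refine ContinuousAt.sub (by fun_prop) (ContinuousAt.mul (ContinuousAt.div (by fun_prop)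
          (by fun_prop) (by simpa using h0)) (by fun_prop)))
      simpa using this
    have hneg : 2 - 1 / (q / (1 + q)) < 0 := by
      rw [one_div_div, sub_neg, lt_div_iff₀ hq0]; linarith
    obtain ⟨η, hη0, hη⟩ : ∃ η : ℝ, 0 < η ∧ 2 - 1 / (q / (1 + q)) < -η :=
      ⟨-(2 - 1 / (q / (1 + q))) / 2, by linarith, by linarith⟩
    have hp := ((tendsto_pow_mul_exp_neg_mul 2 hη0).const_mul |C|).add
      (tendsto_pow_mul_exp_neg_mul 0 hη0)
    simp only [mul_zero, add_zero] at hp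
    refine squeeze_zero_norm' ?_ hp
    filter_upwards [hβ.eventually_lt_const hη, eventually_ge_atTop 0] with l hl hl0
    rw [Real.norm_eq_abs, abs_mul, abs_of_pos (Real.exp_pos _)]
    have e1 : |C * l ^ 2 + 1| ≤ |C| * l ^ 2 + 1 := by
      refine (abs_add_le _ _).trans_eq ?_
      rw [abs_mul, abs_of_nonneg (sq_nonneg l), abs_one]
    have e2 : Real.exp (l * (2 - (1 - D * l⁻¹ ^ 2) / (q / (1 + q) + E * l⁻¹) * (1 + s * l⁻¹)))
        ≤ Real.exp (-(η * l)) := Real.exp_le_exp.2 (by nlinarith)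
    calc _ ≤ (|C| * l ^ 2 + 1) * Real.exp (-(η * l)) := by gcongr
      _ = _ := by ring
  have h := ((h1.sub ((h2.mul h2').div_const 2)).add (h3.div_const 2)).add (h4.div_const 2)
  rw [zero_div, add_zero] at h
  refine h.congr' ?_
  filter_upwards [eventually_gt_atTop 0] with l hl
  have e1 : Real.exp (-s + D * l⁻¹ + D * s * l⁻¹ ^ 2)
      = Real.exp l * Real.exp (-((1 - D / l ^ 2) * (l + s))) := by
    rw [← Real.exp_add]; congr 1; field_simp; ring
  have e2 : Real.exp (-2 * s - (2 * s * E * l⁻¹ + 4 * E ^ 2 * l⁻¹ + 4 * s * E ^ 2 * l⁻¹ ^ 2))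
      = Real.exp l * Real.exp l *
        Real.exp (-(2 * (l + s)) - (2 * s * (E / l) + 4 * (l + s) * (E / l) ^ 2)) := by
    rw [← Real.exp_add, ← Real.exp_add]; congr 1; field_simp; ring
  have e3 : Real.exp ((6 * E - 3 * s + 3 * D * l⁻¹ + 3 * D * s * l⁻¹ ^ 2) / (1 + 2 * E * l⁻¹))
      = Real.exp l * Real.exp l ^ 2 *
        Real.exp (-((1 - D / l ^ 2) / ((1 + 2 * (E / l)) / 3) * (l + s))) := by
    rw [← Real.exp_nat_mul, ← Real.exp_add, ← Real.exp_add]; congr 1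
    have : l + 2 * E ≠ 0 := by positivity
    field_simp; push_cast; ring
  have e4 : Real.exp (l * (2 - (1 - D * l⁻¹ ^ 2) / (q / (1 + q) + E * l⁻¹) * (1 + s * l⁻¹)))
      = Real.exp l * Real.exp l *
        Real.exp (-((1 - D / l ^ 2) / (q / (1 + q) + E / l) * (l + s))) := by
    rw [← Real.exp_add, ← Real.exp_add]; congr 1
    have : q / (1 + q) + E / l ≠ 0 := by positivity
    have e : l * (1 + s * l⁻¹) = l + s := by field_simp
    rw [mul_sub, mul_left_comm, e, ← div_eq_mul_inv, inv_pow, ← div_eq_mul_inv]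
    ring
  have e5 : Real.exp l * Real.exp (-l) = 1 := by rw [← Real.exp_add]; simp
  rw [e1, e2, e3, e4, tailBound, inv_pow, ← div_eq_mul_inv D]
  linear_combination (1 - D / l ^ 2) *
    (Real.exp l * Real.exp (-(2 * (l + s)) - (2 * s * (E / l) + 4 * (l + s) * (E / l) ^ 2)) *
      ((C * l ^ 2 + 1) * (1 + 2 * l + 4 * l ^ 2 / (2 * Z)))) / 2 * e5

namespace DualPairing.SpectralBounds

variable {V : Type} [AddCommGroup V] [Fintype V] [DecidableEq V] {Φ : DualPairing V}
  {S R : Finset V} {C M : ℝ}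

lemma prx_cov_le_tailBound (H : Φ.SpectralBounds S R C M)
    (hl : 576 * (C + C ^ 3) ≤ Real.log (Fintype.card V)) {K : Matrix V V ℝ} (hK : K = stepMat S)
    {W : CTMC V K} (hW : W.Regular) (o x : V) {s : ℝ} (hs : 0 ≤ s) :
    W.prx x {ω | W.epi (W.hit {o}) * (Real.log (Fintype.card V) + s) < W.cov ω} ≤
      tailBound C (288 * (C + C ^ 3)) (4 * (C ^ 2 + 1)) (2 * (4 * (C ^ 2 + 1)))
        (4 / (C ^ 4 * ((1 + C) / 2 + C ^ 2) ^ 2)) (1 - 1 / (4 * ((1 + C) / 2 + C ^ 2)))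
        (Real.log (Fintype.card V)) s := by
  subst hK
  have hn := card_pos' (V := V)
  have hC := H.one_le
  have hC2 : C ≤ C ^ 2 := by nlinarith
  have hC3 : C ^ 2 ≤ C ^ 3 := by nlinarith [sq_nonneg C]
  have hm : 3 ≤ Φ.hitMean S := by
    have := Real.log_le_sub_one_of_pos hn
    linarith [H.quarter_card_le_hitMean]
  have hQ := H.invSq_le_hitMean
  set l := Real.log (Fintype.card V) with hldef
  have hl0 : 0 < l := by linarith
  have hδ : 288 * (C + C ^ 3) / l ^ 2 ≤ 1 / 2 := by
    rw [div_le_iff₀ (by positivity)]; nlinarith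
  have hexp : Real.exp l = Fintype.card V := Real.exp_log hn
  rw [Φ.epi_hit H.nonempty H.neg H.pos hW o H.green_pos (by linarith)
    (by nlinarith [sq_nonneg (Φ.hitMean S)])]
  have := Φ.prx_cov_le H.nonempty H.neg H.pos hW x (q := 1 - 1 / (4 * ((1 + C) / 2 + C ^ 2)))
    (δ := 288 * (C + C ^ 3) / l ^ 2) (ε := 4 * (C ^ 2 + 1) / l) (N := C * l ^ 2 + 1)
    (v := 4 / (C ^ 4 * ((1 + C) / 2 + C ^ 2) ^ 2)) (Z := 2 * (4 * (C ^ 2 + 1))) (Λ := l) (s := s)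
    H.green_pos
    (by
      have : 1 / (4 * ((1 + C) / 2 + C ^ 2)) ≤ 1 / 2 :=
        one_div_le_one_div_of_le two_pos (by linarith)
      linarith)
    (fun y hy => H.corr_le hy) hm hQ hδ (by positivity)
    (by rw [div_le_iff₀ hl0]; linarith) H.card_corr_le H.le_sum_corr_sq (by linarith)
    (by rw [mul_assoc, mul_div_cancel₀ _ hl0.ne']) hl0.le hs
  rwa [tailBound, hexp]

/-- The constant in the correction to the Gumbel tail. -/
lemma tail_limit_le {E κ s : ℝ} (hκ : 0 < κ) (hs : 6 * E - Real.log (κ / 2) ≤ s) :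
    Real.exp (-s) - Real.exp (-2 * s) * (1 + κ) / 2 + Real.exp (6 * E - 3 * s) / 2
      ≤ (1 - Real.exp (-Real.exp (-s))) - κ / 4 * Real.exp (-2 * s) := by
  have h1 : Real.exp (6 * E - s) ≤ κ / 2 := by
    rw [← Real.exp_log (half_pos hκ)]; exact Real.exp_le_exp.2 (by linarith)
  have h2 : Real.exp (6 * E - 3 * s) = Real.exp (6 * E - s) * Real.exp (-2 * s) := by
    rw [← Real.exp_add]; congr 1; ring
  have h3 : Real.exp (-2 * s) = Real.exp (-s) ^ 2 := by
    rw [← Real.exp_nat_mul]; congr 1; push_cast; ring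
  have h4 : Real.exp (-Real.exp (-s)) ≤ 1 - Real.exp (-s) + Real.exp (-s) ^ 2 / 2 := by
    have hy := (Real.exp_pos (-s)).le
    have := Real.quadratic_le_exp_of_nonneg hy
    rw [Real.exp_neg, inv_le_comm₀ (Real.exp_pos _) (by nlinarith [sq_nonneg (1 - Real.exp (-s))])]
    refine le_trans ?_ this
    rw [inv_le_iff_one_le_mul₀ (by nlinarith [sq_nonneg (1 - Real.exp (-s))])]
    nlinarith [pow_nonneg hy 4]
  rw [h2, h3] at *
  nlinarith [mul_le_mul_of_nonneg_right h1 (sq_nonneg (Real.exp (-s)))]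

lemma sum_exp_div_le (H : Φ.SpectralBounds S R C M) {s : ℝ} (hs : 0 < s) :
    ∑ ξ ∈ {0}ᶜ, Real.exp (-(Φ.mu S ξ) * s) / Φ.mu S ξ ≤ C * Fintype.card V / s + C * M := by
  rw [H.sum_compl_zero]
  refine add_le_add ?_ ?_
  · rw [le_div_iff₀ hs, Finset.sum_mul]
    refine le_trans (Finset.sum_le_sum fun ξ hξ => ?_) H.sum_R
    have hμ := H.pos ξ fun h => H.zero_notMem (h ▸ hξ)
    have h := Real.add_one_le_exp (Φ.mu S ξ * s)
    have h2 : Real.exp (-(Φ.mu S ξ) * s) ≤ 1 / (Φ.mu S ξ * s) := by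
      rw [neg_mul, Real.exp_neg, inv_eq_one_div]
      exact one_div_le_one_div_of_le (by positivity) (by linarith)
    calc _ ≤ 1 / (Φ.mu S ξ * s) / Φ.mu S ξ * s := by gcongr
      _ = _ := by field_simp
  · refine le_trans (Finset.sum_le_sum fun ξ hξ => ?_) H.sum_inv
    have hμ := H.pos ξ fun h => by simp [h] at hξ
    rw [inv_eq_one_div]
    refine div_le_div_of_nonneg_right (Real.exp_le_one_iff.2 ?_) hμ.le
    nlinarith

lemma ex_loc_bounds (H : Φ.SpectralBounds S R C M) {K : Matrix V V ℝ} (hK : K = stepMat S)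
    {W : CTMC V K} (hW : W.Regular) {s : ℝ} (hs : 0 < s)
    (hsn : 2 * C ^ 2 * s * Real.log (Fintype.card V) ≤ Fintype.card V) :
    0 ≤ (⨆ x, W.ex x (fun ω => W.loc x (tmixTV K) ω - W.loc x s ω)) ∧
    (⨆ x, W.ex x (fun ω => W.loc x (tmixTV K) ω - W.loc x s ω)) ≤
      C / s + (2 * (C + C ^ 3) + C ^ 2) / Real.log (Fintype.card V) := by
  subst hK
  have hn := card_pos' (V := V)
  have hC := H.one_le
  have hM := H.M_pos
  obtain ⟨ξ, hξ, hslow⟩ := H.slow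
  have hl : 0 < Real.log (Fintype.card V) := by linarith [H.one_le_log]
  have hQ := H.invSq_le
  have hMle := H.M_le
  have hleM := H.le_M
  set n : ℝ := (Fintype.card V : ℝ) with hndef
  set l := Real.log n
  have hCC : C ≤ C ^ 3 := by nlinarith [sq_nonneg C]
  obtain ⟨hlow, hup⟩ := Φ.tmixTV_bounds H.nonempty H.neg H.pos (t := 2 * (C + C ^ 3) * n / l)
    (by positivity) (by
      refine (mul_le_mul_of_nonneg_left hQ two_pos.le).trans ?_
      rw [div_pow, mul_div_assoc']
      gcongr
      nlinarith [mul_pos hn hn]) hξ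
  have hst : s ≤ tmixTV (stepMat S) := by
    refine le_trans ?_ hlow
    have hμ := H.pos ξ hξ
    rw [le_div_iff₀ (by positivity)]
    have : s * (2 * Φ.mu S ξ) ≤ s * (2 * (C / M)) := by gcongr
    refine this.trans ?_
    rw [mul_div_assoc', mul_div_assoc', div_le_one hM]
    have h1 : C * l * (s * (2 * C)) ≤ C * l * M := by nlinarith
    exact le_of_mul_le_mul_left h1 (by positivity)
  have hb := fun x => Φ.ex_loc_sub_bounds H.nonempty H.neg H.pos hW x hs.le hst
  have hV : Nonempty V := ⟨0⟩
  refine ⟨Real.iSup_nonneg fun x => (hb x).1, ciSup_le fun x => (hb x).2.trans ?_⟩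
  have h1 := H.sum_exp_div_le hs
  have h2 : M ≤ C * n / l := by rwa [le_div_iff₀ hl]
  have h3 : C * M ≤ C * (C * n / l) := by gcongr
  rw [← hndef] at h1 ⊢
  rw [inv_mul_le_iff₀ hn]
  have : n * (C / s + (2 * (C + C ^ 3) + C ^ 2) / l)
      = 2 * (C + C ^ 3) * n / l + (C * n / s + C * (C * n / l)) := by ring
  linarith only [this, h1, h3, hup]

end DualPairing.SpectralBounds

/-- The walk is a regular version of a walk on an abelian group, whose spectrum satisfies
`DualPairing.SpectralBounds` with the constant `C`. -/
def GW.Spectral (B : GW) (C : ℝ) : Prop :=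
  ∃ (_ : AddCommGroup B.V) (Φ : DualPairing B.V) (S R : Finset B.V) (M : ℝ),
    transMat B.G = stepMat S ∧ B.W.Regular ∧ Φ.SpectralBounds S R C M

section

variable {B : ℕ → GW} {C : ℝ}

lemma tendsto_log_nV (hn : Tendsto (fun n => (B n).nV) atTop atTop) :
    Tendsto (fun n => Real.log ((B n).nV)) atTop atTop :=
  Real.tendsto_log_atTop.comp (tendsto_natCast_atTop_atTop.comp hn)

theorem limsup_prx_le (hB : ∀ᶠ n in atTop, (B n).Spectral C)
    (hn : Tendsto (fun n => (B n).nV) atTop atTop) (o : (n : ℕ) → (B n).V) :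
    ∃ s0 c : ℝ, 0 < c ∧ ∀ s : ℝ, s0 ≤ s → ∀ x0 : (n : ℕ) → (B n).V,
      Filter.limsup (fun n => (B n).W.prx (x0 n)
        {ω | (B n).W.epi ((B n).W.hit {o n}) * (Real.log ((B n).nV) + s) < (B n).W.cov ω}) atTop
      ≤ (1 - Real.exp (-Real.exp (-s))) - c * Real.exp (-2 * s) := by
  have hC : 1 ≤ C := by
    obtain ⟨_, _, Φ, S, R, M, _, _, H⟩ := hB.exists
    exact H.one_le
  set κ := 4 / (C ^ 4 * ((1 + C) / 2 + C ^ 2) ^ 2) / (2 * (2 * (4 * (C ^ 2 + 1)))) with hκ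
  have hκ0 : 0 < κ := by positivity
  refine ⟨max 0 (6 * (4 * (C ^ 2 + 1)) - Real.log (κ / 2)), κ / 4, by positivity,
    fun s hs x0 => ?_⟩
  have hCg : 0 < 1 / (4 * ((1 + C) / 2 + C ^ 2)) := by positivity
  have hCg' : 1 / (4 * ((1 + C) / 2 + C ^ 2)) < 1 := by
    rw [div_lt_one (by positivity)]; nlinarith
  have ht := (tendsto_tailBound C (288 * (C + C ^ 3)) (2 * (4 * (C ^ 2 + 1)))
    (4 / (C ^ 4 * ((1 + C) / 2 + C ^ 2) ^ 2)) s (E := 4 * (C ^ 2 + 1))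
    (q := 1 - 1 / (4 * ((1 + C) / 2 + C ^ 2))) (by positivity) (by linarith)
    (by linarith)).comp (tendsto_log_nV hn)
  refine le_trans ?_ (DualPairing.SpectralBounds.tail_limit_le hκ0 ((le_max_right _ _).trans hs))
  refine le_trans (limsup_le_limsup ?_ ?_ ht.isBoundedUnder_le) ht.limsup_eq.le
  · filter_upwards [hB, (tendsto_log_nV hn).eventually_ge_atTop (576 * (C + C ^ 3))] with n h hl
    obtain ⟨_, Φ, S, R, M, hK, hW, H⟩ := h
    exact H.prx_cov_le_tailBound hl hK hW (o n) (x0 n) ((le_max_left _ _).trans hs)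
  · exact isCoboundedUnder_le_of_le atTop (x := 0) fun n => ENNReal.toReal_nonneg

theorem tendsto_limsup_ex_loc (hB : ∀ᶠ n in atTop, (B n).Spectral C)
    (hn : Tendsto (fun n => (B n).nV) atTop atTop) :
    Tendsto (fun s : ℝ => Filter.limsup (fun n => ⨆ x : (B n).V,
      (B n).W.ex x (fun ω =>
        (B n).W.loc x (tmixTV (transMat (B n).G)) ω - (B n).W.loc x s ω)) atTop)
      atTop (nhds 0) := by
  have hlog : Tendsto (fun n => 2 * C ^ 2 * 1 * Real.log ((B n).nV) / (B n).nV) atTop (nhds 0) := by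
    have h := (Real.isLittleO_log_id_atTop.tendsto_div_nhds_zero.comp
      (tendsto_natCast_atTop_atTop.comp hn)).const_mul (2 * C ^ 2 * 1)
    rw [mul_zero] at h
    refine h.congr fun n => ?_
    simp only [Function.comp, id]
    ring
  have hbound : ∀ s : ℝ, 0 < s → ∀ᶠ n in atTop,
      0 ≤ (⨆ x : (B n).V, (B n).W.ex x (fun ω =>
        (B n).W.loc x (tmixTV (transMat (B n).G)) ω - (B n).W.loc x s ω)) ∧
      (⨆ x : (B n).V, (B n).W.ex x (fun ω =>
        (B n).W.loc x (tmixTV (transMat (B n).G)) ω - (B n).W.loc x s ω)) ≤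
      C / s + (2 * (C + C ^ 3) + C ^ 2) / Real.log ((B n).nV) := by
    intro s hs
    filter_upwards [hB, hlog.eventually_lt_const (inv_pos.2 hs), hn.eventually_ge_atTop 1]
      with n h h1 h2
    obtain ⟨_, Φ, S, R, M, hK, hW, H⟩ := h
    refine H.ex_loc_bounds hK hW hs ?_
    have h3 : (0 : ℝ) < (B n).nV := by exact_mod_cast h2
    rw [div_lt_iff₀ h3, inv_mul_eq_div, lt_div_iff₀ hs] at h1
    refine le_trans (le_of_eq ?_) h1.le
    rw [GW.nV]; ring
  have hlim : ∀ s : ℝ, Tendsto (fun n => C / s + (2 * (C + C ^ 3) + C ^ 2) / Real.log ((B n).nV))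
      atTop (nhds (C / s)) := fun s => by
    simpa using ((tendsto_log_nV hn).const_div_atTop (2 * (C + C ^ 3) + C ^ 2)).const_add (C / s)
  refine tendsto_of_tendsto_of_tendsto_of_le_of_le' tendsto_const_nhds
    (tendsto_id.const_div_atTop C) ?_ ?_
  · filter_upwards [eventually_gt_atTop 0] with s hs
    refine le_limsup_of_frequently_le ((hbound s hs).mono fun n h => h.1).frequently ?_
    exact (hlim s).isBoundedUnder_le.mono_le ((hbound s hs).mono fun n h => h.2)
  · filter_upwards [eventually_gt_atTop 0] with s hs
    refine le_trans (limsup_le_limsup ((hbound s hs).mono fun n h => h.2) ?_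
      (hlim s).isBoundedUnder_le) (hlim s).limsup_eq.le
    exact IsCobounded.of_frequently_ge ((hbound s hs).mono fun n h => h.1).frequently

end

namespace DualPairing

/-- The pairing of `ZMod k` with itself by roots of unity. -/
def zmod (k : ℕ) [NeZero k] : DualPairing (ZMod k) where
  e ξ x := ZMod.stdAddChar (ξ * x)
  map_add ξ x y := by rw [mul_add, AddChar.map_add_eq_mul]
  symm ξ x := by rw [mul_comm]
  norm_one ξ x := by rw [ZMod.stdAddChar_apply]; exact Circle.norm_coe _
  sum_eq ξ := by
    have h := AddChar.sum_mulShift ξ (ZMod.isPrimitive_stdAddChar k)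
    simp only [mul_comm _ ξ] at h
    rw [h]; split_ifs <;> simp

/-- The product of pairings. -/
def prod {V W : Type} [AddCommGroup V] [Fintype V] [DecidableEq V] [AddCommGroup W] [Fintype W]
    [DecidableEq W] (Φ : DualPairing V) (Ψ : DualPairing W) : DualPairing (V × W) where
  e ξ x := Φ.e ξ.1 x.1 * Ψ.e ξ.2 x.2
  map_add ξ x y := by simp only [Prod.fst_add, Prod.snd_add, Φ.map_add, Ψ.map_add]; ring
  symm ξ x := by rw [Φ.symm, Ψ.symm]
  norm_one ξ x := by rw [norm_mul, Φ.norm_one, Ψ.norm_one, mul_one]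
  sum_eq ξ := by
    rw [Fintype.sum_prod_type]
    simp only [← Finset.mul_sum, ← Finset.sum_mul, Φ.sum_eq, Ψ.sum_eq, Prod.ext_iff,
      Prod.fst_zero, Prod.snd_zero, Fintype.card_prod]
    split_ifs <;> simp_all

/-- The power of a pairing. -/
def pi {V ι : Type} [AddCommGroup V] [Fintype V] [DecidableEq V] [Fintype ι] [DecidableEq ι]
    (Φ : DualPairing V) : DualPairing (ι → V) where
  e ξ x := ∏ j, Φ.e (ξ j) (x j)
  map_add ξ x y := by simp only [Pi.add_apply, Φ.map_add, Finset.prod_mul_distrib]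
  symm ξ x := Finset.prod_congr rfl fun j _ => Φ.symm _ _
  norm_one ξ x := by simp only [norm_prod, Φ.norm_one, Finset.prod_const_one]
  sum_eq ξ := by
    rw [← Fintype.piFinset_univ, ← Finset.prod_univ_sum]
    simp only [Φ.sum_eq]
    by_cases h : ξ = 0
    · simp [h]
    · obtain ⟨j, hj⟩ := Function.ne_iff.1 h
      rw [if_neg h]
      exact Finset.prod_eq_zero (Finset.mem_univ j) (if_neg hj)

section ZMod

variable (k : ℕ) [NeZero k]

lemma zmod_c_one (b : ZMod k) : (zmod k).c b 1 = Real.cos (2 * Real.pi * b.valMinAbs / k) := by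
  show (ZMod.stdAddChar (b * 1)).re = _
  rw [mul_one]
  nth_rw 1 [← ZMod.coe_valMinAbs b]
  rw [ZMod.stdAddChar_coe, show (2 * Real.pi * Complex.I * b.valMinAbs / k : ℂ)
    = ((2 * Real.pi * b.valMinAbs / k : ℝ) : ℂ) * Complex.I by push_cast; ring,
    Complex.exp_ofReal_mul_I_re]

lemma zmod_one_sub_c_one (b : ZMod k) :
    8 * (b.valMinAbs.natAbs : ℝ) ^ 2 / k ^ 2 ≤ 1 - (zmod k).c b 1 := by
  have hk : (0 : ℝ) < k := by exact_mod_cast Nat.pos_of_ne_zero (NeZero.ne k)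
  have h1 : (b.valMinAbs.natAbs : ℝ) = |(b.valMinAbs : ℝ)| := by
    rw [Nat.cast_natAbs, Int.cast_abs]
  have h2 : (b.valMinAbs.natAbs : ℝ) ≤ k / 2 :=
    (Nat.cast_le.2 (ZMod.natAbs_valMinAbs_le b)).trans Nat.cast_div_le
  have h3 : |2 * Real.pi * b.valMinAbs / k| ≤ Real.pi := by
    rw [abs_div, abs_mul, ← h1, abs_of_pos Real.two_pi_pos, abs_of_pos hk, div_le_iff₀ hk]
    nlinarith [Real.pi_pos]
  have h := Real.cos_le_one_sub_mul_cos_sq h3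
  rw [zmod_c_one, h1, sq_abs]
  have : 2 / Real.pi ^ 2 * (2 * Real.pi * b.valMinAbs / k) ^ 2 =
      8 * (b.valMinAbs : ℝ) ^ 2 / k ^ 2 := by
    have := Real.pi_ne_zero
    field_simp; ring
  linarith

lemma zmod_one_sub_c_one_one_le : 1 - (zmod k).c 1 1 ≤ 20 / k ^ 2 := by
  have hk : (0 : ℝ) < k := by exact_mod_cast Nat.pos_of_ne_zero (NeZero.ne k)
  have h : (zmod k).c 1 1 = Real.cos (2 * Real.pi / k) := by
    show (ZMod.stdAddChar ((1 : ZMod k) * 1)).re = _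
    rw [mul_one, ← Int.cast_one, ZMod.stdAddChar_coe,
      show (2 * Real.pi * Complex.I * (1 : ℤ) / k : ℂ) = ((2 * Real.pi / k : ℝ) : ℂ) * Complex.I by
        push_cast; ring, Complex.exp_ofReal_mul_I_re]
  have h1 := Real.one_sub_sq_div_two_le_cos (x := 2 * Real.pi / k)
  have h2 : (2 * Real.pi / k) ^ 2 / 2 = 2 * Real.pi ^ 2 / k ^ 2 := by field_simp
  have h3 : 2 * Real.pi ^ 2 / k ^ 2 ≤ 20 / (k : ℝ) ^ 2 := by
    gcongr
    nlinarith [Real.pi_lt_d2, Real.pi_pos]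
  rw [h]; linarith

end ZMod

end DualPairing

lemma ZMod.sum_natAbs_valMinAbs_le (k : ℕ) [NeZero k] {f : ℕ → ℝ} (hf : ∀ v, 0 ≤ f v) :
    ∑ a ∈ ({0} : Finset (ZMod k))ᶜ, f a.valMinAbs.natAbs ≤ 2 * ∑ v ∈ Finset.Icc 1 k, f v := by
  rw [Finset.sum_comp, Finset.mul_sum]
  refine le_trans (Finset.sum_le_sum (g := fun v => 2 * f v) fun v _ => ?_) ?_
  · rw [nsmul_eq_mul]
    refine mul_le_mul_of_nonneg_right ?_ (hf v)
    have : (({0} : Finset (ZMod k))ᶜ.filter fun a => a.valMinAbs.natAbs = v)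
        ⊆ {(v : ZMod k), -(v : ZMod k)} := by
      intro a ha
      have h := (Finset.mem_filter.1 ha).2
      have h2 := ZMod.coe_valMinAbs a
      simp only [Finset.mem_insert, Finset.mem_singleton]
      rcases Int.natAbs_eq_iff.1 h with h | h
      · left; rw [← h2, h]; simp
      · right; rw [← h2, h]; simp
    exact_mod_cast (Finset.card_le_card this).trans Finset.card_le_two
  · refine Finset.sum_le_sum_of_subset_of_nonneg ?_ fun v _ _ => mul_nonneg two_pos.le (hf v)
    intro v hv
    obtain ⟨a, ha, rfl⟩ := Finset.mem_image.1 hv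
    rw [Finset.mem_Icc]
    refine ⟨Nat.one_le_iff_ne_zero.2 ?_, (ZMod.natAbs_valMinAbs_le a).trans (Nat.div_le_self _ _)⟩
    rw [Int.natAbs_ne_zero, Ne, ZMod.valMinAbs_eq_zero]
    simpa using ha

lemma sum_inv_sq_le (k : ℕ) : ∑ v ∈ Finset.Icc 1 k, ((v : ℝ) ^ 2)⁻¹ ≤ 2 := by
  have h : ∑ v ∈ Finset.Icc 1 k, ((v : ℝ) ^ 2)⁻¹ ≤ 2 - 2 / (2 * k + 1) := by
    induction k with
    | zero => norm_num
    | succ k ih =>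
      rw [Finset.sum_Icc_succ_top (by omega)]
      have : (((k + 1 : ℕ) : ℝ) ^ 2)⁻¹ ≤ 2 / (2 * k + 1 : ℝ) - 2 / (2 * ((k + 1 : ℕ) : ℝ) + 1) := by
        rw [div_sub_div _ _ (by positivity) (by positivity), inv_eq_one_div,
          div_le_div_iff₀ (by positivity) (by positivity)]
        push_cast
        nlinarith
      linarith
  have : (0 : ℝ) ≤ 2 / (2 * k + 1) := by positivity
  linarith

lemma sum_inv_sqrt_le (k : ℕ) : ∑ v ∈ Finset.Icc 1 k, (√(v : ℝ))⁻¹ ≤ 2 * √k := by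
  induction k with
  | zero => simp
  | succ k ih =>
    rw [Finset.sum_Icc_succ_top (by omega)]
    have h0 : 0 < √((k + 1 : ℕ) : ℝ) := Real.sqrt_pos.2 (by positivity)
    have h1 := Real.sq_sqrt (Nat.cast_nonneg (α := ℝ) k)
    have h2 := Real.sq_sqrt (Nat.cast_nonneg (α := ℝ) (k + 1))
    have : (√((k + 1 : ℕ) : ℝ))⁻¹ ≤ 2 * √((k + 1 : ℕ) : ℝ) - 2 * √k := by
      rw [inv_le_iff_one_le_mul₀ h0]
      push_cast at h2 ⊢
      nlinarith [sq_nonneg (√((k : ℝ) + 1) - √(k : ℝ))]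
    linarith

namespace DualPairing

variable {V W ι : Type} [AddCommGroup V] [Fintype V] [DecidableEq V] [AddCommGroup W] [Fintype W]
  [DecidableEq W] [Fintype ι] [DecidableEq ι] (Φ : DualPairing V) (Ψ : DualPairing W)

lemma prod_c_left (ξ : V × W) (x : V) : (Φ.prod Ψ).c ξ (x, 0) = Φ.c ξ.1 x := by
  show (Φ.e ξ.1 x * Ψ.e ξ.2 0).re = _
  rw [e_zero, mul_one, c]

lemma prod_c_right (ξ : V × W) (y : W) : (Φ.prod Ψ).c ξ (0, y) = Ψ.c ξ.2 y := by
  show (Φ.e ξ.1 0 * Ψ.e ξ.2 y).re = _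
  rw [e_zero, one_mul, c]

lemma pi_c_single (ξ : ι → V) (j : ι) (x : V) :
    (Φ.pi (ι := ι)).c ξ (Pi.single j x) = Φ.c (ξ j) x := by
  show (∏ i, Φ.e (ξ i) ((Pi.single j x : ι → V) i)).re = _
  rw [Finset.prod_eq_single j (fun i _ hi => by rw [Pi.single_eq_of_ne hi, e_zero]) (by simp),
    Pi.single_eq_same, c]

end DualPairing

section Torus

variable (L k : ℕ)

/-- The steps of the walk on the product of a cycle and an eight dimensional torus. -/
def torusSteps : Finset (ZMod L × (Fin 8 → ZMod k)) :=
  ({(1, 0), (-1, 0)} ∪ Finset.univ.image fun j => (0, Pi.single j 1)) ∪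
    Finset.univ.image fun j => (0, -Pi.single j 1)

variable {L k}

lemma mem_torusSteps {g : ZMod L × (Fin 8 → ZMod k)} : g ∈ torusSteps L k ↔
    ((g = (1, 0) ∨ g = (-1, 0)) ∨ ∃ j, (0, Pi.single j 1) = g) ∨
      ∃ j, (0, -Pi.single j 1) = g := by
  simp [torusSteps, or_assoc]

lemma torusSteps_nonempty : (torusSteps L k).Nonempty := ⟨(1, 0), by simp [mem_torusSteps]⟩

lemma card_torusSteps_le : (torusSteps L k).card ≤ 18 := by
  refine (Finset.card_union_le _ _).trans ?_
  have h1 : (Finset.univ.image fun j : Fin 8 =>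
    ((0, -Pi.single j 1) : ZMod L × (Fin 8 → ZMod k))).card ≤ 8 := Finset.card_image_le
  have h2 : (Finset.univ.image fun j : Fin 8 =>
    ((0, Pi.single j 1) : ZMod L × (Fin 8 → ZMod k))).card ≤ 8 := Finset.card_image_le
  have h3 := Finset.card_union_le ({(1, 0), (-1, 0)} : Finset (ZMod L × (Fin 8 → ZMod k)))
    (Finset.univ.image fun j : Fin 8 => (0, Pi.single j 1))
  have h4 := Finset.card_le_two (a := ((1, 0) : ZMod L × (Fin 8 → ZMod k))) (b := (-1, 0))
  omega

lemma neg_mem_torusSteps {g : ZMod L × (Fin 8 → ZMod k)} (hg : g ∈ torusSteps L k) :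
    -g ∈ torusSteps L k := by
  rw [mem_torusSteps] at hg ⊢
  rcases hg with ((rfl | rfl) | ⟨j, rfl⟩) | ⟨j, rfl⟩
  · simp
  · simp
  · exact Or.inr ⟨j, by simp⟩
  · exact Or.inl (Or.inr ⟨j, by simp⟩)

lemma zero_notMem_torusSteps (hL : 2 ≤ L) (hk : 2 ≤ k) : 0 ∉ torusSteps L k := by
  have : Fact (1 < L) := ⟨hL⟩
  have : Fact (1 < k) := ⟨hk⟩
  rw [mem_torusSteps]
  simp [Prod.ext_iff, eq_comm (a := (0 : ZMod L))]

/-- Frequencies which are not constant on the torus factor. -/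
def torusFreq (L k : ℕ) [NeZero L] [NeZero k] : Finset (ZMod L × (Fin 8 → ZMod k)) :=
  Finset.univ.filter fun ξ => ξ.2 ≠ 0

variable (L k) [NeZero L] [NeZero k]

/-- The pairing on the product of a cycle and a torus. -/
def torusPairing : DualPairing (ZMod L × (Fin 8 → ZMod k)) :=
  (DualPairing.zmod L).prod (DualPairing.zmod k).pi

variable {L k}

lemma le_torus_mu_fst (ξ : ZMod L × (Fin 8 → ZMod k)) :
    4 / 9 * (ξ.1.valMinAbs.natAbs : ℝ) ^ 2 / L ^ 2 ≤ (torusPairing L k).mu (torusSteps L k) ξ := by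
  have h := (torusPairing L k).le_mu torusSteps_nonempty ξ (g := (1, 0)) (by simp [mem_torusSteps])
  rw [torusPairing, DualPairing.prod_c_left] at h
  have h1 := DualPairing.zmod_one_sub_c_one L ξ.1
  have h2 : (18 : ℝ)⁻¹ ≤ ((torusSteps L k).card : ℝ)⁻¹ :=
    inv_anti₀ (by exact_mod_cast torusSteps_nonempty.card_pos)
      (by exact_mod_cast card_torusSteps_le)
  refine le_trans ?_ h
  calc _ = (18 : ℝ)⁻¹ * (8 * (ξ.1.valMinAbs.natAbs : ℝ) ^ 2 / L ^ 2) := by ring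
    _ ≤ _ := mul_le_mul h2 h1 (by positivity) (by positivity)

lemma le_torus_mu_snd (ξ : ZMod L × (Fin 8 → ZMod k)) (j : Fin 8) :
    4 / 9 * ((ξ.2 j).valMinAbs.natAbs : ℝ) ^ 2 / k ^ 2
      ≤ (torusPairing L k).mu (torusSteps L k) ξ := by
  have h := (torusPairing L k).le_mu torusSteps_nonempty ξ (g := (0, Pi.single j 1))
    (by rw [mem_torusSteps]; exact Or.inl (Or.inr ⟨j, rfl⟩))
  rw [torusPairing, DualPairing.prod_c_right, DualPairing.pi_c_single] at h
  have h1 := DualPairing.zmod_one_sub_c_one k (ξ.2 j)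
  have h2 : (18 : ℝ)⁻¹ ≤ ((torusSteps L k).card : ℝ)⁻¹ :=
    inv_anti₀ (by exact_mod_cast torusSteps_nonempty.card_pos)
      (by exact_mod_cast card_torusSteps_le)
  refine le_trans ?_ h
  calc _ = (18 : ℝ)⁻¹ * (8 * ((ξ.2 j).valMinAbs.natAbs : ℝ) ^ 2 / k ^ 2) := by ring
    _ ≤ _ := mul_le_mul h2 h1 (by positivity) (by positivity)

lemma torus_mu_slow_le : (torusPairing L k).mu (torusSteps L k) (1, 0) ≤ 20 / L ^ 2 := by
  rw [DualPairing.mu_eq _ torusSteps_nonempty, inv_mul_le_iff₀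
    (by exact_mod_cast torusSteps_nonempty.card_pos), ← nsmul_eq_mul]
  refine Finset.sum_le_card_nsmul _ _ _ fun g hg => ?_
  have h1 := DualPairing.zmod_one_sub_c_one_one_le L
  have h0 : (0 : ℝ) ≤ 20 / L ^ 2 := by positivity
  rw [mem_torusSteps] at hg
  rcases hg with ((rfl | rfl) | ⟨j, rfl⟩) | ⟨j, rfl⟩
  · rwa [torusPairing, DualPairing.prod_c_left]
  · rwa [torusPairing, DualPairing.prod_c_left, DualPairing.c_neg]
  · rwa [torusPairing, DualPairing.prod_c_right, DualPairing.c_zero_left, sub_self]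
  · rwa [torusPairing, DualPairing.prod_c_right, DualPairing.c_zero_left, sub_self]

lemma natAbs_valMinAbs_pos {m : ℕ} {a : ZMod m} (ha : a ≠ 0) : 1 ≤ a.valMinAbs.natAbs := by
  rw [Nat.one_le_iff_ne_zero, Int.natAbs_ne_zero, Ne, ZMod.valMinAbs_eq_zero]
  exact ha

lemma torus_mu_pos {ξ : ZMod L × (Fin 8 → ZMod k)} (hξ : ξ ≠ 0) :
    0 < (torusPairing L k).mu (torusSteps L k) ξ := by
  have hL : (0 : ℝ) < L := by exact_mod_cast Nat.pos_of_ne_zero (NeZero.ne L)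
  have hk : (0 : ℝ) < k := by exact_mod_cast Nat.pos_of_ne_zero (NeZero.ne k)
  by_cases h : ξ.1 = 0
  · have h2 : ξ.2 ≠ 0 := fun h2 => hξ (Prod.ext h h2)
    obtain ⟨j, hj⟩ := Function.ne_iff.1 h2
    refine lt_of_lt_of_le ?_ (le_torus_mu_snd ξ j)
    have : (0 : ℝ) < (ξ.2 j).valMinAbs.natAbs := by exact_mod_cast natAbs_valMinAbs_pos hj
    positivity
  · refine lt_of_lt_of_le ?_ (le_torus_mu_fst ξ)
    have : (0 : ℝ) < ξ.1.valMinAbs.natAbs := by exact_mod_cast natAbs_valMinAbs_pos h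
    positivity

/-- The constant here is far from optimal. -/
lemma sum_torusFreq_le : ∑ ξ ∈ torusFreq L k, ((torusPairing L k).mu (torusSteps L k) ξ ^ 2)⁻¹
    ≤ 2000000 * (L * k ^ 8) := by
  have hk : (1 : ℝ) ≤ k := by exact_mod_cast Nat.one_le_iff_ne_zero.2 (NeZero.ne k)
  have hsk : 1 ≤ √(k : ℝ) := Real.one_le_sqrt.2 hk
  set w : ZMod k → ℝ := fun b => max 1 b.valMinAbs.natAbs with hw
  have hw1 : ∀ b, 1 ≤ w b := fun b => le_max_left _ _
  have hpt : ∀ ξ ∈ torusFreq L k, ((torusPairing L k).mu (torusSteps L k) ξ ^ 2)⁻¹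
      ≤ 81 / 16 * k ^ 4 * ∏ j, (√(w (ξ.2 j)))⁻¹ := by
    intro ξ hξ
    have h2 : ξ.2 ≠ 0 := (Finset.mem_filter.1 hξ).2
    obtain ⟨i, -, hi⟩ := Finset.exists_max_image Finset.univ
      (fun j => (ξ.2 j).valMinAbs.natAbs) Finset.univ_nonempty
    have hi1 : 1 ≤ (ξ.2 i).valMinAbs.natAbs := by
      obtain ⟨j, hj⟩ := Function.ne_iff.1 h2
      exact (natAbs_valMinAbs_pos hj).trans (hi j (Finset.mem_univ j))
    set m : ℝ := ((ξ.2 i).valMinAbs.natAbs : ℝ) with hm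
    have hm1 : (1 : ℝ) ≤ m := by rw [hm]; exact_mod_cast hi1
    have h3 : ∏ j, √(w (ξ.2 j)) ≤ m ^ 4 := by
      calc ∏ j, √(w (ξ.2 j)) ≤ ∏ j : Fin 8, √m := by
            refine Finset.prod_le_prod (fun j _ => Real.sqrt_nonneg _) fun j _ =>
              Real.sqrt_le_sqrt (max_le hm1 ?_)
            exact hm ▸ Nat.cast_le.2 (hi j (Finset.mem_univ j))
        _ = (√m ^ 2) ^ 4 := by
            rw [Finset.prod_const, Finset.card_univ, Fintype.card_fin, ← pow_mul]
        _ = m ^ 4 := by rw [Real.sq_sqrt (by linarith)]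
    have h4 := le_torus_mu_snd ξ i
    have h5 : 0 < ∏ j, √(w (ξ.2 j)) :=
      Finset.prod_pos fun j _ => Real.sqrt_pos.2 (by linarith [hw1 (ξ.2 j)])
    calc _ ≤ ((4 / 9 * m ^ 2 / k ^ 2) ^ 2)⁻¹ := by gcongr
      _ = 81 / 16 * k ^ 4 * (m ^ 4)⁻¹ := by field_simp; norm_num
      _ ≤ _ := by
        rw [Finset.prod_inv_distrib]
        gcongr
  have hsum : ∑ b : ZMod k, (√(w b))⁻¹ ≤ 5 * √k := by
    rw [← Finset.sum_add_sum_compl {0}, Finset.sum_singleton]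
    have h0 : (√(w 0))⁻¹ = 1 := by simp [hw]
    have h1 : ∑ b ∈ ({0} : Finset (ZMod k))ᶜ, (√(w b))⁻¹ ≤ 2 * (2 * √k) := by
      refine le_trans (Finset.sum_le_sum fun b hb => ?_) ((ZMod.sum_natAbs_valMinAbs_le k
        (f := fun v => (√(v : ℝ))⁻¹) (fun v => by positivity)).trans
          (mul_le_mul_of_nonneg_left (sum_inv_sqrt_le k) two_pos.le))
      have hb' : (1 : ℝ) ≤ b.valMinAbs.natAbs := by
        exact_mod_cast natAbs_valMinAbs_pos (by simpa using hb)
      simp only [hw]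
      rw [max_eq_right hb']
    linarith
  calc _ ≤ ∑ ξ ∈ torusFreq L k, 81 / 16 * (k : ℝ) ^ 4 * ∏ j, (√(w (ξ.2 j)))⁻¹ :=
        Finset.sum_le_sum hpt
    _ ≤ ∑ ξ : ZMod L × (Fin 8 → ZMod k), 81 / 16 * (k : ℝ) ^ 4 * ∏ j, (√(w (ξ.2 j)))⁻¹ :=
        Finset.sum_le_sum_of_subset_of_nonneg (Finset.filter_subset _ _) fun ξ _ _ => by positivity
    _ = 81 / 16 * (k : ℝ) ^ 4 * (L * ∏ j : Fin 8, ∑ b : ZMod k, (√(w b))⁻¹) := by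
        rw [← Finset.mul_sum, Fintype.sum_prod_type, Finset.prod_univ_sum, Fintype.piFinset_univ]
        dsimp only
        rw [Finset.sum_const, nsmul_eq_mul, Finset.card_univ, ZMod.card]
    _ ≤ 81 / 16 * (k : ℝ) ^ 4 * (L * (5 * √k) ^ 8) := by
        rw [Finset.prod_const, Finset.card_univ, Fintype.card_fin]
        gcongr
    _ = 81 / 16 * 5 ^ 8 * (L * k ^ 8) := by
        rw [mul_pow, show √(k : ℝ) ^ 8 = (√k ^ 2) ^ 4 by ring, Real.sq_sqrt (by linarith)]
        ring
    _ ≤ _ := by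
        gcongr
        norm_num

lemma sum_compl_torusFreq_eq (f : ZMod L × (Fin 8 → ZMod k) → ℝ) :
    ∑ ξ ∈ (insert 0 (torusFreq L k))ᶜ, f ξ = ∑ a ∈ ({0} : Finset (ZMod L))ᶜ, f (a, 0) := by
  have : (insert 0 (torusFreq L k))ᶜ = ({0} : Finset (ZMod L))ᶜ.image fun a => (a, 0) := by
    ext ⟨a, b⟩
    simp only [torusFreq, Finset.mem_compl, Finset.mem_insert, Finset.mem_filter, Finset.mem_univ,
      true_and, Finset.mem_image, Finset.mem_singleton, Prod.ext_iff, Prod.fst_zero, Prod.snd_zero]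
    constructor
    · intro h
      exact ⟨a, by tauto, rfl, by tauto⟩
    · rintro ⟨a', h, rfl, rfl⟩
      tauto
  rw [this, Finset.sum_image fun a _ b _ h => (Prod.ext_iff.1 h).1]

lemma sum_inv_torus_le :
    ∑ ξ ∈ (insert 0 (torusFreq L k))ᶜ, ((torusPairing L k).mu (torusSteps L k) ξ)⁻¹
      ≤ 9 * (L : ℝ) ^ 2 := by
  have hL : (0 : ℝ) < L := by exact_mod_cast Nat.pos_of_ne_zero (NeZero.ne L)
  rw [sum_compl_torusFreq_eq]
  have h := (ZMod.sum_natAbs_valMinAbs_le L (f := fun v => ((v : ℝ) ^ 2)⁻¹)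
    (fun v => by positivity)).trans (mul_le_mul_of_nonneg_left (sum_inv_sq_le L) two_pos.le)
  have h2 := mul_le_mul_of_nonneg_left h (show 0 ≤ 9 / 4 * (L : ℝ) ^ 2 by positivity)
  rw [Finset.mul_sum] at h2
  refine (Finset.sum_le_sum fun a ha => ?_).trans (h2.trans (le_of_eq (by ring)))
  have ha' : (0 : ℝ) < a.valMinAbs.natAbs := by
    exact_mod_cast natAbs_valMinAbs_pos (by simpa using ha)
  have h3 := le_torus_mu_fst (k := k) (a, 0)
  calc _ ≤ (4 / 9 * (a.valMinAbs.natAbs : ℝ) ^ 2 / L ^ 2)⁻¹ := by gcongr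
    _ = _ := by field_simp

lemma sum_inv_sq_torus_le :
    ∑ ξ ∈ (insert 0 (torusFreq L k))ᶜ, ((torusPairing L k).mu (torusSteps L k) ξ ^ 2)⁻¹
      ≤ 81 * ((L : ℝ) ^ 2) ^ 2 := by
  have h0 : ∀ ξ ∈ (insert 0 (torusFreq L k))ᶜ,
      0 ≤ ((torusPairing L k).mu (torusSteps L k) ξ)⁻¹ := fun ξ hξ =>
    inv_nonneg.2 (torus_mu_pos fun h => by simp [h] at hξ).le
  have h := Finset.sum_sq_le_sq_sum_of_nonneg h0
  simp only [inv_pow] at h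
  refine h.trans ?_
  calc _ ≤ (9 * (L : ℝ) ^ 2) ^ 2 := pow_le_pow_left₀ (Finset.sum_nonneg h0) sum_inv_torus_le 2
    _ = _ := by ring

/-- The product of a cycle and a torus satisfies the spectral bounds, once the length of the cycle
is comparable to the volume of the torus divided by its logarithm. -/
theorem torus_spectralBounds (hL : 2 ≤ L) {C : ℝ} (hC : 2000000 ≤ C)
    (h1 : L * Real.log (L * k ^ 8) ≤ C * k ^ 8) (h2 : k ^ 8 ≤ C * (L * Real.log (L * k ^ 8)))
    (h3 : 1 ≤ Real.log (L * k ^ 8)) (h4 : Real.log (L * k ^ 8) ^ 2 ≤ L * k ^ 8) :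
    (torusPairing L k).SpectralBounds (torusSteps L k) (torusFreq L k) C (L ^ 2) := by
  have hL0 : (0 : ℝ) < L := by exact_mod_cast Nat.pos_of_ne_zero (NeZero.ne L)
  have hcard : (Fintype.card (ZMod L × (Fin 8 → ZMod k)) : ℝ) = L * k ^ 8 := by
    simp [ZMod.card]
  have : Fact (1 < L) := ⟨hL⟩
  constructor
  · exact torusSteps_nonempty
  · exact fun g => neg_mem_torusSteps
  · exact fun ξ => torus_mu_pos
  · simp [torusFreq]
  · simp [torusFreq]
  · linarith
  · positivity
  · rw [hcard]; nlinarith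
  · rw [hcard]; nlinarith
  · rw [hcard]
    refine sum_torusFreq_le.trans (mul_le_mul_of_nonneg_right hC (by positivity))
  · exact sum_inv_torus_le.trans (mul_le_mul_of_nonneg_right (by linarith) (by positivity))
  · exact sum_inv_sq_torus_le.trans (mul_le_mul_of_nonneg_right (by linarith) (by positivity))
  · exact ⟨(1, 0), by simp [Prod.ext_iff], torus_mu_slow_le.trans
      (div_le_div_of_nonneg_right (by linarith) (by positivity))⟩
  · rwa [hcard]
  · rwa [hcard]

end Torus

section Cayley

variable {V : Type} [AddCommGroup V] {S : Finset V}

/-- The Cayley graph of an abelian group. -/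
def cayleyGraph (S : Finset V) (hneg : ∀ g ∈ S, -g ∈ S) (h0 : 0 ∉ S) : SimpleGraph V where
  Adj x y := y - x ∈ S
  symm := ⟨fun x y h => by simpa using hneg _ h⟩
  loopless := ⟨fun x h => h0 (by simpa using h)⟩

variable {hneg : ∀ g ∈ S, -g ∈ S} {h0 : 0 ∉ S}

instance [DecidableEq V] : DecidableRel (cayleyGraph S hneg h0).Adj := fun x y =>
  inferInstanceAs (Decidable (y - x ∈ S))

lemma cayleyGraph_adj {x y : V} : (cayleyGraph S hneg h0).Adj x y ↔ y - x ∈ S := Iff.rfl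

lemma cayleyGraph_isVertexTransitive : IsVertexTransitive (cayleyGraph S hneg h0) := fun x y =>
  ⟨⟨Equiv.addRight (y - x), by simp [cayleyGraph_adj]⟩, by simp⟩

lemma cayleyGraph_degree [DecidableEq V] [Fintype V] (x : V) :
    (cayleyGraph S hneg h0).degree x = S.card := by
  rw [← SimpleGraph.card_neighborFinset_eq_degree,
    ← Finset.card_image_of_injective S (add_right_injective x)]
  congr 1
  ext y
  simp only [SimpleGraph.mem_neighborFinset, cayleyGraph_adj, Finset.mem_image]
  exact ⟨fun h => ⟨y - x, h, by abel⟩, by rintro ⟨g, hg, rfl⟩; simpa using hg⟩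

lemma transMat_cayleyGraph [DecidableEq V] [Fintype V] :
    transMat (cayleyGraph S hneg h0) = stepMat S := by
  ext x y
  simp [transMat, stepMat, cayleyGraph_degree, cayleyGraph_adj]

lemma cayleyGraph_walk_nsmul {g : V} (hg : g ∈ S) (x : V) (m : ℕ) :
    ∃ p : (cayleyGraph S hneg h0).Walk x (x + m • g), p.length = m := by
  induction m generalizing x with
  | zero => exact ⟨SimpleGraph.Walk.nil.copy rfl (by simp), by simp⟩
  | succ m ih =>
    obtain ⟨p, hp⟩ := ih (x + g)
    have h : (cayleyGraph S hneg h0).Adj x (x + g) := by simpa [cayleyGraph_adj] using hg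
    exact ⟨(SimpleGraph.Walk.cons h p).copy rfl (by rw [succ_nsmul]; abel), by simp [hp]⟩

lemma cayleyGraph_walk_zsmul {g : V} (hg : g ∈ S) (x : V) (m : ℤ) :
    ∃ p : (cayleyGraph S hneg h0).Walk x (x + m • g), p.length = m.natAbs := by
  rcases Int.natAbs_eq m with h | h
  · obtain ⟨p, hp⟩ := cayleyGraph_walk_nsmul (hneg := hneg) (h0 := h0) hg x m.natAbs
    exact ⟨p.copy rfl (by rw [← natCast_zsmul, ← h]), by simp [hp]⟩
  · obtain ⟨p, hp⟩ := cayleyGraph_walk_nsmul (hneg := hneg) (h0 := h0) (hneg g hg) x m.natAbs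
    exact ⟨p.copy rfl (by rw [smul_neg, ← natCast_zsmul, ← neg_smul, ← h]), by simp [hp]⟩

end Cayley

section Torus

variable {L k : ℕ}

/-- The Cayley graph of the product of a cycle and an eight dimensional torus. -/
abbrev torusGraph (hL : 2 ≤ L) (hk : 2 ≤ k) : SimpleGraph (ZMod L × (Fin 8 → ZMod k)) :=
  cayleyGraph (torusSteps L k) (fun _ => neg_mem_torusSteps) (zero_notMem_torusSteps hL hk)

lemma le_length_torusGraph_walk (hL : 2 ≤ L) (hk : 2 ≤ k) {x y : ZMod L × (Fin 8 → ZMod k)}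
    (p : (torusGraph hL hk).Walk x y) : (y.1 - x.1).valMinAbs.natAbs ≤ p.length := by
  induction p with
  | nil => simp
  | @cons u v w h p ih =>
    have hstep : (v.1 - u.1).valMinAbs.natAbs ≤ 1 := by
      have h1 : ((1 : ZMod L).valMinAbs).natAbs ≤ 1 := by
        have := ZMod.valMinAbs_natCast_of_le_half (n := L) (a := 1) (by omega)
        rw [Nat.cast_one] at this
        rw [this]; simp
      have h2 := mem_torusSteps.1 (cayleyGraph_adj.1 h)
      rw [show v.1 - u.1 = (v - u).1 from rfl]
      rcases h2 with ((h2 | h2) | ⟨j, h2⟩) | ⟨j, h2⟩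
      · rwa [h2]
      · rwa [h2, ZMod.natAbs_valMinAbs_neg]
      · simp [← h2]
      · simp [← h2]
    have h3 := ZMod.natAbs_valMinAbs_add_le (w.1 - v.1) (v.1 - u.1)
    have h4 := Int.natAbs_add_le (w.1 - v.1).valMinAbs (v.1 - u.1).valMinAbs
    rw [sub_add_sub_cancel] at h3
    rw [SimpleGraph.Walk.length_cons]
    omega

variable [NeZero k]

lemma torusGraph_walk_pi (hL : 2 ≤ L) (hk : 2 ≤ k) (x : ZMod L × (Fin 8 → ZMod k))
    (b : Fin 8 → ZMod k) (s : Finset (Fin 8)) :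
    ∃ p : (torusGraph hL hk).Walk x (x + (0, ∑ j ∈ s, Pi.single j (b j))),
      p.length ≤ s.card * k := by
  induction s using Finset.induction_on with
  | empty => exact ⟨SimpleGraph.Walk.nil.copy rfl (by simp), by simp⟩
  | insert j s hj ih =>
    obtain ⟨p, hp⟩ := ih
    obtain ⟨q, hq⟩ := cayleyGraph_walk_zsmul (S := torusSteps L k)
      (hneg := fun _ => neg_mem_torusSteps) (h0 := zero_notMem_torusSteps hL hk)
      (g := (0, Pi.single j 1)) (by rw [mem_torusSteps]; exact Or.inl (Or.inr ⟨j, rfl⟩))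
      (x + (0, ∑ j ∈ s, Pi.single j (b j))) (b j).valMinAbs
    refine ⟨(p.append q).copy rfl ?_, ?_⟩
    · rw [Finset.sum_insert hj, add_assoc, Prod.smul_mk, smul_zero, ← Pi.single_smul,
        zsmul_one, ZMod.coe_valMinAbs,
        add_comm (Pi.single j (b j) : Fin 8 → ZMod k)]
      congr 1
      ext <;> simp
    · have := (ZMod.natAbs_valMinAbs_le (b j)).trans (Nat.div_le_self _ _)
      rw [SimpleGraph.Walk.length_copy, SimpleGraph.Walk.length_append, hq,
        Finset.card_insert_of_notMem hj, add_mul, one_mul]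
      omega

variable [NeZero L]

lemma torusGraph_walk (hL : 2 ≤ L) (hk : 2 ≤ k) (x y : ZMod L × (Fin 8 → ZMod k)) :
    ∃ p : (torusGraph hL hk).Walk x y, p.length ≤ L / 2 + 8 * k := by
  obtain ⟨q, hq⟩ := cayleyGraph_walk_zsmul (S := torusSteps L k)
    (hneg := fun _ => neg_mem_torusSteps) (h0 := zero_notMem_torusSteps hL hk)
    (g := (1, 0)) (by simp [mem_torusSteps]) x (y.1 - x.1).valMinAbs
  obtain ⟨p, hp⟩ := torusGraph_walk_pi hL hk (x + (y.1 - x.1).valMinAbs • (1, 0)) (y.2 - x.2)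
    Finset.univ
  refine ⟨(q.append p).copy rfl ?_, ?_⟩
  · rw [Finset.univ_sum_single]
    ext <;> simp
  · have := ZMod.natAbs_valMinAbs_le (y.1 - x.1)
    rw [Finset.card_univ, Fintype.card_fin] at hp
    rw [SimpleGraph.Walk.length_copy, SimpleGraph.Walk.length_append]
    omega

lemma torusGraph_connected (hL : 2 ≤ L) (hk : 2 ≤ k) : (torusGraph hL hk).Connected where
  preconnected x y := (torusGraph_walk hL hk x y).choose.reachable

lemma gDiam_torusGraph_le (hL : 2 ≤ L) (hk : 2 ≤ k) : gDiam (torusGraph hL hk) ≤ L / 2 + 8 * k :=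
  Finset.sup_le fun q _ =>
    let ⟨p, hp⟩ := torusGraph_walk hL hk q.1 q.2
    (SimpleGraph.dist_le p).trans hp

lemma le_gDiam_torusGraph (hL : 2 ≤ L) (hk : 2 ≤ k) : L / 2 ≤ gDiam (torusGraph hL hk) := by
  refine le_trans ?_ (Finset.le_sup (f := fun p : (ZMod L × (Fin 8 → ZMod k)) × _ =>
    (torusGraph hL hk).dist p.1 p.2) (Finset.mem_univ (0, (((L / 2 : ℕ) : ZMod L), 0))))
  obtain ⟨p, hp⟩ := (torusGraph_connected hL hk).exists_walk_length_eq_dist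
    0 (((L / 2 : ℕ) : ZMod L), 0)
  have h := le_length_torusGraph_walk hL hk p
  rw [hp] at h
  refine le_trans (le_of_eq ?_) h
  show L / 2 = ((((L / 2 : ℕ) : ZMod L) - 0).valMinAbs).natAbs
  rw [sub_zero, ZMod.valMinAbs_natCast_of_le_half le_rfl, Int.natAbs_natCast]

/-- The random walk on the product of a cycle and a torus. -/
theorem exists_torus_walk (hL : 2 ≤ L) (hk : 2 ≤ k) :
    ∃ B : GW, B.nV = L * k ^ 8 ∧ B.G.Connected ∧ IsVertexTransitive B.G ∧
      (∀ x, B.G.degree x ≤ 18) ∧ L / 2 ≤ B.D ∧ B.D ≤ L / 2 + 8 * k ∧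
      ∀ C : ℝ, 2000000 ≤ C → L * Real.log (L * k ^ 8) ≤ C * k ^ 8 →
        k ^ 8 ≤ C * (L * Real.log (L * k ^ 8)) → 1 ≤ Real.log (L * k ^ 8) →
        Real.log (L * k ^ 8) ^ 2 ≤ L * k ^ 8 → B.Spectral C := by
  have hK : transMat (torusGraph hL hk) = stepMat (torusSteps L k) := transMat_cayleyGraph
  obtain ⟨W, hW⟩ := CTMC.exists_regular torusSteps_nonempty hK
  refine ⟨⟨_, torusGraph hL hk, W⟩, ?_, torusGraph_connected hL hk,
    cayleyGraph_isVertexTransitive (hneg := fun _ => neg_mem_torusSteps)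
      (h0 := zero_notMem_torusSteps hL hk), fun x => ?_, le_gDiam_torusGraph hL hk,
    gDiam_torusGraph_le hL hk, fun C hC h1 h2 h3 h4 => ?_⟩
  · show Fintype.card (ZMod L × (Fin 8 → ZMod k)) = _
    simp [ZMod.card]
  · exact (cayleyGraph_degree (hneg := fun _ => neg_mem_torusSteps)
      (h0 := zero_notMem_torusSteps hL hk) x).trans_le card_torusSteps_le
  · exact ⟨inferInstance, torusPairing L k, torusSteps L k, torusFreq L k, _, hK, hW,
      torus_spectralBounds hL hC h1 h2 h3 h4⟩

end Torus

/-- The length of the cycle, for a torus of side `k`. -/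
def cycleLength (a : ℝ) (k : ℕ) : ℕ := max 2 ⌊2 / a * ((k : ℝ) ^ 8 / Real.log ((k : ℝ) ^ 8))⌋₊

section

variable {a : ℝ}

lemma tendsto_natCast_pow_eight : Tendsto (fun k : ℕ => (k : ℝ) ^ 8) atTop atTop :=
  (tendsto_pow_atTop (by norm_num)).comp tendsto_natCast_atTop_atTop

lemma tendsto_log_pow_eight : Tendsto (fun k : ℕ => Real.log ((k : ℝ) ^ 8)) atTop atTop :=
  Real.tendsto_log_atTop.comp tendsto_natCast_pow_eight

lemma tendsto_pow_div_log : Tendsto (fun k : ℕ => (k : ℝ) ^ 8 / Real.log ((k : ℝ) ^ 8))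
    atTop atTop := by
  refine ((Real.tendsto_exp_div_pow_atTop 1).comp tendsto_log_pow_eight).congr' ?_
  filter_upwards [eventually_gt_atTop 0] with k hk
  simp only [Function.comp, pow_one]
  rw [Real.exp_log (by positivity)]

lemma tendsto_cycleLength_mul_log (ha : 0 < a) :
    Tendsto (fun k : ℕ => cycleLength a k * Real.log ((k : ℝ) ^ 8) / (k : ℝ) ^ 8) atTop
      (nhds (2 / a)) := by
  have hX := tendsto_pow_div_log.const_mul_atTop (div_pos two_pos ha)
  have h := ((tendsto_nat_floor_div_atTop (R := ℝ)).comp hX).mul_const (2 / a)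
  rw [one_mul] at h
  refine h.congr' ?_
  filter_upwards [eventually_gt_atTop 0, tendsto_log_pow_eight.eventually_gt_atTop 0,
    hX.eventually_ge_atTop 2] with k hk hl hx
  have h2 : 2 ≤ ⌊2 / a * ((k : ℝ) ^ 8 / Real.log ((k : ℝ) ^ 8))⌋₊ :=
    Nat.le_floor (by exact_mod_cast hx)
  simp only [Function.comp, cycleLength, max_eq_right h2]
  have : (0 : ℝ) < k := by exact_mod_cast hk
  field_simp

lemma cycleLength_pos (a : ℝ) (k : ℕ) : 0 < cycleLength a k :=
  two_pos.trans_le (le_max_left _ _)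

lemma tendsto_cycleLength_mul_log_card (ha : 0 < a) :
    Tendsto (fun k : ℕ => cycleLength a k * Real.log (cycleLength a k * (k : ℝ) ^ 8) / (k : ℝ) ^ 8)
      atTop (nhds (4 / a)) := by
  have hr := tendsto_cycleLength_mul_log ha
  have h1 := (hr.log (div_pos two_pos ha).ne').div_atTop tendsto_log_pow_eight
  have h2 := (Real.isLittleO_log_id_atTop.tendsto_div_nhds_zero).comp tendsto_log_pow_eight
  have h := hr.mul ((h1.sub h2).const_add 2)
  rw [sub_zero, add_zero, show 2 / a * 2 = 4 / a by ring] at h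
  refine h.congr' ?_
  filter_upwards [eventually_gt_atTop 0, tendsto_log_pow_eight.eventually_gt_atTop 0] with k hk hl
  have hk' : (0 : ℝ) < (k : ℝ) ^ 8 := by positivity
  have hL : (0 : ℝ) < cycleLength a k := by exact_mod_cast cycleLength_pos a k
  simp only [Function.comp, id]
  rw [Real.log_div (by positivity) hk'.ne', Real.log_mul hL.ne' hl.ne', Real.log_mul hL.ne' hk'.ne']
  field_simp
  ring

lemma tendsto_div_cycleLength (ha : 0 < a) :
    Tendsto (fun k : ℕ => (k : ℝ) / cycleLength a k) atTop (nhds 0) := by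
  have h1 := (Real.isLittleO_log_id_atTop.tendsto_div_nhds_zero).comp
    (tendsto_natCast_atTop_atTop (R := ℝ))
  have h2 : Tendsto (fun k : ℕ => (((k : ℝ) ^ 6)⁻¹)) atTop (nhds 0) :=
    tendsto_inv_atTop_zero.comp ((tendsto_pow_atTop (by norm_num)).comp tendsto_natCast_atTop_atTop)
  have h := ((h1.mul h2).const_mul 8).div (tendsto_cycleLength_mul_log ha)
    (div_pos two_pos ha).ne'
  rw [mul_zero, mul_zero, zero_div] at h
  refine h.congr' ?_
  filter_upwards [eventually_gt_atTop 0, tendsto_log_pow_eight.eventually_gt_atTop 0] with k hk hl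
  have hk' : (0 : ℝ) < k := by exact_mod_cast hk
  have hL : (0 : ℝ) < cycleLength a k := by exact_mod_cast cycleLength_pos a k
  rw [Real.log_pow, Nat.cast_ofNat] at hl
  simp only [Pi.div_apply, Function.comp, id]
  rw [Real.log_pow, Nat.cast_ofNat]
  have hl' : Real.log k ≠ 0 := by intro h; simp [h] at hl
  field_simp

end

lemma exists_torus_sequence {a : ℝ} (ha : 0 < a) :
    ∃ (B : ℕ → GW) (C : ℝ),
      (∀ n, (B n).G.Connected) ∧ (∀ n, IsVertexTransitive (B n).G) ∧
      (∀ n (x : (B n).V), (B n).G.degree x ≤ 18) ∧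
      Tendsto (fun n => (B n).nV) atTop atTop ∧
      Tendsto (fun n => ((B n).D : ℝ) ^ 2 * (a * Real.log ((B n).nV)) / ((B n).nV))
        atTop (nhds 1) ∧
      ∀ᶠ n in atTop, (B n).Spectral C := by
  have hex : ∀ n : ℕ, _ := fun n =>
    have : NeZero (cycleLength a (n + 2)) := ⟨(cycleLength_pos _ _).ne'⟩
    exists_torus_walk (L := cycleLength a (n + 2)) (k := n + 2) (le_max_left _ _) (by omega)
  choose B hcard hconn htrans hdeg hD1 hD2 hspec using hex
  have hshift : Tendsto (fun n : ℕ => n + 2) atTop atTop := tendsto_add_atTop_nat 2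
  have hcard' : ∀ n, ((B n).nV : ℝ) = cycleLength a (n + 2) * ((n + 2 : ℕ) : ℝ) ^ 8 := fun n => by
    rw [hcard]; push_cast; ring
  have hL0 : ∀ n, (0 : ℝ) < cycleLength a (n + 2) := fun n => by
    exact_mod_cast cycleLength_pos a (n + 2)
  have hnV : Tendsto (fun n => (B n).nV) atTop atTop := by
    refine tendsto_atTop_mono (fun n => ?_) tendsto_id
    rw [hcard, id]
    calc n ≤ n + 2 := by omega
      _ ≤ (n + 2) ^ 8 := Nat.le_self_pow (by norm_num) _
      _ ≤ _ := Nat.le_mul_of_pos_left _ (cycleLength_pos _ _)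
  have hlim := (tendsto_cycleLength_mul_log_card ha).comp hshift
  refine ⟨B, max 2000000 (8 / a + a), hconn, htrans, hdeg, hnV, ?_, ?_⟩
  · have hk := ((tendsto_div_cycleLength ha).comp hshift).const_mul 8
    rw [mul_zero] at hk
    have hDL : Tendsto (fun n => ((B n).D : ℝ) / cycleLength a (n + 2)) atTop (nhds (1 / 2)) := by
      rw [tendsto_iff_dist_tendsto_zero]
      refine squeeze_zero (fun _ => dist_nonneg) (fun n => ?_) hk
      have h1 : (cycleLength a (n + 2) : ℝ) ≤ 2 * (B n).D + 1 := by
        have := hD1 n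
        exact_mod_cast (by omega : cycleLength a (n + 2) ≤ 2 * (B n).D + 1)
      have h2 : (2 * (B n).D : ℝ) ≤ cycleLength a (n + 2) + 16 * ((n + 2 : ℕ) : ℝ) := by
        have := hD2 n
        exact_mod_cast (by omega : 2 * (B n).D ≤ cycleLength a (n + 2) + 16 * (n + 2))
      have h3 : (1 : ℝ) ≤ ((n + 2 : ℕ) : ℝ) := by exact_mod_cast (by omega : 1 ≤ n + 2)
      have hL := hL0 n
      simp only [Function.comp]
      rw [Real.dist_eq, div_sub_div _ _ hL.ne' two_ne_zero, abs_div,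
        abs_of_pos (mul_pos hL two_pos), mul_div_assoc', div_le_div_iff₀ (mul_pos hL two_pos) hL,
        mul_comm (_ : ℝ) (cycleLength _ _ * 2 : ℝ), mul_comm (|_|), mul_assoc (cycleLength _ _ : ℝ)]
      refine mul_le_mul_of_nonneg_left ?_ hL.le
      rw [abs_le]
      constructor <;> linarith
    have h := (hDL.pow 2).mul (hlim.const_mul a)
    rw [show (1 / 2 : ℝ) ^ 2 * (a * (4 / a)) = 1 by field_simp; norm_num] at h
    refine h.congr fun n => ?_
    have hL := hL0 n
    simp only [Function.comp]
    rw [hcard']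
    field_simp
  · have hlog := tendsto_log_nV hnV
    have hsq : ∀ᶠ n in atTop, Real.log ((B n).nV) ^ 2 ≤ (B n).nV := by
      have := (Real.isLittleO_pow_log_id_atTop (n := 2)).tendsto_div_nhds_zero.comp
        (tendsto_natCast_atTop_atTop.comp hnV)
      filter_upwards [this.eventually_lt_const one_pos, hnV.eventually_gt_atTop 0] with n h h0
      have h0' : (0 : ℝ) < (B n).nV := by exact_mod_cast h0
      simp only [Function.comp, id] at h
      exact ((div_lt_one h0').1 h).le
    have h48 : 4 / a < max 2000000 (8 / a + a) := by
      refine lt_of_lt_of_le ?_ (le_max_right _ _)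
      have : 4 / a < 8 / a := div_lt_div_of_pos_right (by norm_num) ha
      linarith
    have h14 : (max 2000000 (8 / a + a))⁻¹ < 4 / a := by
      rw [inv_lt_comm₀ (lt_max_of_lt_left (by norm_num)) (by positivity), inv_div]
      refine lt_of_lt_of_le ?_ (le_max_right _ _)
      have : 0 < 8 / a := by positivity
      linarith
    filter_upwards [hlog.eventually_ge_atTop 1, hsq, hlim.eventually_lt_const h48,
      hlim.eventually_const_lt h14] with n h3 h4 h1 h2
    have hk : (0 : ℝ) < ((n + 2 : ℕ) : ℝ) ^ 8 := by positivity
    rw [hcard'] at h3 h4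
    simp only [Function.comp] at h1 h2
    refine hspec n _ (le_max_left _ _) ((div_lt_iff₀ hk).1 h1).le ?_ h3 h4
    rw [inv_lt_iff_one_lt_mul₀ (lt_max_of_lt_left (by norm_num)), div_mul_eq_mul_div,
      lt_div_iff₀ hk, one_mul] at h2
    exact (h2.trans_eq (mul_comm _ _)).le

/-- Theorem 1.2: sharpness of the diameter condition. For every `a > 0`
there is a sequence of finite connected vertex-transitive graphs of diverging sizes and
uniformly bounded degree with `D² ∼ |V_n|/(a log |V_n|)`, and there are `s(a)` and
`c(a) > 0`, such that for all `s ≥ s(a)` the limsup of `P(τ_cov > t_s)` is at most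
`P(χ > s) - c(a) e^{-2s}` (for a standard Gumbel `χ`); furthermore the sequence is
strongly uniformly transient. -/
theorem diameter_condition_sharp :
    ∀ a : ℝ, 0 < a →
      ∃ (B : ℕ → GW) (d : ℕ) (o : (n : ℕ) → (B n).V),
        (∀ n, (B n).G.Connected) ∧
        (∀ n, IsVertexTransitive (B n).G) ∧
        (∀ n (x : (B n).V), (B n).G.degree x ≤ d) ∧
        Tendsto (fun n => (B n).nV) atTop atTop ∧
        Tendsto (fun n => ((B n).D : ℝ) ^ 2 * (a * Real.log ((B n).nV)) / ((B n).nV))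
          atTop (nhds 1) ∧
        (∃ s0 c : ℝ, 0 < c ∧ ∀ s : ℝ, s0 ≤ s → ∀ x0 : (n : ℕ) → (B n).V,
          Filter.limsup (fun n =>
              (B n).W.prx (x0 n)
                {ω | (B n).W.epi ((B n).W.hit {o n}) * (Real.log ((B n).nV) + s) <
                    (B n).W.cov ω}) atTop
            ≤ (1 - Real.exp (-Real.exp (-s))) - c * Real.exp (-2 * s)) ∧
        Tendsto (fun s : ℝ =>
            Filter.limsup (fun n =>
                ⨆ x : (B n).V,
                  (B n).W.ex x (fun ω =>
                    (B n).W.loc x (tmixTV (transMat (B n).G)) ω - (B n).W.loc x s ω))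
              atTop)
          atTop (nhds 0) := by
  intro a ha
  obtain ⟨B, C, hconn, htrans, hdeg, hnV, hdiam, hspec⟩ := exists_torus_sequence ha
  let o : (n : ℕ) → (B n).V := fun n => (hconn n).nonempty.some
  exact ⟨B, 18, o, hconn, htrans, hdeg, hnV, hdiam, limsup_prx_le hspec hnV o,
    tendsto_limsup_ex_loc hspec hnV⟩
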